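/- Let α ∈ (0,1) be a Liouville number. For every lift g of an orientation-preserving C^∞ circle diffeomorphism with rotation number ρ(g) = α, every r ∈ ℕ and every ε > 0, there exists a lift f of an orientation-preserving C^∞ circle diffeomorphism with rotation number ρ(f) = α such that d_r(f, g) < ε and the circle diffeomorphism induced by f admits an invariant Borel probability measure equivalent to the Lebesgue measure m (i.e. it is of type II₁). -/

import Mathlib

noncomputable section
open MeasureTheory Filter Topology

/-- A lift of an orientation-preserving `C^∞` circle diffeomorphism: a `C^∞` map
`f : ℝ → ℝ` with `f (x+1) = f x + 1` and everywhere positive derivative. -/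
def IsCircleDiffeoLift (f : ℝ → ℝ) : Prop :=
  ContDiff ℝ (⊤ : ℕ∞) f ∧ (∀ x : ℝ, f (x + 1) = f x + 1) ∧ ∀ x : ℝ, 0 < deriv f x

/-- The `C^r` norm `‖φ‖_r = max_{0 ≤ i ≤ r} sup_x |φ^{(i)}(x)|`. -/
def CrNorm (r : ℕ) (φ : ℝ → ℝ) : ℝ :=
  (Finset.range (r + 1)).sup' (Finset.nonempty_range_iff.mpr r.succ_ne_zero)
    fun i => ⨆ x : ℝ, |iteratedDeriv i φ x|

/-- `d_r(f, g) = max {‖f - g‖_r, ‖f⁻¹ - g⁻¹‖_r}`. -/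
def liftDist (r : ℕ) (f g : ℝ → ℝ) : ℝ :=
  max (CrNorm r (fun x => f x - g x))
    (CrNorm r (fun x => Function.invFun f x - Function.invFun g x))

/-- `|f|_r = max {‖f - id‖_r, ‖f⁻¹ - id‖_r, 1}`. -/
def liftNorm (r : ℕ) (f : ℝ → ℝ) : ℝ :=
  max (max (CrNorm r (fun x => f x - x)) (CrNorm r (fun x => Function.invFun f x - x))) 1

/-- The lift `x ↦ x + a` of the rotation by `a`. -/
def RotLift (a : ℝ) : ℝ → ℝ := fun x => x + a

/-- The rotation number of the circle diffeomorphism induced by the lift `f` equals `a`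
(mod 1): the translation number `lim (fⁿ(0) - 0)/n` equals `a + k` for some integer `k`. -/
def HasRotationNumber (f : ℝ → ℝ) (a : ℝ) : Prop :=
  ∃ k : ℤ, Tendsto (fun n : ℕ => f^[n] 0 / (n : ℝ)) atTop (nhds (a + k))

/-- The lift of the `i`-th iterate (`i ∈ ℤ`) of the circle diffeomorphism induced by `f`. -/
def zpowLift (f : ℝ → ℝ) : ℤ → ℝ → ℝ := fun i =>
  if 0 ≤ i then f^[i.toNat] else (Function.invFun f)^[(-i).toNat]

/-- The ratio set of a circle diffeomorphism, described through the family `Fz i` of its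
iterates (`i ∈ ℤ`) and the family `D i` of the derivatives of its iterates: `t ≥ 0` lies in
the ratio set iff for every Borel `A` of positive Haar measure and every `ε > 0` there are a
Borel `B ⊆ A` of positive measure and `i ∈ ℤ` with `Fz i '' B ⊆ A` and `|D i x - t| < ε`
on `B`. -/
def ratioSet (Fz : ℤ → UnitAddCircle → UnitAddCircle) (D : ℤ → UnitAddCircle → ℝ) : Set ℝ :=
  {t : ℝ | 0 ≤ t ∧ ∀ A : Set UnitAddCircle, MeasurableSet A → 0 < volume A →
    ∀ ε : ℝ, 0 < ε → ∃ B : Set UnitAddCircle, MeasurableSet B ∧ B ⊆ A ∧ 0 < volume B ∧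
      ∃ i : ℤ, Fz i '' B ⊆ A ∧ ∀ x ∈ B, |D i x - t| < ε}

/-- A lift of an orientation-preserving `C¹` circle diffeomorphism. -/
def IsC1CircleLift (f : ℝ → ℝ) : Prop :=
  ContDiff ℝ 1 f ∧ (∀ x : ℝ, f (x + 1) = f x + 1) ∧ ∀ x : ℝ, 0 < deriv f x

open scoped ContDiff

/-! ### Calculus of iterated derivatives -/

lemma ContDiff.infty_of_deriv {φ : ℝ → ℝ} (h : ContDiff ℝ ∞ φ) : ContDiff ℝ ∞ (deriv φ) :=
  (contDiff_infty_iff_deriv.1 h).2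

lemma ContDiff.infty_iteratedDeriv {φ : ℝ → ℝ} (h : ContDiff ℝ ∞ φ) (n : ℕ) :
    ContDiff ℝ ∞ (iteratedDeriv n φ) := by
  induction n with
  | zero => simpa using h
  | succ n ih => rw [iteratedDeriv_succ]; exact ih.infty_of_deriv

lemma ContDiff.infty_contDiffAt {φ : ℝ → ℝ} (h : ContDiff ℝ ∞ φ) (n : ℕ) (x : ℝ) :
    ContDiffAt ℝ n φ x :=
  (h.of_le (by exact_mod_cast le_top)).contDiffAt

lemma ContDiff.infty_differentiable {φ : ℝ → ℝ} (h : ContDiff ℝ ∞ φ) : Differentiable ℝ φ :=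
  h.differentiable (by simp)

lemma abs_iteratedDeriv_comp_le {g f : ℝ → ℝ} (hg : ContDiff ℝ ∞ g) (hf : ContDiff ℝ ∞ f)
    {n : ℕ} {x C D : ℝ} (hC : ∀ i ≤ n, |iteratedDeriv i g (f x)| ≤ C)
    (hD : ∀ i, 1 ≤ i → i ≤ n → |iteratedDeriv i f x| ≤ D ^ i) :
    |iteratedDeriv n (g ∘ f) x| ≤ n.factorial * C * D ^ n := by
  have := norm_iteratedFDeriv_comp_le (𝕜 := ℝ) (N := ∞) hg hf
    (n := n) (by exact_mod_cast le_top) x (C := C) (D := D)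
    (fun i hi => by rw [norm_iteratedFDeriv_eq_norm_iteratedDeriv]; exact hC i hi)
    (fun i h1 hi => by rw [norm_iteratedFDeriv_eq_norm_iteratedDeriv]; exact hD i h1 hi)
  rwa [norm_iteratedFDeriv_eq_norm_iteratedDeriv] at this

lemma abs_iteratedDeriv_mul_le {u v : ℝ → ℝ} (hu : ContDiff ℝ ∞ u) (hv : ContDiff ℝ ∞ v)
    {n : ℕ} {x C₁ C₂ B : ℝ} (h₁ : ∀ i ≤ n, |iteratedDeriv i u x| ≤ C₁ * B ^ i)
    (h₂ : ∀ i ≤ n, |iteratedDeriv i v x| ≤ C₂ * B ^ i) :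
    |iteratedDeriv n (fun x => u x * v x) x| ≤ 2 ^ n * C₁ * C₂ * B ^ n := by
  rw [iteratedDeriv_fun_mul (hu.infty_contDiffAt n x) (hv.infty_contDiffAt n x)]
  refine (Finset.abs_sum_le_sum_abs _ _).trans ?_
  have : ∀ i ∈ Finset.range (n + 1),
      |(n.choose i : ℝ) * iteratedDeriv i u x * iteratedDeriv (n - i) v x|
        ≤ (n.choose i : ℝ) * (C₁ * C₂ * B ^ n) := by
    intro i hi
    have hi' : i ≤ n := by simpa [Nat.lt_succ_iff] using hi
    rw [abs_mul, abs_mul, Nat.abs_cast, mul_assoc]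
    refine mul_le_mul_of_nonneg_left ?_ (by positivity)
    calc _ ≤ (C₁ * B ^ i) * (C₂ * B ^ (n - i)) :=
          mul_le_mul (h₁ i hi') (h₂ _ (Nat.sub_le _ _)) (abs_nonneg _)
            ((abs_nonneg _).trans (h₁ i hi'))
      _ = C₁ * C₂ * (B ^ i * B ^ (n - i)) := by ring
      _ = _ := by rw [← pow_add, Nat.add_sub_cancel' hi']
  refine (Finset.sum_le_sum this).trans (le_of_eq ?_)
  rw [← Finset.sum_mul, ← Nat.cast_sum, Nat.sum_range_choose]
  push_cast; ring

lemma exists_deriv_eq_slope_of_lt {φ : ℝ → ℝ} (h : Differentiable ℝ φ) {x y : ℝ} (hxy : x < y) :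
    ∃ z ∈ Set.Ioo x y, φ y - φ x = deriv φ z * (y - x) := by
  obtain ⟨z, hz, h'⟩ := exists_deriv_eq_slope φ hxy h.continuous.continuousOn
    h.differentiableOn
  refine ⟨z, hz, ?_⟩
  rw [h', div_mul_cancel₀ _ (by linarith)]

lemma exists_deriv_eq_slope_of_le {φ : ℝ → ℝ} (h : Differentiable ℝ φ) {x y : ℝ} (hxy : x ≤ y) :
    ∃ z ∈ Set.Icc x y, φ y - φ x = deriv φ z * (y - x) := by
  rcases hxy.eq_or_lt with rfl | hlt
  · exact ⟨x, by simp, by simp⟩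
  · obtain ⟨z, hz, h'⟩ := exists_deriv_eq_slope_of_lt h hlt
    exact ⟨z, Set.Ioo_subset_Icc_self hz, h'⟩

/-- A function with bounded `n`-th derivative that is small at sufficiently many separated nodes is
small together with its derivatives of order less than `n`. -/
lemma exists_abs_iteratedDeriv_le_of_nodes (n : ℕ) (K : ℝ) (hK : 0 ≤ K) :
    ∃ C : ℝ, 1 ≤ C ∧ ∀ (φ : ℝ → ℝ) (g u w ε B : ℝ) (y : ℕ → ℝ), ContDiff ℝ ∞ φ → 0 < g →
      w - u ≤ K * g → 0 ≤ ε → 0 ≤ B → (∀ j < 2 ^ n, y j ∈ Set.Icc u w) →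
      (∀ j, j + 1 < 2 ^ n → y j + g ≤ y (j + 1)) → (∀ j < 2 ^ n, |φ (y j)| ≤ ε) →
      (∀ x ∈ Set.Icc u w, |iteratedDeriv n φ x| ≤ B) →
      ∀ j ≤ n, ∀ x ∈ Set.Icc u w, |iteratedDeriv j φ x| * g ^ j ≤ C * (ε + B * g ^ n) := by
  induction n with
  | zero =>
    refine ⟨1, le_rfl, fun φ g u w ε B y _ _ _ hε _ _ _ _ hB j hj x hx => ?_⟩
    obtain rfl : j = 0 := by omega
    have := hB x hx
    simp at this ⊢; linarith
  | succ n ih =>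
    obtain ⟨C, hC1, hC⟩ := ih
    refine ⟨1 + 2 * C * (K + 1), by nlinarith, ?_⟩
    intro φ g u w ε B y hφ hg huw hε hB0 hy hgap hsmall hB
    have hdiff := hφ.infty_differentiable
    have hpow : 2 ^ (n + 1) = 2 * 2 ^ n := by ring
    have hz : ∀ i : ℕ, ∃ z, i < 2 ^ n → z ∈ Set.Ioo (y (2 * i)) (y (2 * i + 1)) ∧
        |deriv φ z| ≤ 2 * ε / g := by
      intro i
      by_cases hi : i < 2 ^ n
      · have hg1 := hgap (2 * i) (by omega)
        obtain ⟨z, hz, hz'⟩ := exists_deriv_eq_slope_of_lt hdiff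
          (show y (2 * i) < y (2 * i + 1) by linarith)
        refine ⟨z, fun _ => ⟨hz, ?_⟩⟩
        rw [le_div_iff₀ hg]
        have h1 := hsmall (2 * i) (by omega)
        have h2 := hsmall (2 * i + 1) (by omega)
        calc |deriv φ z| * g ≤ |deriv φ z| * (y (2 * i + 1) - y (2 * i)) :=
              mul_le_mul_of_nonneg_left (by linarith) (abs_nonneg _)
          _ = |φ (y (2 * i + 1)) - φ (y (2 * i))| := by
              rw [hz', abs_mul, abs_of_pos (show 0 < y (2 * i + 1) - y (2 * i) by linarith)]
          _ ≤ _ := (abs_sub _ _).trans (by linarith)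
      · exact ⟨0, fun h => absurd h hi⟩
    choose z hz using hz
    have key := hC (deriv φ) g u w (2 * ε / g) B z hφ.infty_of_deriv hg huw (by positivity) hB0
      (fun j hj => ⟨(hy (2 * j) (by omega)).1.trans (hz j hj).1.1.le,
        (hz j hj).1.2.le.trans (hy (2 * j + 1) (by omega)).2⟩)
      (fun j hj => by
        have h1 := (hz j (by omega)).1.2
        have h2 := (hz (j + 1) hj).1.1
        have h3 := hgap (2 * j + 1) (by omega)
        rw [show 2 * (j + 1) = 2 * j + 1 + 1 by ring] at h2
        linarith)
      (fun j hj => (hz j hj).2)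
      (fun x hx => by rw [← iteratedDeriv_succ']; exact hB x hx)
    have hD : ∀ j ≤ n, ∀ x ∈ Set.Icc u w,
        |iteratedDeriv (j + 1) φ x| * g ^ (j + 1) ≤ C * (2 * ε + B * g ^ (n + 1)) := by
      intro j hj x hx
      have := key j hj x hx
      rw [← iteratedDeriv_succ'] at this
      calc _ = (|iteratedDeriv (j + 1) φ x| * g ^ j) * g := by ring
        _ ≤ (C * (2 * ε / g + B * g ^ n)) * g := mul_le_mul_of_nonneg_right this hg.le
        _ = _ := by field_simp; ring
    have hBg : 0 ≤ B * g ^ (n + 1) := by positivity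
    intro j hj x hx
    rcases j with _ | j
    · have hy0 := hy 0 (by positivity)
      have hs0 := hsmall 0 (by positivity)
      have hbd : ∀ t ∈ Set.Icc u w, ‖deriv φ t‖ ≤ C * (2 * ε + B * g ^ (n + 1)) / g := by
        intro t ht
        rw [le_div_iff₀ hg]
        have := hD 0 (by omega) t ht
        simpa [iteratedDeriv_one] using this
      have hmv := (convex_Icc u w).norm_image_sub_le_of_norm_deriv_le
        (fun t _ => hdiff t) hbd hy0 hx
      have hxy : ‖x - y 0‖ ≤ K * g := by
        rw [Real.norm_eq_abs, abs_le]; constructor <;> linarith [hx.1, hx.2, hy0.1, hy0.2]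
      have h0 : 0 ≤ C * (2 * ε + B * g ^ (n + 1)) / g := by positivity
      have h4 : ‖φ x - φ (y 0)‖ ≤ C * (2 * ε + B * g ^ (n + 1)) * K := by
        refine hmv.trans ((mul_le_mul_of_nonneg_left hxy h0).trans (le_of_eq ?_))
        field_simp
      have h5 : |φ x| ≤ |φ (y 0)| + ‖φ x - φ (y 0)‖ := by
        have := abs_add_le (φ (y 0)) (φ x - φ (y 0))
        simpa using this
      simp only [iteratedDeriv_zero, pow_zero, mul_one]
      nlinarith [mul_nonneg (by linarith : (0:ℝ) ≤ C) hε, mul_nonneg (by linarith : (0:ℝ) ≤ C) hBg,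
        mul_nonneg (mul_nonneg (by linarith : (0:ℝ) ≤ C) hBg) hK]
    · refine (hD j (by omega) x hx).trans ?_
      nlinarith [mul_nonneg (by linarith : (0:ℝ) ≤ C) hε, mul_nonneg (by linarith : (0:ℝ) ≤ C) hBg,
        mul_nonneg (mul_nonneg (by linarith : (0:ℝ) ≤ C) hBg) hK,
        mul_nonneg (mul_nonneg (by linarith : (0:ℝ) ≤ C) hε) hK]

/-- Interpolation at scale `X`: polynomial smallness together with polynomial growth of a higher
derivative gives smallness of the lower derivatives. -/
lemma exists_abs_iteratedDeriv_le_of_scale (n c : ℕ) (A : ℝ) (hA : 0 ≤ A) :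
    ∃ (s : ℕ) (C : ℝ), 1 ≤ C ∧ ∀ (φ : ℝ → ℝ) (X x : ℝ), ContDiff ℝ ∞ φ → 0 < X → X ≤ 1 →
      (∀ y, |y - x| ≤ X ^ (c + 1) → |φ y| ≤ X ^ s) →
      (∀ y, |y - x| ≤ X ^ (c + 1) → |iteratedDeriv (n + 1) φ y| * X ^ c ≤ A) →
      ∀ j ≤ n, |iteratedDeriv j φ x| ≤ C * X := by
  obtain ⟨C, hC1, hC⟩ := exists_abs_iteratedDeriv_le_of_nodes (n + 1) (2 ^ (n + 1)) (by positivity)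
  refine ⟨(c + 1) * n + 1, C * ((2 ^ n) ^ n + A), ?_, ?_⟩
  · have : (1 : ℝ) ≤ (2 ^ n) ^ n := one_le_pow₀ (one_le_pow₀ (by norm_num))
    nlinarith
  intro φ X x hφ hX hX1 hsmall hB j hj
  set d := X ^ (c + 1) with hd
  have hd0 : 0 < d := by positivity
  have hd1 : d ≤ 1 := pow_le_one₀ hX.le hX1
  have h2n : (1 : ℝ) ≤ 2 ^ n := one_le_pow₀ (by norm_num)
  set g := d / 2 ^ n with hg
  have hg0 : 0 < g := by positivity
  have hgd : g ≤ d := div_le_self hd0.le h2n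
  have hdg : d = 2 ^ n * g := by rw [hg]; field_simp
  have hXc : 0 < X ^ c := by positivity
  have hmem : ∀ y ∈ Set.Icc (x - d) (x + d), |y - x| ≤ d := fun y hy => by
    rw [abs_le]; constructor <;> linarith [hy.1, hy.2]
  have hnode : ∀ i : ℕ, i < 2 ^ (n + 1) → x - d + (i : ℝ) * g ∈ Set.Icc (x - d) (x + d) := by
    intro i hi
    have : (i : ℝ) ≤ 2 ^ (n + 1) := by exact_mod_cast hi.le
    have h3 := mul_le_mul_of_nonneg_right this hg0.le
    have h4 : (0 : ℝ) ≤ i * g := by positivity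
    rw [pow_succ] at h3
    constructor <;> nlinarith
  have key := hC φ g (x - d) (x + d) (X ^ ((c + 1) * n + 1)) (A / X ^ c)
    (fun i => x - d + (i : ℝ) * g) hφ hg0 (by rw [pow_succ]; nlinarith) (by positivity)
    (by positivity) hnode
    (fun i _ => by push_cast; linarith)
    (fun i hi => hsmall _ (hmem _ (hnode i hi)))
    (fun y hy => by rw [le_div_iff₀ hXc]; exact hB y (hmem y hy))
    j (by omega) x ⟨by linarith, by linarith⟩
  have hgj : 0 < g ^ j := by positivity
  have hgle : g ≤ 1 := hgd.trans hd1
  refine le_of_mul_le_mul_right (key.trans ?_) hgj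
  have e1 : X ^ ((c + 1) * n + 1) ≤ X * (2 ^ n) ^ n * g ^ j := by
    have : X ^ ((c + 1) * n + 1) = X * (2 ^ n) ^ n * g ^ n := by
      rw [pow_succ, pow_mul, ← hd, hdg, mul_pow]; ring
    rw [this]
    exact mul_le_mul_of_nonneg_left (pow_le_pow_of_le_one hg0.le hgle hj) (by positivity)
  have e2 : A / X ^ c * g ^ (n + 1) ≤ A * X * g ^ j := by
    have h1 : g ^ (n + 1) ≤ g ^ j * d := by
      calc g ^ (n + 1) ≤ g ^ (j + 1) := pow_le_pow_of_le_one hg0.le hgle (by omega)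
        _ = g ^ j * g := pow_succ _ _
        _ ≤ _ := mul_le_mul_of_nonneg_left hgd hgj.le
    calc A / X ^ c * g ^ (n + 1) ≤ A / X ^ c * (g ^ j * d) :=
          mul_le_mul_of_nonneg_left h1 (by positivity)
      _ = _ := by rw [hd, pow_succ]; field_simp
  have := mul_le_mul_of_nonneg_left (add_le_add e1 e2) (by linarith : (0 : ℝ) ≤ C)
  linarith

lemma natCast_le_pow {A : ℝ} (hA : 2 ≤ A) (n : ℕ) : (n : ℝ) ≤ A ^ n :=
  calc (n : ℝ) ≤ 2 ^ n := by exact_mod_cast Nat.lt_two_pow_self.le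
    _ ≤ A ^ n := pow_le_pow_left₀ (by norm_num) hA n

lemma exists_abs_iteratedDeriv_inv_le (n : ℕ) : ∃ c : ℕ, ∀ (v : ℝ → ℝ) (p A : ℝ), 2 ≤ A →
    ContDiff ℝ ∞ v → (∀ x, 0 < v x) → (∀ i ≤ n, |iteratedDeriv i v p| ≤ A) → 1 ≤ A * v p →
    ∀ i ≤ n, |iteratedDeriv i (fun x => (v x)⁻¹) p| ≤ A ^ c := by
  induction n with
  | zero =>
    refine ⟨1, fun v p A hA hv hpos _ h1 i hi => ?_⟩
    obtain rfl : i = 0 := by omega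
    rw [iteratedDeriv_zero, abs_of_pos (inv_pos.2 (hpos p)), pow_one]
    exact (inv_le_iff_one_le_mul₀ (hpos p)).2 h1
  | succ n ih =>
    obtain ⟨c, hc⟩ := ih
    refine ⟨n + 1 + (n + c + c), fun v p A hA hv hpos hb h1 i hi => ?_⟩
    have hA1 : 1 ≤ A := by linarith
    have hc' := hc v p A hA hv hpos (fun i hi => hb i (by omega)) h1
    rcases Nat.lt_or_ge n i with hi' | hi'
    · obtain rfl : i = n + 1 := by omega
      have hinv : ContDiff ℝ ∞ (fun x => (v x)⁻¹) := hv.inv fun x => (hpos x).ne'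
      have hder : deriv (fun x => (v x)⁻¹) =
          fun x => -(deriv v x) * ((v x)⁻¹ * (v x)⁻¹) := by
        ext x
        rw [deriv_fun_inv'' (hv.infty_differentiable x) (hpos x).ne']
        field_simp
      rw [iteratedDeriv_succ', hder]
      have hsq : ∀ i ≤ n, |iteratedDeriv i (fun x => (v x)⁻¹ * (v x)⁻¹) p|
          ≤ A ^ (n + c + c) * 1 ^ i := by
        intro i hi
        refine (abs_iteratedDeriv_mul_le (C₁ := A ^ c) (C₂ := A ^ c) (B := 1) hinv hinv
          (fun j hj => by simpa using hc' j (hj.trans hi))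
          (fun j hj => by simpa using hc' j (hj.trans hi))).trans ?_
        have : (2 : ℝ) ^ i ≤ A ^ n :=
          (pow_le_pow_left₀ (by norm_num) hA i).trans (pow_le_pow_right₀ hA1 hi)
        rw [one_pow, mul_one, mul_one, mul_assoc, add_assoc, pow_add A n, pow_add A c]
        gcongr
      refine (abs_iteratedDeriv_mul_le (C₁ := A) (C₂ := A ^ (n + c + c)) (B := 1)
        (hv.infty_of_deriv.neg) (hinv.mul hinv) (fun j hj => ?_) hsq).trans ?_
      · rw [show (fun x => -deriv v x) = -deriv v from rfl, iteratedDeriv_neg, abs_neg,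
          ← iteratedDeriv_succ']
        simpa using hb (j + 1) (by omega)
      · rw [one_pow, mul_one, pow_add A (n + 1), pow_succ]
        gcongr
    · exact (hc' i hi').trans (pow_le_pow_right₀ hA1 (by omega))

/-- Polynomial bounds for the derivatives of a solution `κ` of `v ∘ κ = u`. -/
lemma exists_abs_iteratedDeriv_le_of_comp_eq (n : ℕ) : ∃ c : ℕ, ∀ (u v κ : ℝ → ℝ) (x A : ℝ),
    2 ≤ A → ContDiff ℝ ∞ u → ContDiff ℝ ∞ v → ContDiff ℝ ∞ κ → (∀ x, 0 < deriv v x) →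
    (∀ x, v (κ x) = u x) → (∀ i, 1 ≤ i → i ≤ n → |iteratedDeriv i u x| ≤ A) →
    (∀ i, 1 ≤ i → i ≤ n → |iteratedDeriv i v (κ x)| ≤ A) → 1 ≤ A * deriv v (κ x) →
    ∀ i, 1 ≤ i → i ≤ n → |iteratedDeriv i κ x| ≤ A ^ c := by
  induction n with
  | zero => exact ⟨0, fun _ _ _ _ _ _ _ _ _ _ _ _ _ _ i h1 h0 => by omega⟩
  | succ n ih =>
    obtain ⟨c, hc⟩ := ih
    obtain ⟨e, he⟩ := exists_abs_iteratedDeriv_inv_le n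
    refine ⟨n + 1 + (n.factorial + e + c * n) + c, ?_⟩
    intro u v κ x A hA hu hv hκ hpos hcomp hbu hbv h1 i hi1 hi
    have hA1 : 1 ≤ A := by linarith
    have hc' := hc u v κ x A hA hu hv hκ hpos hcomp (fun i h1 hi => hbu i h1 (by omega))
      (fun i h1 hi => hbv i h1 (by omega)) h1
    rcases Nat.lt_or_ge n i with hi' | hi'
    · obtain rfl : i = n + 1 := by omega
      set ρ : ℝ → ℝ := fun y => (deriv v y)⁻¹ with hρ
      have hρs : ContDiff ℝ ∞ ρ := hv.infty_of_deriv.inv fun x => (hpos x).ne'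
      have hρb := he (deriv v) (κ x) A hA hv.infty_of_deriv hpos
        (fun i hi => by rw [← iteratedDeriv_succ']; exact hbv (i + 1) (by omega) (by omega)) h1
      have hder : deriv κ = fun y => deriv u y * (ρ ∘ κ) y := by
        ext y
        have h2 : deriv u y = deriv v (κ y) * deriv κ y := by
          rw [← deriv_comp y (hv.infty_differentiable _) (hκ.infty_differentiable y)]
          congr 1; ext z; exact (hcomp z).symm
        simp only [hρ, Function.comp]
        rw [h2]; field_simp [(hpos (κ y)).ne']
      rw [iteratedDeriv_succ', hder]
      refine (abs_iteratedDeriv_mul_le (C₁ := A) (C₂ := A ^ (n.factorial + e + c * n)) (B := 1)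
        hu.infty_of_deriv (hρs.comp hκ) (fun j hj => ?_) (fun j hj => ?_)).trans ?_
      · rw [← iteratedDeriv_succ']
        simpa using hbu (j + 1) (by omega) (by omega)
      · refine (abs_iteratedDeriv_comp_le (C := A ^ e) (D := A ^ c) hρs hκ
          (fun i hi => hρb i (hi.trans hj)) (fun i h1 hi => ?_)).trans ?_
        · refine (hc' i h1 (hi.trans hj)).trans ?_
          rw [← pow_mul]
          exact pow_le_pow_right₀ hA1 (Nat.le_mul_of_pos_right _ (by omega))
        · have h3 : (j.factorial : ℝ) ≤ A ^ n.factorial :=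
            (natCast_le_pow hA _).trans (pow_le_pow_right₀ hA1 (Nat.factorial_le hj))
          have h4 : (A ^ c) ^ j ≤ A ^ (c * n) := by
            rw [← pow_mul]; exact pow_le_pow_right₀ hA1 (Nat.mul_le_mul_left _ hj)
          rw [one_pow, mul_one, pow_add, pow_add]
          gcongr
      · have : (2 : ℝ) ^ n ≤ A ^ n := pow_le_pow_left₀ (by norm_num) hA n
        calc (2 : ℝ) ^ n * A * A ^ (n.factorial + e + c * n) * 1 ^ n
            ≤ A ^ n * A * A ^ (n.factorial + e + c * n) * 1 ^ n := by gcongr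
          _ = A ^ (n + 1 + (n.factorial + e + c * n)) := by ring
          _ ≤ _ := pow_le_pow_right₀ hA1 (by omega)
    · exact (hc' i hi1 hi').trans (pow_le_pow_right₀ hA1 (by omega))

lemma iteratedDeriv_sub_id {κ : ℝ → ℝ} (hκ : ContDiff ℝ ∞ κ) (n : ℕ) (x : ℝ) :
    iteratedDeriv n (fun y => κ y - y) x = iteratedDeriv n κ x - iteratedDeriv n (fun y => y) x :=
  iteratedDeriv_fun_sub (hκ.infty_contDiffAt n x) contDiffAt_id

lemma abs_iteratedDeriv_id_le {n : ℕ} (hn : 1 ≤ n) (x : ℝ) :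
    |iteratedDeriv n (fun y : ℝ => y) x| ≤ 1 := by
  obtain ⟨n, rfl⟩ := Nat.exists_eq_add_of_le' hn
  rw [iteratedDeriv_succ', show deriv (fun y : ℝ => y) = fun _ => (1 : ℝ) by ext; simp,
    iteratedDeriv_const]
  split_ifs <;> simp

/-- If `v ∘ κ = u`, the maps `u` and `v` have derivatives polynomial in `X⁻¹` and `κ` is very close
to the identity in the uniform sense, then `κ` is close to the identity in the `C^n` sense. -/
lemma exists_abs_iteratedDeriv_sub_id_le (n c₀ : ℕ) (C₀ : ℝ) (hC₀ : 2 ≤ C₀) :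
    ∃ (s : ℕ) (C : ℝ), 1 ≤ C ∧ ∀ (u v κ : ℝ → ℝ) (X x : ℝ), ContDiff ℝ ∞ u → ContDiff ℝ ∞ v →
      ContDiff ℝ ∞ κ → (∀ y, 0 < deriv v y) → (∀ y, v (κ y) = u y) → 0 < X → X ≤ 1 →
      (∀ y, |y - x| ≤ X ^ 2 →
        (∀ i, 1 ≤ i → i ≤ n + 1 → |iteratedDeriv i u y| * X ^ c₀ ≤ C₀ ∧
          |iteratedDeriv i v (κ y)| * X ^ c₀ ≤ C₀) ∧
        1 ≤ C₀ * deriv v (κ y) ∧ |κ y - y| ≤ X ^ s) →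
      ∀ j ≤ n, |iteratedDeriv j (fun y => κ y - y) x| ≤ C * X := by
  obtain ⟨c, hc⟩ := exists_abs_iteratedDeriv_le_of_comp_eq (n + 1)
  obtain ⟨s, C, hC1, hC⟩ := exists_abs_iteratedDeriv_le_of_scale n (c₀ * c + 1) (C₀ ^ c + 1)
    (by positivity)
  refine ⟨s, C, hC1, ?_⟩
  intro u v κ X x hu hv hκ hpos hcomp hX hX1 hb
  have hrad : X ^ (c₀ * c + 1 + 1) ≤ X ^ 2 := pow_le_pow_of_le_one hX.le hX1 (by omega)
  refine hC (fun y => κ y - y) X x (hκ.sub contDiff_id) hX hX1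
    (fun y hy => (hb y (hy.trans hrad)).2.2) (fun y hy => ?_)
  obtain ⟨hb1, hb2, -⟩ := hb y (hy.trans hrad)
  have hXc : 0 < X ^ c₀ := by positivity
  have hXc1 : X ^ c₀ ≤ 1 := pow_le_one₀ hX.le hX1
  have hA : C₀ ≤ C₀ / X ^ c₀ := by rw [le_div_iff₀ hXc]; nlinarith
  have hk := hc u v κ y (C₀ / X ^ c₀) (hC₀.trans hA) hu hv hκ hpos hcomp
    (fun i h1 hi => by rw [le_div_iff₀ hXc]; exact (hb1 i h1 hi).1)
    (fun i h1 hi => by rw [le_div_iff₀ hXc]; exact (hb1 i h1 hi).2)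
    (hb2.trans (mul_le_mul_of_nonneg_right hA (hpos _).le)) (n + 1) (by omega) le_rfl
  rw [iteratedDeriv_sub_id hκ]
  have h1 : |iteratedDeriv (n + 1) κ y| * X ^ (c₀ * c) ≤ C₀ ^ c := by
    rw [div_pow, ← pow_mul, le_div_iff₀ (by positivity)] at hk
    exact hk
  have h2 := abs_iteratedDeriv_id_le (n := n + 1) (by omega) y
  have h3 := abs_sub (iteratedDeriv (n + 1) κ y) (iteratedDeriv (n + 1) (fun y => y) y)
  have h4 : 0 < X ^ (c₀ * c) := by positivity
  have h5 : X ^ (c₀ * c) ≤ 1 := pow_le_one₀ hX.le hX1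
  have h6 : X ^ (c₀ * c + 1) ≤ X ^ (c₀ * c) := pow_le_pow_of_le_one hX.le hX1 (by omega)
  have h7 : 0 < X ^ (c₀ * c + 1) := by positivity
  calc _ ≤ (|iteratedDeriv (n + 1) κ y| + 1) * X ^ (c₀ * c + 1) :=
        mul_le_mul_of_nonneg_right (h3.trans (by linarith)) h7.le
    _ ≤ (|iteratedDeriv (n + 1) κ y| + 1) * X ^ (c₀ * c) :=
        mul_le_mul_of_nonneg_left h6 (by positivity)
    _ ≤ _ := by linarith

/-- Left composition with a smooth map with bounded derivatives is continuous at the identity. -/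
lemma exists_abs_iteratedDeriv_comp_sub_le {f : ℝ → ℝ} (hf : ContDiff ℝ ∞ f)
    (hb : ∀ i, 1 ≤ i → ∃ C, ∀ x, |iteratedDeriv i f x| ≤ C) (n : ℕ) {ε : ℝ} (hε : 0 < ε) :
    ∃ δ > 0, ∀ k : ℝ → ℝ, ContDiff ℝ ∞ k →
      (∀ x, ∀ j ≤ n + 1, |iteratedDeriv j (fun y => k y - y) x| ≤ δ) →
      ∀ x, ∀ j ≤ n, |iteratedDeriv j (fun y => f (k y) - f y) x| ≤ ε := by
  choose! C hC using hb
  set L := 1 + ∑ i ∈ Finset.range (n + 2), |C i| with hL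
  have hCL : ∀ i, 1 ≤ i → i ≤ n + 1 → ∀ x, |iteratedDeriv i f x| ≤ L := by
    intro i h1 hi x
    have := Finset.single_le_sum (f := fun i => |C i|) (fun i _ => abs_nonneg _)
      (Finset.mem_range.2 (show i < n + 2 by omega))
    linarith [hC i h1 x, le_abs_self (C i)]
  have hL1 : 1 ≤ L := by
    have : 0 ≤ ∑ i ∈ Finset.range (n + 2), |C i| := Finset.sum_nonneg fun i _ => abs_nonneg _
    linarith
  set A := (n.factorial : ℝ) * (L) * 2 ^ n * 2 ^ n * 2 + L with hA
  obtain ⟨s, K, hK1, hK⟩ := exists_abs_iteratedDeriv_le_of_scale n 0 A (by positivity)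
  set X := min 1 (ε / K) with hX
  have hX0 : 0 < X := by positivity
  refine ⟨min 1 (X ^ s / L), by positivity, fun k hk hkb x j hj => ?_⟩
  have hdf := hf.infty_differentiable
  have hdk := hk.infty_differentiable
  have hkb' : ∀ i, 1 ≤ i → i ≤ n + 1 → ∀ x, |iteratedDeriv i k x| ≤ 2 := by
    intro i h1 hi x
    have h2 := (hkb x i hi).trans (min_le_left _ _)
    rw [iteratedDeriv_sub_id hk] at h2
    have h3 := abs_iteratedDeriv_id_le h1 x
    have h4 := abs_sub_abs_le_abs_sub (iteratedDeriv i k x) (iteratedDeriv i (fun y => y) x)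
    linarith
  refine (hK (fun y => f (k y) - f y) X x ((hf.comp hk).sub hf) hX0 (min_le_left _ _)
    (fun y _ => ?_) (fun y _ => ?_) j hj).trans ?_
  · have h0 := (hkb y 0 (by omega)).trans (min_le_right _ _)
    rw [le_div_iff₀ (by linarith)] at h0
    have := (convex_univ (𝕜 := ℝ) (E := ℝ)).norm_image_sub_le_of_norm_deriv_le
      (fun t _ => hdf t) (fun t _ => by
        have := hCL 1 le_rfl (by omega) t
        rwa [iteratedDeriv_one] at this) (Set.mem_univ y) (Set.mem_univ (k y))
    simp only [Real.norm_eq_abs, iteratedDeriv_zero] at this h0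
    linarith
  · rw [pow_zero, mul_one, iteratedDeriv_fun_sub (f := fun y => f (k y))
      ((hf.comp hk).infty_contDiffAt _ _)
      (hf.infty_contDiffAt _ _)]
    refine (abs_sub _ _).trans ?_
    refine add_le_add ?_ (hCL _ (by omega) le_rfl y)
    have hder : deriv (fun y => f (k y)) = fun y => (deriv f ∘ k) y * deriv k y := by
      ext y; exact deriv_comp y (hdf _) (hdk _)
    rw [iteratedDeriv_succ', hder]
    have hLpos : 0 ≤ L := by linarith
    refine (abs_iteratedDeriv_mul_le (C₁ := n.factorial * L * 2 ^ n) (C₂ := 2) (B := 1)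
      (hf.infty_of_deriv.comp hk) hk.infty_of_deriv (fun i hi => ?_) (fun i hi => ?_)).trans ?_
    · refine (abs_iteratedDeriv_comp_le (C := L) (D := 2) hf.infty_of_deriv hk
        (fun l hl => ?_) (fun l h1 hl => ?_)).trans ?_
      · rw [← iteratedDeriv_succ']; exact hCL _ (by omega) (by omega) _
      · exact (hkb' l h1 (by omega) y).trans
          (le_self_pow₀ (by norm_num) (by omega))
      · have h1 : (i.factorial : ℝ) ≤ n.factorial := by exact_mod_cast Nat.factorial_le hi
        have h2 : (2 : ℝ) ^ i ≤ 2 ^ n := pow_le_pow_right₀ (by norm_num) hi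
        rw [one_pow, mul_one]
        gcongr
    · rw [← iteratedDeriv_succ']
      simpa using hkb' (i + 1) (by omega) (by omega) y
    · rw [one_pow, mul_one]
      apply le_of_eq; ring
  · calc K * X ≤ K * (ε / K) := mul_le_mul_of_nonneg_left (min_le_right _ _) (by linarith)
      _ = ε := by field_simp

lemma exists_abs_iteratedDeriv_comp_le {h : ℝ → ℝ} (hh : ContDiff ℝ ∞ h)
    (hb : ∀ i, 1 ≤ i → ∃ C, ∀ x, |iteratedDeriv i h x| ≤ C) (n : ℕ) {ε : ℝ} (hε : 0 < ε) :
    ∃ δ > 0, ∀ φ : ℝ → ℝ, ContDiff ℝ ∞ φ →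
      (∀ x, ∀ j ≤ n, |iteratedDeriv j φ x| ≤ δ) →
      ∀ x, ∀ j ≤ n, |iteratedDeriv j (fun y => φ (h y)) x| ≤ ε := by
  choose! C hC using hb
  set L := 1 + ∑ i ∈ Finset.range (n + 1), |C i| with hL
  have hL1 : 1 ≤ L := by
    have : 0 ≤ ∑ i ∈ Finset.range (n + 1), |C i| := Finset.sum_nonneg fun i _ => abs_nonneg _
    linarith
  have hCL : ∀ i, 1 ≤ i → i ≤ n → ∀ x, |iteratedDeriv i h x| ≤ L ^ i := by
    intro i h1 hi x
    have := Finset.single_le_sum (f := fun i => |C i|) (fun i _ => abs_nonneg _)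
      (Finset.mem_range.2 (show i < n + 1 by omega))
    refine le_trans ?_ (le_self_pow₀ hL1 (by omega))
    linarith [hC i h1 x, le_abs_self (C i)]
  refine ⟨ε / (n.factorial * L ^ n), by positivity, fun φ hφ hb x j hj => ?_⟩
  refine (abs_iteratedDeriv_comp_le hφ hh (fun i hi => hb _ i (hi.trans hj))
    (fun i h1 hi => hCL i h1 (hi.trans hj) x)).trans ?_
  have h1 : (j.factorial : ℝ) ≤ n.factorial := by exact_mod_cast Nat.factorial_le hj
  have h2 : L ^ j ≤ L ^ n := pow_le_pow_right₀ hL1 hj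
  calc (j.factorial : ℝ) * (ε / (n.factorial * L ^ n)) * L ^ j
      ≤ n.factorial * (ε / (n.factorial * L ^ n)) * L ^ n := by gcongr
    _ = ε := by field_simp

/-! ### Iterates of a circle diffeomorphism with irrational rotation number -/

/-- The family `T` of the lifts of the iterates of a smooth circle diffeomorphism semiconjugate to
the rotation by `α`, with distortion constant `V`. -/
structure RotSystem (T : ℤ → ℝ → ℝ) (α V : ℝ) : Prop where
  zero : ∀ x, T 0 x = x
  add : ∀ i j x, T (i + j) x = T i (T j x)
  add_one : ∀ i x, T i (x + 1) = T i x + 1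
  smooth : ∀ i, ContDiff ℝ ∞ (T i)
  deriv_pos : ∀ i x, 0 < deriv (T i) x
  semiconj : ∃ H : ℝ → ℝ, Monotone H ∧ (∀ x, H (x + 1) = H x + 1) ∧
    ∀ (i : ℤ) x, H (T i x) = H x + i * α
  irr : Irrational α
  one_le_V : 1 ≤ V
  lip : ∀ x y, |Real.log (deriv (T 1) x) - Real.log (deriv (T 1) y)| ≤ V * |x - y|

/-- The displacement of the map `x ↦ T a x - b`. -/
def disp (T : ℤ → ℝ → ℝ) (a b : ℤ) (x : ℝ) : ℝ := T a x - b - x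

/-- A close return `aα - b > 0` that is at least as good as all returns of time less than `Q`. -/
structure Frame (α : ℝ) (a b : ℤ) (Q : ℕ) : Prop where
  pos : 0 < a * α - b
  le_one : a * α - b ≤ 1
  one_le : 1 ≤ Q
  natAbs_le : a.natAbs ≤ Q
  sep : ∀ i k : ℤ, 0 < i → i < Q → a * α - b ≤ |i * α - k|

lemma add_int_of_add_one {f : ℝ → ℝ} (h : ∀ x, f (x + 1) = f x + 1) (x : ℝ) (k : ℤ) :
    f (x + k) = f x + k := by
  induction k using Int.induction_on with
  | zero => simp
  | succ n ih => push_cast at ih ⊢; rw [← add_assoc, h, ih]; ring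
  | pred n ih =>
    have := h (x + ((-(n : ℤ) - 1 : ℤ) : ℝ))
    push_cast at ih this ⊢
    rw [show x + (-(n : ℝ) - 1) + 1 = x + -n by ring, ih] at this
    linarith

lemma exists_isMax_of_periodic {f : ℝ → ℝ} (hf : Continuous f) (hp : ∀ x, f (x + 1) = f x) :
    ∃ x, ∀ y, f y ≤ f x := by
  obtain ⟨x, -, hx⟩ := isCompact_Icc.exists_isMaxOn (Set.nonempty_Icc.2 (zero_le_one (α := ℝ)))
    hf.continuousOn
  refine ⟨x, fun y => ?_⟩
  obtain ⟨z, hz, hyz⟩ := Function.Periodic.exists_mem_Ico₀ (f := f) (c := 1) hp one_pos y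
  rw [hyz]
  exact hx (Set.Ico_subset_Icc_self hz)

lemma exists_isMin_of_periodic {f : ℝ → ℝ} (hf : Continuous f) (hp : ∀ x, f (x + 1) = f x) :
    ∃ x, ∀ y, f x ≤ f y := by
  obtain ⟨x, hx⟩ := exists_isMax_of_periodic (f := fun x => -f x) hf.neg (fun x => by simp [hp])
  exact ⟨x, fun y => by simpa using hx y⟩

lemma abs_exp_sub_one_le (x : ℝ) : |Real.exp x - 1| ≤ |x| * Real.exp |x| := by
  have h2 := Real.add_one_le_exp (-|x|)
  have h3 : Real.exp |x| * Real.exp (-|x|) = 1 := by rw [← Real.exp_add]; simp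
  have h4 := Real.exp_pos |x|
  rcases le_total 0 x with h | h
  · rw [abs_of_nonneg (by linarith [Real.add_one_le_exp x])]
    rw [abs_of_nonneg h] at *
    nlinarith
  · rw [abs_of_nonpos (by linarith [Real.exp_le_one_iff.2 h])]
    have h1 := Real.add_one_le_exp x
    have h5 : 1 ≤ Real.exp |x| := Real.one_le_exp (abs_nonneg x)
    rw [abs_of_nonpos h] at *
    nlinarith

namespace RotSystem

variable {T : ℤ → ℝ → ℝ} {α V : ℝ}

lemma add_int (S : RotSystem T α V) (i : ℤ) (x : ℝ) (k : ℤ) : T i (x + k) = T i x + k :=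
  add_int_of_add_one (S.add_one i) x k

lemma sub_int (S : RotSystem T α V) (i : ℤ) (x : ℝ) (k : ℤ) : T i (x - k) = T i x - k := by
  have := S.add_int i x (-k)
  push_cast at this
  simpa [sub_eq_add_neg] using this

lemma differentiable (S : RotSystem T α V) (i : ℤ) : Differentiable ℝ (T i) :=
  (S.smooth i).infty_differentiable

lemma strictMono (S : RotSystem T α V) (i : ℤ) : StrictMono (T i) :=
  strictMono_of_deriv_pos (S.deriv_pos i)

lemma comm (S : RotSystem T α V) (i j : ℤ) (x : ℝ) : T i (T j x) = T j (T i x) := by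
  rw [← S.add, ← S.add, add_comm]

lemma exists_semiconj (S : RotSystem T α V) : ∃ H : ℝ → ℝ, Monotone H ∧
    (∀ x (k : ℤ), H (x + k) = H x + k) ∧ ∀ (i : ℤ) x, H (T i x) = H x + i * α := by
  obtain ⟨H, h1, h2, h3⟩ := S.semiconj
  exact ⟨H, h1, fun x k => add_int_of_add_one h2 x k, h3⟩

lemma lt (S : RotSystem T α V) {i k j l : ℤ} (h : i * α + k < j * α + l) (x : ℝ) :
    T i x + k < T j x + l := by
  obtain ⟨H, hm, h1, h2⟩ := S.exists_semiconj
  apply hm.reflect_lt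
  rw [h1, h1, h2, h2]
  linarith

lemma le (S : RotSystem T α V) {i k j l : ℤ} (h : i * α + k ≤ j * α + l) (x : ℝ) :
    T i x + k ≤ T j x + l := by
  rcases h.lt_or_eq with h | h
  · exact (S.lt h x).le
  · have hij : i = j := by
      by_contra hne
      have hne' : ((i - j : ℤ) : ℝ) ≠ 0 := by exact_mod_cast sub_ne_zero.2 hne
      refine (irrational_iff_ne_rational α).1 S.irr (l - k) (i - j) (sub_ne_zero.2 hne) ?_
      rw [eq_div_iff hne']
      push_cast
      linarith
    subst hij
    have : (k : ℝ) = l := by linarith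
    rw [this]

lemma disp_pos (S : RotSystem T α V) {a b : ℤ} (h : 0 < a * α - b) (x : ℝ) : 0 < disp T a b x := by
  have := S.lt (i := 0) (k := 0) (j := a) (l := -b) (by push_cast; linarith) x
  rw [S.zero] at this
  push_cast at this
  unfold disp; linarith

lemma disp_mono (S : RotSystem T α V) {a b a' b' : ℤ} (h : a * α - b ≤ a' * α - b') (x : ℝ) :
    disp T a b x ≤ disp T a' b' x := by
  have := S.le (i := a) (k := -b) (j := a') (l := -b') (by push_cast; linarith) x
  push_cast at this
  unfold disp; linarith

lemma disp_add_one (S : RotSystem T α V) (a b : ℤ) (x : ℝ) :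
    disp T a b (x + 1) = disp T a b x := by
  unfold disp; rw [S.add_one]; ring

lemma disp_sub_int (S : RotSystem T α V) (a b : ℤ) (x : ℝ) (k : ℤ) :
    disp T a b (x - k) = disp T a b x := by
  unfold disp; rw [S.sub_int]; ring

lemma disp_smooth (S : RotSystem T α V) (a b : ℤ) : ContDiff ℝ ∞ (disp T a b) :=
  ((S.smooth a).sub contDiff_const).sub contDiff_id

lemma deriv_disp (S : RotSystem T α V) (a b : ℤ) (x : ℝ) :
    deriv (disp T a b) x = deriv (T a) x - 1 := by
  unfold disp
  rw [deriv_fun_sub ((S.differentiable a x).sub_const _) differentiableAt_fun_id,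
    deriv_sub_const, deriv_id'']

lemma disp_add (S : RotSystem T α V) (a b a' b' : ℤ) (x : ℝ) :
    disp T (a + a') (b + b') x = disp T a b (T a' x - b') + disp T a' b' x := by
  unfold disp; rw [S.sub_int, ← S.add]; push_cast; ring

lemma apply_shift (S : RotSystem T α V) (a b i : ℤ) (x : ℝ) :
    T i (T a x - b) = T a (T i x) - b := by rw [S.sub_int, S.comm]

lemma deriv_add (S : RotSystem T α V) (i j : ℤ) (x : ℝ) :
    deriv (T (i + j)) x = deriv (T i) (T j x) * deriv (T j) x := by
  have : T (i + j) = T i ∘ T j := by ext x; exact S.add i j x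
  rw [this, deriv_comp x (S.differentiable i _) (S.differentiable j x)]

lemma deriv_zero (S : RotSystem T α V) (x : ℝ) : deriv (T 0) x = 1 := by
  have : T 0 = id := by ext x; exact S.zero x
  rw [this]; simp

lemma deriv_sub_int (S : RotSystem T α V) (i : ℤ) (x : ℝ) (k : ℤ) :
    deriv (T i) (x - k) = deriv (T i) x := by
  have : T i = fun y => T i (y - k) + k := by ext y; rw [S.sub_int]; ring
  conv_rhs => rw [this]
  rw [deriv_add_const, deriv_comp_sub_const]

lemma log_deriv_add (S : RotSystem T α V) (i j : ℤ) (x : ℝ) :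
    Real.log (deriv (T (i + j)) x) =
      Real.log (deriv (T i) (T j x)) + Real.log (deriv (T j) x) := by
  rw [S.deriv_add, Real.log_mul (S.deriv_pos _ _).ne' (S.deriv_pos _ _).ne']

lemma log_deriv_sub (S : RotSystem T α V) (s : ℤ) (n : ℕ) (x : ℝ) :
    Real.log (deriv (T (s + n)) x) - Real.log (deriv (T s) x) =
      ∑ i ∈ Finset.range n, Real.log (deriv (T 1) (T (s + i) x)) := by
  induction n with
  | zero => simp
  | succ n ih =>
    rw [Finset.sum_range_succ, ← ih]
    have : s + ((n + 1 : ℕ) : ℤ) = 1 + (s + n) := by push_cast; ring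
    rw [this, S.log_deriv_add]; ring

lemma exists_log_deriv_le (S : RotSystem T α V) (n : ℤ) : ∃ s : ℤ, s.natAbs ≤ n.natAbs ∧
    (∀ i < n.natAbs, (s + i).natAbs ≤ n.natAbs) ∧
    ∀ y z, |Real.log (deriv (T n) y) - Real.log (deriv (T n) z)| ≤
      V * ∑ i ∈ Finset.range n.natAbs, |T (s + i) y - T (s + i) z| := by
  have key : ∀ (s : ℤ) (N : ℕ) (y z : ℝ),
      |(∑ i ∈ Finset.range N, Real.log (deriv (T 1) (T (s + i) y))) -
        ∑ i ∈ Finset.range N, Real.log (deriv (T 1) (T (s + i) z))| ≤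
      V * ∑ i ∈ Finset.range N, |T (s + i) y - T (s + i) z| := by
    intro s N y z
    rw [← Finset.sum_sub_distrib, Finset.mul_sum]
    exact (Finset.abs_sum_le_sum_abs _ _).trans (Finset.sum_le_sum fun i _ => S.lip _ _)
  rcases le_total 0 n with h | h
  · refine ⟨0, by simp, fun i hi => by omega, fun y z => ?_⟩
    have hn : (0 : ℤ) + (n.natAbs : ℤ) = n := by omega
    have h1 := S.log_deriv_sub 0 n.natAbs y
    have h2 := S.log_deriv_sub 0 n.natAbs z
    rw [hn, S.deriv_zero, Real.log_one, sub_zero] at h1 h2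
    rw [h1, h2]
    exact key _ _ _ _
  · refine ⟨n, le_rfl, fun i hi => by omega, fun y z => ?_⟩
    have hn : n + (n.natAbs : ℤ) = 0 := by omega
    have h1 := S.log_deriv_sub n n.natAbs y
    have h2 := S.log_deriv_sub n n.natAbs z
    rw [hn, S.deriv_zero, Real.log_one, zero_sub] at h1 h2
    have := key n n.natAbs y z
    rw [← h1, ← h2] at this
    rwa [show ∀ a b : ℝ, -a - -b = -(a - b) by intros; ring, abs_neg] at this

end RotSystem

namespace Frame

variable {T : ℤ → ℝ → ℝ} {α V : ℝ} {a b : ℤ} {Q : ℕ}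

lemma sum_disp_le_one (F : Frame α a b Q) (S : RotSystem T α V) (s : ℤ) (x : ℝ) :
    ∑ i ∈ Finset.range Q, disp T a b (T (s + i) x) ≤ 1 := by
  set X := T s x with hX
  set k : ℕ → ℤ := fun i => ⌊T (s + i) x - X⌋ with hk
  set l : ℕ → ℝ := fun i => T (s + i) x - k i with hl
  have hl0 : ∀ i, X ≤ l i := fun i => by
    have := Int.floor_le (T (s + i) x - X); simp only [hl, hk]; linarith
  have hl1 : ∀ i, l i < X + 1 := fun i => by
    have := Int.lt_floor_add_one (T (s + i) x - X); simp only [hl, hk]; linarith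
  have hstep : ∀ i j : ℕ, ∀ k k' : ℤ, i < Q → j < Q → i ≠ j →
      T (s + i) x - k < T (s + j) x - k' →
      T (s + i) x - k + disp T a b (T (s + i) x) ≤ T (s + j) x - k' := by
    intro i j k k' hi hj hij hlt
    have h1 : ((s + i : ℤ) : ℝ) * α + (-k : ℤ) < ((s + j : ℤ) : ℝ) * α + (-k' : ℤ) := by
      by_contra hcon
      have := S.le (not_lt.1 hcon) x
      push_cast at this
      linarith
    have h2 : a * α - b ≤ |((j : ℝ) - i) * α - (k' - k)| := by
      rcases lt_or_gt_of_ne hij with h | h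
      · have := F.sep (j - i) (k' - k) (by omega) (by omega)
        push_cast at this; exact this
      · have := F.sep (i - j) (k - k') (by omega) (by omega)
        push_cast at this
        rwa [show ((j : ℝ) - i) * α - (k' - k) = -(((i : ℝ) - j) * α - (k - k')) by ring, abs_neg]
    push_cast at h1
    rw [abs_of_pos (by linarith)] at h2
    have h3 := S.le (i := a + (s + i)) (k := -b - k) (j := s + j) (l := -k')
      (by push_cast; linarith) x
    rw [S.add] at h3
    push_cast at h3
    unfold disp
    linarith
  have hsub : ∀ i ∈ Finset.range Q, Set.Ico (l i) (l i + disp T a b (T (s + i) x)) ⊆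
      Set.Ico X (X + 1) := by
    intro i hi
    have hi' := Finset.mem_range.1 hi
    refine Set.Ico_subset_Ico (hl0 i) ?_
    rcases Nat.eq_zero_or_pos i with rfl | hpos
    · have h2 := S.le (i := a + s) (k := -b) (j := s) (l := 1)
        (by push_cast; linarith [F.le_one]) x
      rw [S.add] at h2
      push_cast at h2
      simp only [hl, hk, disp]
      simp [← hX] at h2 ⊢
      linarith
    · have := hstep i 0 (k i) (-1) hi' F.one_le (by omega) (by
        have := hl1 i
        simp only [hl] at this
        simp [← hX]; linarith)
      simp only [hl]
      simpa [← hX] using this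
  have hdisj : Set.PairwiseDisjoint (↑(Finset.range Q))
      (fun i => Set.Ico (l i) (l i + disp T a b (T (s + i) x))) := by
    intro i hi j hj hij
    have hi' := Finset.mem_range.1 hi
    have hj' := Finset.mem_range.1 hj
    have hne : l i ≠ l j := by
      intro heq
      have h1 : ((s + i : ℤ) : ℝ) * α + (-k i : ℤ) = ((s + j : ℤ) : ℝ) * α + (-k j : ℤ) := by
        rcases lt_trichotomy (((s + i : ℤ) : ℝ) * α + (-k i : ℤ))
          (((s + j : ℤ) : ℝ) * α + (-k j : ℤ)) with h | h | h
        · have := S.lt h x; push_cast at this; simp only [hl] at heq; linarith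
        · exact h
        · have := S.lt h x; push_cast at this; simp only [hl] at heq; linarith
      have hne : (i : ℤ) - j ≠ 0 := by omega
      have hne' : (((i : ℤ) - j : ℤ) : ℝ) ≠ 0 := by exact_mod_cast hne
      refine (irrational_iff_ne_rational α).1 S.irr (k i - k j) (i - j) hne ?_
      rw [eq_div_iff hne']
      push_cast at h1 ⊢
      linarith
    rcases lt_or_gt_of_ne hne with h | h
    · have := hstep i j (k i) (k j) hi' hj' hij h
      exact Set.disjoint_left.2 fun y hy hy' => absurd hy.2 (not_lt.2 (this.trans hy'.1))
    · have := hstep j i (k j) (k i) hj' hi' hij.symm h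
      exact Set.disjoint_left.2 fun y hy hy' => absurd hy'.2 (not_lt.2 (this.trans hy.1))
  have hvol := measure_biUnion_finset (μ := volume) hdisj (fun i _ => measurableSet_Ico)
  have hle : volume (⋃ i ∈ Finset.range Q, Set.Ico (l i) (l i + disp T a b (T (s + i) x))) ≤
      volume (Set.Ico X (X + 1)) := measure_mono (Set.iUnion₂_subset hsub)
  rw [hvol, Real.volume_Ico] at hle
  simp only [Real.volume_Ico, add_sub_cancel_left] at hle
  rw [← ENNReal.ofReal_sum_of_nonneg (fun i _ => (S.disp_pos F.pos _).le),
    ENNReal.ofReal_le_ofReal_iff zero_le_one] at hle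
  exact hle

end Frame

namespace RotSystem

variable {T : ℤ → ℝ → ℝ} {α V : ℝ}

lemma apply_add_disp_sub (S : RotSystem T α V) (a b i : ℤ) (x : ℝ) :
    T i (x + disp T a b x) - T i x = disp T a b (T i x) := by
  rw [show x + disp T a b x = T a x - b by unfold disp; ring, S.apply_shift]; rfl

lemma disp_zero (S : RotSystem T α V) (x : ℝ) : disp T 0 0 x = 0 := by
  unfold disp; rw [S.zero]; simp

lemma disp_succ_mul (S : RotSystem T α V) (a b : ℤ) (L : ℕ) (x : ℝ) :
    disp T ((L + 1 : ℕ) * a) ((L + 1 : ℕ) * b) x =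
      disp T a b (x + disp T (L * a) (L * b) x) + disp T (L * a) (L * b) x := by
  rw [show ((L + 1 : ℕ) : ℤ) * a = a + L * a by push_cast; ring,
    show ((L + 1 : ℕ) : ℤ) * b = b + L * b by push_cast; ring, S.disp_add]
  congr 2
  unfold disp; ring

lemma disp_mul_nonneg (S : RotSystem T α V) {a b : ℤ} (h : 0 < a * α - b) (L : ℕ) (x : ℝ) :
    0 ≤ disp T (L * a) (L * b) x := by
  have := S.le (i := 0) (k := 0) (j := L * a) (l := -(L * b))
    (by push_cast; nlinarith [mul_nonneg (Nat.cast_nonneg (α := ℝ) L) h.le]) x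
  rw [S.zero] at this
  push_cast at this
  unfold disp; push_cast; linarith

end RotSystem

namespace Frame

variable {T : ℤ → ℝ → ℝ} {α V : ℝ} {a b : ℤ} {Q : ℕ}

lemma sum_disp_mul_le (F : Frame α a b Q) (S : RotSystem T α V) (L : ℕ) (s : ℤ) (x : ℝ) :
    ∑ i ∈ Finset.range Q, disp T (L * a) (L * b) (T (s + i) x) ≤ L := by
  induction L with
  | zero => simp [S.disp_zero]
  | succ L ih =>
    have h : ∀ i ∈ Finset.range Q,
        disp T ((L + 1 : ℕ) * a) ((L + 1 : ℕ) * b) (T (s + i) x) =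
        disp T a b (T (s + i) (x + disp T (L * a) (L * b) x)) +
          disp T (L * a) (L * b) (T (s + i) x) := by
      intro i _
      rw [S.disp_succ_mul]
      congr 2
      linarith [S.apply_add_disp_sub (L * a) (L * b) (s + i) x]
    rw [Finset.sum_congr rfl h, Finset.sum_add_distrib]
    have := F.sum_disp_le_one S s (x + disp T (L * a) (L * b) x)
    push_cast
    linarith

lemma sum_disp_mul_le_two (F : Frame α a b Q) (S : RotSystem T α V) (L : ℕ) (s : ℤ) {n : ℕ}
    (hn : n ≤ 2 * Q) (x : ℝ) :
    ∑ i ∈ Finset.range n, disp T (L * a) (L * b) (T (s + i) x) ≤ 2 * L := by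
  calc _ ≤ ∑ i ∈ Finset.range (Q + Q), disp T (L * a) (L * b) (T (s + i) x) :=
        Finset.sum_le_sum_of_subset_of_nonneg (Finset.range_mono (by omega))
          fun i _ _ => S.disp_mul_nonneg F.pos L _
    _ = _ := Finset.sum_range_add _ _ _
    _ ≤ L + L := by
        refine add_le_add (F.sum_disp_mul_le S L s x) ?_
        have := F.sum_disp_mul_le S L (s + Q) x
        simpa [add_assoc] using this
    _ = _ := by ring

lemma sum_disp_le_two (F : Frame α a b Q) (S : RotSystem T α V) (s : ℤ) {n : ℕ}
    (hn : n ≤ 2 * Q) (x : ℝ) :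
    ∑ i ∈ Finset.range n, disp T a b (T (s + i) x) ≤ 2 := by
  simpa using F.sum_disp_mul_le_two S 1 s hn x

lemma distortion (F : Frame α a b Q) (S : RotSystem T α V) (L : ℕ) {x y z : ℝ}
    (hy : y ∈ Set.Icc x (x + disp T (L * a) (L * b) x))
    (hz : z ∈ Set.Icc x (x + disp T (L * a) (L * b) x)) {n : ℤ} (hn : n.natAbs ≤ 2 * Q) :
    |Real.log (deriv (T n) y) - Real.log (deriv (T n) z)| ≤ 2 * L * V := by
  obtain ⟨s, -, -, hs⟩ := S.exists_log_deriv_le n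
  have hV := S.one_le_V
  have hsum := F.sum_disp_mul_le_two S L s hn x
  calc _ ≤ V * ∑ i ∈ Finset.range n.natAbs, |T (s + i) y - T (s + i) z| := hs y z
    _ ≤ V * ∑ i ∈ Finset.range n.natAbs, disp T (L * a) (L * b) (T (s + i) x) := by
        refine mul_le_mul_of_nonneg_left (Finset.sum_le_sum fun i _ => ?_) (by linarith)
        rw [← S.apply_add_disp_sub, abs_le]
        have hm := (S.strictMono (s + i)).monotone
        constructor <;> linarith [hm hy.1, hm hy.2, hm hz.1, hm hz.2]
    _ ≤ _ := by nlinarith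

lemma deriv_le_of_distortion {T : ℤ → ℝ → ℝ} {α V : ℝ} (S : RotSystem T α V) {n : ℤ} {y z K : ℝ}
    (h : |Real.log (deriv (T n) y) - Real.log (deriv (T n) z)| ≤ K) :
    deriv (T n) y ≤ Real.exp K * deriv (T n) z := by
  have h1 : Real.log (deriv (T n) y) ≤ K + Real.log (deriv (T n) z) := by
    linarith [(abs_le.1 h).2]
  rwa [Real.log_le_iff_le_exp (S.deriv_pos _ _), Real.exp_add, Real.exp_log (S.deriv_pos _ _)] at h1

lemma exists_deriv_mul_disp (F : Frame α a b Q) (S : RotSystem T α V) (n : ℤ) (x : ℝ) :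
    ∃ ξ ∈ Set.Icc x (x + disp T a b x), disp T a b (T n x) = deriv (T n) ξ * disp T a b x := by
  have hpos := S.disp_pos F.pos x
  obtain ⟨ξ, hξ, h⟩ := exists_deriv_eq_slope_of_le (S.differentiable n)
    (show x ≤ x + disp T a b x by linarith)
  rw [S.apply_add_disp_sub, add_sub_cancel_left] at h
  exact ⟨ξ, hξ, h⟩

lemma deriv_mul_disp_le (F : Frame α a b Q) (S : RotSystem T α V) {n : ℤ} (hn : n.natAbs ≤ 2 * Q)
    {x y : ℝ} (hy : y ∈ Set.Icc x (x + disp T a b x)) :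
    deriv (T n) y * disp T a b x ≤ Real.exp (2 * V) * disp T a b (T n x) := by
  obtain ⟨ξ, hξ, h⟩ := F.exists_deriv_mul_disp S n x
  have h1 := F.distortion S 1 (by simpa using hy) (by simpa using hξ) hn
  have h2 := deriv_le_of_distortion S h1
  rw [h, ← mul_assoc]
  refine mul_le_mul_of_nonneg_right (by simpa using h2) (S.disp_pos F.pos x).le

lemma disp_le_deriv_mul (F : Frame α a b Q) (S : RotSystem T α V) {n : ℤ} (hn : n.natAbs ≤ 2 * Q)
    {x y : ℝ} (hy : y ∈ Set.Icc x (x + disp T a b x)) :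
    disp T a b (T n x) ≤ Real.exp (2 * V) * (deriv (T n) y * disp T a b x) := by
  obtain ⟨ξ, hξ, h⟩ := F.exists_deriv_mul_disp S n x
  have h1 := F.distortion S 1 (by simpa using hξ) (by simpa using hy) hn
  have h2 := deriv_le_of_distortion S h1
  rw [h, ← mul_assoc]
  refine mul_le_mul_of_nonneg_right (by simpa using h2) (S.disp_pos F.pos x).le

lemma left_mem (F : Frame α a b Q) (S : RotSystem T α V) (x : ℝ) :
    x ∈ Set.Icc x (x + disp T a b x) := ⟨le_rfl, by linarith [S.disp_pos F.pos x]⟩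

lemma fine_distortion (F : Frame α a b Q) (S : RotSystem T α V) {x y z : ℝ}
    (hy : y ∈ Set.Icc x (x + disp T a b x)) (hz : z ∈ Set.Icc x (x + disp T a b x))
    {n : ℤ} (hn : n.natAbs ≤ 2 * Q) :
    |Real.log (deriv (T n) y) - Real.log (deriv (T n) z)| ≤
      2 * V * Real.exp (2 * V) * (|y - z| / disp T a b x) := by
  obtain ⟨s, -, hsn, hs⟩ := S.exists_log_deriv_le n
  have hV := S.one_le_V
  have hd := S.disp_pos F.pos x
  have hsum := F.sum_disp_le_two S s hn x
  have hterm : ∀ i ∈ Finset.range n.natAbs, |T (s + i) y - T (s + i) z| ≤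
      Real.exp (2 * V) * (|y - z| / disp T a b x) * disp T a b (T (s + i) x) := by
    intro i hi
    have hb : ∀ t ∈ Set.Icc x (x + disp T a b x), ‖deriv (T (s + i)) t‖ ≤
        Real.exp (2 * V) * disp T a b (T (s + i) x) / disp T a b x := by
      intro t ht
      rw [Real.norm_eq_abs, abs_of_pos (S.deriv_pos _ _), le_div_iff₀ hd]
      exact F.deriv_mul_disp_le S ((hsn i (Finset.mem_range.1 hi)).trans hn) ht
    have := (convex_Icc _ _).norm_image_sub_le_of_norm_deriv_le
      (fun t _ => S.differentiable (s + i) t) hb hz hy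
    refine (this.trans (le_of_eq ?_))
    rw [Real.norm_eq_abs]; ring
  calc _ ≤ V * ∑ i ∈ Finset.range n.natAbs, |T (s + i) y - T (s + i) z| := hs y z
    _ ≤ V * ∑ i ∈ Finset.range n.natAbs,
          Real.exp (2 * V) * (|y - z| / disp T a b x) * disp T a b (T (s + i) x) :=
        mul_le_mul_of_nonneg_left (Finset.sum_le_sum hterm) (by linarith)
    _ = V * (Real.exp (2 * V) * (|y - z| / disp T a b x)) *
          ∑ i ∈ Finset.range n.natAbs, disp T a b (T (s + i) x) := by
        rw [← Finset.mul_sum]; ring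
    _ ≤ V * (Real.exp (2 * V) * (|y - z| / disp T a b x)) * 2 :=
        mul_le_mul_of_nonneg_left hsum (by positivity)
    _ = _ := by ring

lemma deriv_eq_one_of_isMin {T : ℤ → ℝ → ℝ} {α V : ℝ} (S : RotSystem T α V) {a b : ℤ} {x : ℝ}
    (h : ∀ y, disp T a b x ≤ disp T a b y) : deriv (T a) x = 1 := by
  have : IsLocalMin (disp T a b) x := Eventually.of_forall h
  have h1 := this.deriv_eq_zero
  rw [S.deriv_disp] at h1; linarith

lemma deriv_eq_one_of_isMax {T : ℤ → ℝ → ℝ} {α V : ℝ} (S : RotSystem T α V) {a b : ℤ} {x : ℝ}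
    (h : ∀ y, disp T a b y ≤ disp T a b x) : deriv (T a) x = 1 := by
  have : IsLocalMax (disp T a b) x := Eventually.of_forall h
  have h1 := this.deriv_eq_zero
  rw [S.deriv_disp] at h1; linarith

/-- Passing to a better return cannot decrease the minimal displacement too much. -/
lemma min_disp_step (V : ℝ) (hV : 1 ≤ V) : ∃ c > 0, ∀ (T : ℤ → ℝ → ℝ) (α : ℝ) (a b a' b' : ℤ)
    (Q : ℕ) (μ : ℝ), RotSystem T α V → Frame α a b Q → a'.natAbs ≤ 2 * Q → 0 < a' * α - b' →
    a' * α - b' < a * α - b → 0 ≤ μ → (∀ x, μ ≤ disp T a b x) →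
    ∀ x, c * ((a' * α - b') / (a * α - b)) ^ 2 * μ ≤ disp T a' b' x := by
  set K := 2 * V * Real.exp (2 * V) with hK
  have hK0 : 0 < K := by positivity
  set C := K * Real.exp K with hC
  have hC0 : 0 < C := by positivity
  refine ⟨1 / (4 * (1 + C) ^ 2), by positivity, ?_⟩
  intro T α a b a' b' Q μ S F ha' hδ' hlt hμ0 hμ
  have hδ := F.pos
  set δ := a * α - b with hδdef
  set δ' := a' * α - b' with hδ'def
  obtain ⟨x₀, hx₀⟩ := exists_isMin_of_periodic (S.disp_smooth a' b').continuous
    (S.disp_add_one a' b')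
  set d := disp T a' b' x₀ with hd
  set L := disp T a b x₀ with hLdef
  have hd0 : 0 < d := S.disp_pos hδ' x₀
  have hL0 : 0 < L := S.disp_pos hδ x₀
  have hD := deriv_eq_one_of_isMin S hx₀
  suffices h : 1 / (4 * (1 + C) ^ 2) * (δ' / δ) ^ 2 * L ≤ d by
    intro x
    refine le_trans ?_ (h.trans (hx₀ x))
    exact mul_le_mul_of_nonneg_left (hμ x₀) (by positivity)
  have hr0 : 0 < δ' / δ := by positivity
  have hr1 : δ' / δ ≤ 1 := (div_le_one hδ).2 hlt.le
  have hc1 : 1 / (4 * (1 + C) ^ 2) ≤ 1 := by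
    rw [div_le_one (by positivity)]; nlinarith
  rcases le_or_gt L d with hLd | hLd
  · have h1 : (δ' / δ) ^ 2 ≤ 1 := pow_le_one₀ hr0.le hr1
    have h2 : 1 / (4 * (1 + C) ^ 2) * (δ' / δ) ^ 2 ≤ 1 :=
      mul_le_one₀ hc1 (by positivity) h1
    nlinarith
  -- local quadratic bound for the displacement
  have hquad : ∀ y ∈ Set.Icc x₀ (x₀ + L), disp T a' b' y ≤ d + C * (y - x₀) ^ 2 / L := by
    intro y hy
    have hb : ∀ t ∈ Set.Icc x₀ y, ‖deriv (disp T a' b') t‖ ≤ C * (y - x₀) / L := by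
      intro t ht
      have hlog := F.fine_distortion S (y := t) (z := x₀) ⟨ht.1, ht.2.trans hy.2⟩
        (F.left_mem S x₀) ha'
      rw [hD, Real.log_one, sub_zero, abs_of_nonneg (by linarith [ht.1] : 0 ≤ t - x₀)] at hlog
      have hle1 : (t - x₀) / L ≤ 1 := by rw [div_le_one hL0]; linarith [ht.2, hy.2]
      have hle : |Real.log (deriv (T a') t)| ≤ K := hlog.trans (by
        calc K * ((t - x₀) / L) ≤ K * 1 := mul_le_mul_of_nonneg_left hle1 hK0.le
          _ = K := mul_one K)
      rw [S.deriv_disp, Real.norm_eq_abs]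
      have := abs_exp_sub_one_le (Real.log (deriv (T a') t))
      rw [Real.exp_log (S.deriv_pos _ _)] at this
      refine this.trans ?_
      calc _ ≤ (K * ((t - x₀) / L)) * Real.exp K :=
            mul_le_mul hlog (Real.exp_le_exp.2 hle) (Real.exp_pos _).le
              (mul_nonneg hK0.le (div_nonneg (by linarith [ht.1]) hL0.le))
        _ = C * (t - x₀) / L := by rw [hC]; ring
        _ ≤ _ := by gcongr; exact ht.2
    have := (convex_Icc x₀ y).norm_image_sub_le_of_norm_deriv_le
      (fun t _ => (S.disp_smooth a' b').infty_differentiable t) hb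
      (Set.left_mem_Icc.2 hy.1) (Set.right_mem_Icc.2 hy.1)
    rw [Real.norm_eq_abs, Real.norm_eq_abs, abs_of_nonneg (by linarith [hy.1] : 0 ≤ y - x₀)] at this
    have h2 := (abs_le.1 this).2
    have h3 : C * (y - x₀) / L * (y - x₀) = C * (y - x₀) ^ 2 / L := by ring
    linarith
  obtain ⟨J, hJ1, hJ2⟩ : ∃ J : ℕ, δ ≤ J * δ' ∧ J * δ' ≤ 2 * δ := by
    refine ⟨⌈δ / δ'⌉₊, ?_, ?_⟩
    · rw [← div_le_iff₀ hδ']; exact Nat.le_ceil _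
    · have h1 := (Nat.ceil_lt_add_one (by positivity : 0 ≤ δ / δ')).le
      have h2 : δ / δ' * δ' = δ := by field_simp
      nlinarith
  set s := Real.sqrt (d * L) with hs
  have hs2 : s ^ 2 = d * L := Real.sq_sqrt (by positivity)
  have hsL : s ≤ L := by
    rw [hs, Real.sqrt_le_left hL0.le]; nlinarith
  have hmain : s ≤ J * ((1 + C) * d) := by
    by_contra! hcon
    have hit : ∀ j : ℕ, j ≤ J → disp T (j * a') (j * b') x₀ ≤ j * ((1 + C) * d) := by
      intro j
      induction j with
      | zero => intro _; simp [S.disp_zero]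
      | succ j ih =>
        intro hj
        have ih' := ih (by omega)
        have hjs : disp T (j * a') (j * b') x₀ ≤ s := by
          have : (j : ℝ) ≤ J := by exact_mod_cast (by omega : j ≤ J)
          have := mul_le_mul_of_nonneg_right this (by positivity : 0 ≤ (1 + C) * d)
          linarith
        have hj0 := S.disp_mul_nonneg hδ' j x₀
        rw [S.disp_succ_mul]
        have hq := hquad (x₀ + disp T (j * a') (j * b') x₀) ⟨by linarith, by linarith⟩
        rw [add_sub_cancel_left] at hq
        have h4 : C * disp T (j * a') (j * b') x₀ ^ 2 / L ≤ C * d := by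
          rw [div_le_iff₀ hL0, mul_assoc C d L, ← hs2]
          exact mul_le_mul_of_nonneg_left (pow_le_pow_left₀ hj0 hjs 2) hC0.le
        push_cast
        linarith
    have h1 := hit J le_rfl
    have h2 := S.disp_mono (a := a) (b := b) (a' := J * a') (b' := J * b')
      (by push_cast; linarith) x₀
    linarith
  have hsq : d * L ≤ (J * ((1 + C) * d)) ^ 2 := by
    rw [← hs2]; exact pow_le_pow_left₀ (Real.sqrt_nonneg _) hmain 2
  have hL : L ≤ J ^ 2 * (1 + C) ^ 2 * d := by
    refine le_of_mul_le_mul_left (hsq.trans (le_of_eq ?_)) hd0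
    ring
  have hJr : J * (δ' / δ) ≤ 2 := by
    rw [← mul_div_assoc, div_le_iff₀ hδ]; exact hJ2
  have hJr2 : (J * (δ' / δ)) ^ 2 ≤ 2 ^ 2 := pow_le_pow_left₀ (by positivity) hJr 2
  calc 1 / (4 * (1 + C) ^ 2) * (δ' / δ) ^ 2 * L
      ≤ 1 / (4 * (1 + C) ^ 2) * (δ' / δ) ^ 2 * (J ^ 2 * (1 + C) ^ 2 * d) := by gcongr
    _ = (J * (δ' / δ)) ^ 2 / 4 * d := by field_simp
    _ ≤ 1 * d := by gcongr; linarith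
    _ = d := one_mul d

/-- Passing to a return at least twice as good decreases the maximal displacement by a definite
factor. -/
lemma max_disp_step (F : Frame α a b Q) (S : RotSystem T α V) {a' b' : ℤ} {M : ℝ}
    (h : 2 * (a * α - b) ≤ a' * α - b') (hM : ∀ x, disp T a' b' x ≤ M) (x : ℝ) :
    (1 + Real.exp (-(2 * V))) * disp T a b x ≤ M := by
  obtain ⟨x₀, hx₀⟩ := exists_isMax_of_periodic (S.disp_smooth a b).continuous
    (S.disp_add_one a b)
  have hD := deriv_eq_one_of_isMax S hx₀
  have hle := F.deriv_mul_disp_le S (n := a) (by have := F.natAbs_le; omega) (F.left_mem S x₀)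
  rw [hD, one_mul] at hle
  have h1 : Real.exp (-(2 * V)) * disp T a b x₀ ≤ disp T a b (T a x₀) := by
    rw [Real.exp_neg, inv_mul_le_iff₀ (Real.exp_pos _)]; exact hle
  have h2 := S.disp_add a b a b x₀
  rw [S.disp_sub_int] at h2
  have h3 := S.disp_mono (a := a + a) (b := b + b) (a' := a') (b' := b')
    (by push_cast; linarith) x₀
  have h4 := hM x₀
  calc _ ≤ (1 + Real.exp (-(2 * V))) * disp T a b x₀ :=
        mul_le_mul_of_nonneg_left (hx₀ x) (by positivity)
    _ ≤ M := by linarith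

end Frame

/-! ### Best rational approximations -/

/-- A signed best approximation of `α`: a positive return `aα - b`, better than all returns of
smaller time. -/
structure BestApprox (α : ℝ) (a b : ℤ) : Prop where
  ne_zero : a ≠ 0
  pos : 0 < a * α - b
  lt_half : a * α - b < 1 / 2
  sep : ∀ i l : ℤ, 0 < i → i < a.natAbs → a * α - b < |i * α - l|

lemma Irrational.mul_int_sub_ne_zero {α : ℝ} (h : Irrational α) {i : ℤ} (hi : i ≠ 0) (l : ℤ) :
    (i : ℝ) * α - l ≠ 0 := fun h0 => by
  have hi' : (i : ℝ) ≠ 0 := by exact_mod_cast hi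
  exact (irrational_iff_ne_rational α).1 h l i hi (by rw [eq_div_iff hi']; linarith)

lemma BestApprox.sep' {α : ℝ} {a b c d : ℤ} {Q : ℤ}
    (h : ∀ i l : ℤ, 0 < i → i < Q → c * α - d ≤ |i * α - l|) (ha : a ≠ 0) (haQ : |a| < Q) :
    c * α - d ≤ |a * α - b| := by
  rcases lt_or_gt_of_ne ha with h0 | h0
  · have := h (-a) (-b) (by omega) (by rwa [abs_of_neg h0] at haQ)
    push_cast at this
    rwa [show -(a : ℝ) * α - -b = -(a * α - b) by ring, abs_neg] at this
  · exact h a b h0 (by rwa [abs_of_pos h0] at haQ)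

lemma exists_pos_signed {α : ℝ} (hα : Irrational α) {q : ℤ} (hq : 0 < q) (p : ℤ) :
    ∃ a b : ℤ, a.natAbs = q.natAbs ∧ 0 < a * α - b ∧ a * α - b = |q * α - p| := by
  rcases lt_or_gt_of_ne (hα.mul_int_sub_ne_zero hq.ne' p) with h | h
  · refine ⟨-q, -p, by simp, ?_, ?_⟩
    · push_cast; linarith
    · rw [abs_of_neg h]; push_cast; ring
  · exact ⟨q, p, rfl, h, (abs_of_pos h).symm⟩

lemma BestApprox.exists_first {α : ℝ} (hα : Irrational α) :
    ∃ a b : ℤ, a.natAbs = 1 ∧ BestApprox α a b := by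
  obtain ⟨a, b, h1, h2, h3⟩ := exists_pos_signed hα one_pos (round α)
  refine ⟨a, b, by simpa using h1, ⟨by intro h; simp [h] at h1, h2, ?_, ?_⟩⟩
  · rw [h3]
    refine lt_of_le_of_ne (by simpa using abs_sub_round α) fun heq => ?_
    push_cast at heq
    rcases abs_eq (by norm_num : (0 : ℝ) ≤ 1 / 2) |>.1 heq with h | h
    · exact hα.mul_int_sub_ne_zero two_ne_zero (2 * round α + 1) (by push_cast; linarith)
    · exact hα.mul_int_sub_ne_zero two_ne_zero (2 * round α - 1) (by push_cast; linarith)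
  · intro i l hi hi'
    simp at h1; omega

lemma exists_int_mul_sub_lt (α : ℝ) {δ : ℝ} (hδ : 0 < δ) :
    ∃ q : ℕ, 0 < q ∧ ∃ p : ℤ, |q * α - p| < δ := by
  obtain ⟨n, hn⟩ := exists_nat_gt (1 / δ)
  have hn0 : 0 < n := by
    have : (0 : ℝ) < n := lt_trans (by positivity) hn
    exact_mod_cast this
  obtain ⟨j, k, hk0, -, h⟩ := Real.exists_int_int_abs_mul_sub_le α hn0
  refine ⟨k.toNat, by omega, j, ?_⟩
  have hk : ((k.toNat : ℕ) : ℝ) = k := by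
    have : ((k.toNat : ℕ) : ℤ) = k := Int.toNat_of_nonneg hk0.le
    exact_mod_cast this
  rw [hk]
  refine h.trans_lt ?_
  rw [div_lt_comm₀ (by positivity) hδ]
  linarith

lemma BestApprox.exists_next {α : ℝ} (hα : Irrational α) {a b : ℤ} (h : BestApprox α a b) :
    ∃ a' b' : ℤ, BestApprox α a' b' ∧ a' * α - b' < a * α - b ∧ a.natAbs < a'.natAbs ∧
      ∀ i l : ℤ, 0 < i → i < a'.natAbs → a * α - b ≤ |i * α - l| := by
  classical
  have hex := exists_int_mul_sub_lt α h.pos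
  obtain ⟨hq0, p, hp⟩ := Nat.find_spec hex
  set q := Nat.find hex with hq
  have hmin : ∀ i l : ℤ, 0 < i → i < q → a * α - b ≤ |i * α - l| := by
    intro i l hi hiq
    by_contra! hcon
    refine Nat.find_min hex (m := i.toNat) (by omega) ⟨by omega, l, ?_⟩
    have : ((i.toNat : ℕ) : ℝ) = i := by
      have : ((i.toNat : ℕ) : ℤ) = i := Int.toNat_of_nonneg hi.le
      exact_mod_cast this
    rwa [this]
  obtain ⟨a', b', h1, h2, h3⟩ := exists_pos_signed hα (q := q) (by exact_mod_cast hq0) p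
  have h3' : (a' : ℝ) * α - b' < a * α - b := by rw [h3]; exact_mod_cast hp
  have h1' : a'.natAbs = q := by simpa using h1
  refine ⟨a', b', ⟨by intro h0; simp [h0] at h1'; omega, h2, h3'.trans h.lt_half, ?_⟩, h3', ?_, ?_⟩
  · intro i l hi hi'
    exact h3'.trans_le (hmin i l hi (by omega))
  · by_contra! hcon
    rw [h1'] at hcon
    rcases hcon.lt_or_eq with hlt | heq
    · have := h.sep q p (by exact_mod_cast hq0) (by exact_mod_cast hlt)
      push_cast at this
      linarith
    · have haa : a' = a ∨ a' = -a := by omega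
      rcases haa with rfl | rfl
      · have hlt : (b : ℝ) < b' := by linarith
        have hlt1 : (b' : ℝ) < b + 1 := by linarith [h.lt_half]
        have h4 : b < b' := by exact_mod_cast hlt
        have h5 : b' < b + 1 := by exact_mod_cast hlt1
        omega
      · push_cast at h2 h3'
        have h4 : (0 : ℝ) < -b - b' := by linarith [h.pos]
        have h5 : -(b : ℝ) - b' < 1 := by linarith [h.lt_half]
        have h6 : 0 < -b - b' := by exact_mod_cast h4
        have h7 : -b - b' < 1 := by exact_mod_cast h5
        omega
  · intro i l hi hi'
    exact hmin i l hi (by omega)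

lemma exists_bestApprox_seq {α : ℝ} (hα : Irrational α) : ∃ a b : ℕ → ℤ, (a 0).natAbs = 1 ∧
    (∀ k, BestApprox α (a k) (b k)) ∧ (∀ k, a (k + 1) * α - b (k + 1) < a k * α - b k) ∧
    (∀ k, (a k).natAbs < (a (k + 1)).natAbs) ∧
    ∀ k, ∀ i l : ℤ, 0 < i → i < (a (k + 1)).natAbs → a k * α - b k ≤ |i * α - l| := by
  obtain ⟨a₀, b₀, h0, hb0⟩ := BestApprox.exists_first hα
  have hstep : ∀ p : {p : ℤ × ℤ // BestApprox α p.1 p.2},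
    ∃ p' : {p : ℤ × ℤ // BestApprox α p.1 p.2},
      p'.1.1 * α - p'.1.2 < p.1.1 * α - p.1.2 ∧ p.1.1.natAbs < p'.1.1.natAbs ∧
      ∀ i l : ℤ, 0 < i → i < p'.1.1.natAbs → p.1.1 * α - p.1.2 ≤ |i * α - l| := by
    rintro ⟨⟨a, b⟩, h⟩
    obtain ⟨a', b', h1, h2⟩ := h.exists_next hα
    exact ⟨⟨⟨a', b'⟩, h1⟩, h2⟩
  choose nxt hnxt using hstep
  let s : ℕ → {p : ℤ × ℤ // BestApprox α p.1 p.2} := fun k => nxt^[k] ⟨⟨a₀, b₀⟩, hb0⟩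
  have hs : ∀ k, s (k + 1) = nxt (s k) := fun k => Function.iterate_succ_apply' _ _ _
  refine ⟨fun k => (s k).1.1, fun k => (s k).1.2, h0, fun k => (s k).2, fun k => ?_, fun k => ?_,
    fun k => ?_⟩
  · simp only [hs]; exact (hnxt (s k)).1
  · simp only [hs]; exact (hnxt (s k)).2.1
  · simp only [hs]; exact (hnxt (s k)).2.2

/-- A sequence of consecutive signed best approximations. -/
structure BestSeq (α : ℝ) (a b : ℕ → ℤ) : Prop where
  first : (a 0).natAbs = 1
  best : ∀ k, BestApprox α (a k) (b k)
  lt : ∀ k, a (k + 1) * α - b (k + 1) < a k * α - b k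
  natAbs_lt : ∀ k, (a k).natAbs < (a (k + 1)).natAbs
  sep : ∀ k, ∀ i l : ℤ, 0 < i → i < (a (k + 1)).natAbs → a k * α - b k ≤ |i * α - l|

namespace BestSeq

variable {α : ℝ} {a b : ℕ → ℤ}

lemma antitone (B : BestSeq α a b) : StrictAnti (fun k => (a k : ℝ) * α - b k) :=
  strictAnti_nat_of_succ_lt B.lt

lemma strictMono (B : BestSeq α a b) : StrictMono (fun k => (a k).natAbs) :=
  strictMono_nat_of_lt_succ B.natAbs_lt

lemma natAbs_pos (B : BestSeq α a b) (k : ℕ) : 0 < (a k).natAbs :=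
  Int.natAbs_pos.2 (B.best k).ne_zero

lemma sub_sep (B : BestSeq α a b) (k : ℕ) {i j : ℕ} (hij : a i ≠ a j)
    (h : |a i - a j| < (a (k + 1)).natAbs) :
    a k * α - b k ≤ |(a i * α - b i) - (a j * α - b j)| := by
  have := BestApprox.sep' (b := b i - b j) (B.sep k) (sub_ne_zero.2 hij) h
  push_cast at this
  rwa [show ((a i : ℝ) - a j) * α - (b i - b j) = (a i * α - b i) - (a j * α - b j) by ring] at this

lemma mul_neg (B : BestSeq α a b) (k : ℕ) : a k * a (k + 1) < 0 := by
  by_contra! hcon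
  have h0 := (B.best k).ne_zero
  have h1 := (B.best (k + 1)).ne_zero
  have hlt := B.natAbs_lt k
  have hne : a (k + 1) ≠ a k := fun h => by rw [h] at hlt; omega
  have habs : |a (k + 1) - a k| < (a (k + 1)).natAbs := by
    rcases mul_nonneg_iff.1 hcon with ⟨h, h'⟩ | ⟨h, h'⟩
    · rw [abs_lt]; omega
    · rw [abs_lt]; omega
  have := B.sub_sep k hne habs
  rw [abs_of_neg (by linarith [B.lt k])] at this
  linarith [(B.best (k + 1)).pos]

lemma two_mul_le (B : BestSeq α a b) (k : ℕ) : 2 * (a k).natAbs ≤ (a (k + 2)).natAbs := by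
  by_contra! hcon
  have h1 := B.mul_neg k
  have h2 : a (k + 1) * a (k + 2) < 0 := B.mul_neg (k + 1)
  have hlt := B.natAbs_lt k
  have hlt' : (a (k + 1)).natAbs < (a (k + 2)).natAbs := B.natAbs_lt (k + 1)
  have hne : a (k + 2) ≠ a k := fun h => by rw [h] at hlt'; omega
  have hsign : 0 ≤ a k ∧ 0 ≤ a (k + 2) ∨ a k ≤ 0 ∧ a (k + 2) ≤ 0 := by
    rcases mul_neg_iff.1 h1 with h | h <;> rcases mul_neg_iff.1 h2 with h' | h' <;> omega
  have habs : |a (k + 2) - a k| < (a (k + 1)).natAbs := by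
    rw [abs_lt]; omega
  have := B.sub_sep k hne habs
  rw [abs_of_neg (by linarith [B.lt k, B.lt (k + 1)])] at this
  linarith [(B.best (k + 2)).pos]

lemma two_pow_le (B : BestSeq α a b) (k : ℕ) : 2 ^ k ≤ 2 * (a k).natAbs ^ 2 := by
  induction k using Nat.twoStepInduction with
  | zero => simp [B.first]
  | one =>
    have := B.natAbs_pos 1
    nlinarith
  | more k ih _ =>
    have := Nat.pow_le_pow_left (B.two_mul_le k) 2
    rw [pow_add]; nlinarith

lemma one_le_mul (B : BestSeq α a b) (k : ℕ) :
    1 ≤ 2 * ((a (k + 1)).natAbs : ℝ) * (a k * α - b k) := by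
  have h1 := B.mul_neg k
  have hd := B.lt k
  have hp := (B.best (k + 1)).pos
  have hlt : ((a k).natAbs : ℝ) < (a (k + 1)).natAbs := by exact_mod_cast B.natAbs_lt k
  have hq0 : (0 : ℝ) < (a k).natAbs := by exact_mod_cast B.natAbs_pos k
  have key : ∃ n : ℤ, ((a (k + 1)).natAbs : ℝ) * (a k * α - b k) +
      (a k).natAbs * (a (k + 1) * α - b (k + 1)) = n := by
    rcases mul_neg_iff.1 h1 with ⟨h, h'⟩ | ⟨h, h'⟩
    · refine ⟨a (k + 1) * b k - a k * b (k + 1), ?_⟩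
      rw [Nat.cast_natAbs, Nat.cast_natAbs, abs_of_pos h, abs_of_neg h']
      push_cast; ring
    · refine ⟨a k * b (k + 1) - a (k + 1) * b k, ?_⟩
      rw [Nat.cast_natAbs, Nat.cast_natAbs, abs_of_neg h, abs_of_pos h']
      push_cast; ring
  obtain ⟨n, hn⟩ := key
  have hn0 : (0 : ℝ) < n := by rw [← hn]; nlinarith
  have hn1 : (1 : ℝ) ≤ n := by exact_mod_cast (show 0 < n by exact_mod_cast hn0)
  nlinarith

lemma mul_le_one (B : BestSeq α a b) (k : ℕ) :
    ((a (k + 1)).natAbs : ℝ) * (a k * α - b k) ≤ 1 := by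
  have h0 := B.natAbs_pos k
  have hlt := B.natAbs_lt k
  obtain ⟨j, i, hi0, hin, h⟩ := Real.exists_int_int_abs_mul_sub_le α
    (n := (a (k + 1)).natAbs - 1) (by omega)
  have := B.sep k i j hi0 (by omega)
  have h2 := this.trans h
  rw [Nat.cast_sub (by omega), Nat.cast_one, sub_add_cancel,
    le_div_iff₀ (by exact_mod_cast B.natAbs_pos (k + 1))] at h2
  linarith

lemma tendsto_zero (B : BestSeq α a b) :
    Tendsto (fun k => (a k : ℝ) * α - b k) atTop (𝓝 0) := by
  have h1 : Tendsto (fun k => 1 / ((a (k + 1)).natAbs : ℝ)) atTop (𝓝 0) := by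
    have h2 : Tendsto (fun k => (a (k + 1)).natAbs) atTop atTop :=
      (tendsto_add_atTop_iff_nat 1).2 B.strictMono.tendsto_atTop
    simp only [one_div]
    exact (tendsto_inv_atTop_nhds_zero_nat (𝕜 := ℝ)).comp h2
  refine squeeze_zero (fun k => (B.best k).pos.le) (fun k => ?_) h1
  have h0 : (0 : ℝ) < (a (k + 1)).natAbs := by exact_mod_cast B.natAbs_pos (k + 1)
  rw [le_div_iff₀ h0, mul_comm]
  exact B.mul_le_one k

lemma exists_liouville (B : BestSeq α a b) (hL : Liouville α) (N K : ℕ) :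
    ∃ k ≥ K, ((a (k + 1)).natAbs : ℝ) ^ N * (a (k + 1) * α - b (k + 1)) < 1 := by
  have hδ := (B.best (K + 1)).pos
  obtain ⟨m, hm⟩ := exists_pow_lt_of_lt_one hδ (show (1 / 2 : ℝ) < 1 by norm_num)
  obtain ⟨p, q, hq1, hne, hlt⟩ := hL (N + m + 1)
  have hq0 : (0 : ℝ) < q := by exact_mod_cast (by omega : 0 < q)
  have hq2 : (2 : ℝ) ≤ q := by exact_mod_cast (by omega : 2 ≤ q)
  have hval : |(q : ℝ) * α - p| < 1 / (q : ℝ) ^ (N + m) := by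
    have : (q : ℝ) * α - p = q * (α - p / q) := by field_simp
    rw [this, abs_mul, abs_of_pos hq0]
    calc (q : ℝ) * |α - p / q| < q * (1 / (q : ℝ) ^ (N + m + 1)) :=
          mul_lt_mul_of_pos_left hlt hq0
      _ = _ := by rw [pow_succ]; field_simp
  classical
  have hex : ∃ j, q.natAbs < (a (j + 1)).natAbs := by
    have h2 : Tendsto (fun k => (a (k + 1)).natAbs) atTop atTop :=
      (tendsto_add_atTop_iff_nat 1).2 B.strictMono.tendsto_atTop
    exact (h2.eventually_gt_atTop q.natAbs).exists
  obtain ⟨j, hj, hj'⟩ : ∃ j, q.natAbs < (a (j + 1)).natAbs ∧ (a j).natAbs ≤ q.natAbs := by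
    refine ⟨Nat.find hex, Nat.find_spec hex, ?_⟩
    rcases h : Nat.find hex with _ | n
    · rw [B.first]; omega
    · exact not_lt.1 (Nat.find_min hex (by omega : n < Nat.find hex))
  have hsep := (B.sep j q p (by omega) (by omega)).trans_lt hval
  have hpos := (B.best j).pos
  have hKj : K + 1 < j := by
    refine (B.antitone.lt_iff_gt).1 (lt_trans hsep (lt_of_le_of_lt ?_ hm))
    rw [one_div, one_div, ← inv_pow]
    calc ((q : ℝ)⁻¹) ^ (N + m) ≤ ((q : ℝ)⁻¹) ^ m :=
          pow_le_pow_of_le_one (by positivity) (inv_le_one_of_one_le₀ (by linarith)) (by omega)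
      _ ≤ (2⁻¹) ^ m := by gcongr
  obtain ⟨k, rfl⟩ : ∃ k, j = k + 1 := ⟨j - 1, by omega⟩
  refine ⟨k, by omega, ?_⟩
  rw [lt_div_iff₀ (by positivity)] at hsep
  have hle : ((a (k + 1)).natAbs : ℝ) ≤ q := by
    have : ((a (k + 1)).natAbs : ℤ) ≤ q := by omega
    simpa only [Int.cast_natCast] using (Int.cast_le (R := ℝ)).2 this
  have hpow : ((a (k + 1)).natAbs : ℝ) ^ N ≤ (q : ℝ) ^ (N + m) :=
    (pow_le_pow_left₀ (by positivity) hle N).trans (pow_le_pow_right₀ (by linarith) (by omega))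
  calc _ ≤ (q : ℝ) ^ (N + m) * (a (k + 1) * α - b (k + 1)) :=
        mul_le_mul_of_nonneg_right hpow hpos.le
    _ < 1 := by linarith

/-- Consecutive best approximations yield frames. -/
lemma frame (B : BestSeq α a b) (k : ℕ) : Frame α (a k) (b k) (a (k + 1)).natAbs where
  pos := (B.best k).pos
  le_one := by linarith [(B.best k).lt_half]
  one_le := B.natAbs_pos _
  natAbs_le := (B.natAbs_lt k).le
  sep := B.sep k

end BestSeq

lemma exists_bestSeq {α : ℝ} (hα : Irrational α) : ∃ a b : ℕ → ℤ, BestSeq α a b := by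
  obtain ⟨a, b, h1, h2, h3, h4, h5⟩ := exists_bestApprox_seq hα
  exact ⟨a, b, h1, h2, h3, h4, h5⟩

lemma exists_le_two_pow (C : ℝ) : ∃ n : ℕ, C ≤ 2 ^ n := by
  obtain ⟨n, hn⟩ := pow_unbounded_of_one_lt C (one_lt_two (α := ℝ))
  exact ⟨n, hn.le⟩

namespace BestSeq

variable {T : ℤ → ℝ → ℝ} {α V : ℝ} {a b : ℕ → ℤ}

lemma exists_min_disp_le (B : BestSeq α a b) (S : RotSystem T α V) : ∃ c > 0, ∃ μ > 0, ∀ k x,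
    c ^ k * (a k * α - b k) ^ 2 * μ ≤ disp T (a k) (b k) x := by
  obtain ⟨c, hc, hstep⟩ := Frame.min_disp_step V S.one_le_V
  obtain ⟨x₀, hx₀⟩ := exists_isMin_of_periodic (S.disp_smooth (a 0) (b 0)).continuous
    (S.disp_add_one (a 0) (b 0))
  have h0 := S.disp_pos (B.best 0).pos x₀
  have hδ : ∀ k, 0 < a k * α - b k := fun k => (B.best k).pos
  refine ⟨c, hc, disp T (a 0) (b 0) x₀, h0, fun k => ?_⟩
  induction k with
  | zero =>
    intro x
    refine le_trans ?_ (hx₀ x)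
    have h1 : (a 0 * α - b 0) ^ 2 ≤ 1 := pow_le_one₀ (hδ 0).le (by linarith [(B.best 0).lt_half])
    rw [pow_zero, one_mul]
    nlinarith
  | succ k ih =>
    intro x
    refine le_of_eq_of_le ?_ (hstep T α (a k) (b k) (a (k + 1)) (b (k + 1)) _ _ S (B.frame k)
      (by omega) (hδ (k + 1)) (B.lt k) (by have := hδ k; positivity) ih x)
    have := (hδ k).ne'
    set d := (a k : ℝ) * α - b k
    field_simp
    ring

/-- The displacements are polynomially bounded from below in terms of the return times. -/
lemma exists_one_le_pow_mul_disp (B : BestSeq α a b) (S : RotSystem T α V) : ∃ A : ℕ, ∀ k x,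
    1 ≤ ((a (k + 1)).natAbs : ℝ) ^ A * disp T (a k) (b k) x := by
  obtain ⟨c, hc, μ, hμ, h⟩ := B.exists_min_disp_le S
  obtain ⟨r, hr⟩ := exists_le_two_pow c⁻¹
  obtain ⟨s, hs⟩ := exists_le_two_pow μ⁻¹
  refine ⟨3 * r + s + 4, fun k x => ?_⟩
  set q : ℝ := ((a (k + 1)).natAbs : ℝ) with hq
  have hq2 : (2 : ℝ) ≤ q := by
    have h1 := B.natAbs_lt k
    have h2 := B.natAbs_pos k
    rw [hq]; exact_mod_cast (by omega : 2 ≤ (a (k + 1)).natAbs)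
  have hδ := (B.best k).pos
  have h1 : (2 : ℝ) ^ k ≤ q ^ 3 := by
    have h2 : 2 ^ k ≤ 2 * (a (k + 1)).natAbs ^ 2 :=
      (B.two_pow_le k).trans (Nat.mul_le_mul_left 2 (Nat.pow_le_pow_left (B.natAbs_lt k).le 2))
    have h3 : (2 : ℝ) ^ k ≤ 2 * q ^ 2 := by rw [hq]; exact_mod_cast h2
    nlinarith [sq_nonneg q]
  have hck : 1 ≤ q ^ (3 * r) * c ^ k := by
    have h2 : 1 ≤ 2 ^ r * c := by
      have := mul_le_mul_of_nonneg_right hr hc.le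
      rwa [inv_mul_cancel₀ hc.ne'] at this
    calc (1 : ℝ) ≤ (2 ^ r * c) ^ k := one_le_pow₀ h2
      _ = (2 ^ k) ^ r * c ^ k := by rw [mul_pow, ← pow_mul, ← pow_mul, mul_comm r k]
      _ ≤ (q ^ 3) ^ r * c ^ k := by gcongr
      _ = _ := by rw [← pow_mul]
  have hμs : 1 ≤ q ^ s * μ := by
    have h2 := mul_le_mul_of_nonneg_right hs hμ.le
    rw [inv_mul_cancel₀ hμ.ne'] at h2
    exact h2.trans (by gcongr)
  have hδ2 : 1 ≤ q ^ 4 * (a k * α - b k) ^ 2 := by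
    have h2 : 1 ≤ q ^ 2 * (a k * α - b k) := by
      have := B.one_le_mul k
      nlinarith [mul_le_mul_of_nonneg_right hq2 (mul_nonneg (by linarith : 0 ≤ q) hδ.le)]
    calc (1 : ℝ) ≤ (q ^ 2 * (a k * α - b k)) ^ 2 := one_le_pow₀ h2
      _ = _ := by ring
  calc (1 : ℝ) ≤ (q ^ (3 * r) * c ^ k) * (q ^ s * μ) * (q ^ 4 * (a k * α - b k) ^ 2) :=
        one_le_mul_of_one_le_of_one_le (one_le_mul_of_one_le_of_one_le hck hμs) hδ2
    _ = q ^ (3 * r + s + 4) * (c ^ k * (a k * α - b k) ^ 2 * μ) := by ring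
    _ ≤ _ := mul_le_mul_of_nonneg_left (h k x) (by positivity)

/-- The displacements tend to zero uniformly. -/
lemma exists_disp_le (B : BestSeq α a b) (S : RotSystem T α V) {ε : ℝ} (hε : 0 < ε) :
    ∃ K, ∀ k ≥ K, ∀ x, disp T (a k) (b k) x ≤ ε := by
  set lam := 1 + Real.exp (-(2 * V)) with hlam
  have hlam1 : 1 < lam := by linarith [Real.exp_pos (-(2 * V))]
  have key : ∀ n : ℕ, ∃ K, ∀ k ≥ K, ∀ x, lam ^ n * disp T (a k) (b k) x ≤ 1 := by
    intro n
    induction n with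
    | zero =>
      refine ⟨0, fun k _ x => ?_⟩
      have := S.le (i := a k) (k := -b k) (j := 0) (l := 1)
        (by push_cast; linarith [(B.best k).lt_half]) x
      rw [S.zero] at this
      push_cast at this
      simp only [disp]; linarith
    | succ n ih =>
      obtain ⟨K, hK⟩ := ih
      have hev := B.tendsto_zero.eventually
        (gt_mem_nhds (show (0 : ℝ) < (a K * α - b K) / 2 by linarith [(B.best K).pos]))
      obtain ⟨K', hK'⟩ := eventually_atTop.1 hev
      refine ⟨K', fun k hk x => ?_⟩
      have h1 := (B.frame k).max_disp_step S (a' := a K) (b' := b K) (M := (lam ^ n)⁻¹)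
        (by linarith [hK' k hk]) (fun y => by
          rw [← one_div, le_div_iff₀ (by positivity), mul_comm]; exact hK K le_rfl y) x
      rw [← one_div, le_div_iff₀ (by positivity)] at h1
      rw [pow_succ]; linarith
  obtain ⟨n, hn⟩ := pow_unbounded_of_one_lt ε⁻¹ hlam1
  obtain ⟨K, hK⟩ := key n
  refine ⟨K, fun k hk x => ?_⟩
  have h1 := hK k hk x
  have h2 := S.disp_pos (B.best k).pos x
  have h3 := mul_le_mul_of_nonneg_right hn.le h2.le
  have h4 : ε⁻¹ * disp T (a k) (b k) x ≤ 1 := h3.trans h1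
  rwa [inv_mul_le_iff₀ hε, mul_one] at h4

end BestSeq

/-- A frame whose time `Q` is a much closer return. -/
structure MainFrame (α : ℝ) (a b : ℤ) (Q : ℕ) (p : ℤ) : Prop extends Frame α a b Q where
  theta_lt : |(Q : ℝ) * α - p| < a * α - b
  cover : ∀ t : ℝ, ∃ i k : ℤ, 0 ≤ i ∧ i < Q ∧ t < i * α - k ∧ i * α - k < t + 4 * (a * α - b)

lemma Frame.cover_of_small {α : ℝ} {a b : ℤ} {Q : ℕ} {p : ℤ} (F : Frame α a b Q)
    (haQ : a.natAbs < Q) (h : 3 * |(Q : ℝ) * α - p| < (a * α - b) ^ 2) (t : ℝ) :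
    ∃ i k : ℤ, 0 ≤ i ∧ i < Q ∧ t < i * α - k ∧ i * α - k < t + 4 * (a * α - b) := by
  have hδ := F.pos
  have hδ1 := F.le_one
  set δ := a * α - b with hδdef
  set θ := (Q : ℝ) * α - p with hθ
  set j : ℤ := ⌊Int.fract t / δ⌋ + 2 with hj
  have hQ : (0 : ℤ) < Q := by have := F.one_le; omega
  have hf0 := Int.fract_nonneg t
  have hf1 := Int.fract_lt_one t
  have hj1 : (j : ℝ) * δ ≤ Int.fract t + 2 * δ := by
    have := Int.floor_le (Int.fract t / δ)
    rw [le_div_iff₀ hδ] at this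
    rw [hj]; push_cast; linarith
  have hj2 : Int.fract t + δ < (j : ℝ) * δ := by
    have := Int.lt_floor_add_one (Int.fract t / δ)
    rw [div_lt_iff₀ hδ] at this
    rw [hj]; push_cast; linarith
  have hj0 : 0 ≤ j := by
    have : 0 ≤ ⌊Int.fract t / δ⌋ := Int.floor_nonneg.2 (by positivity)
    omega
  set c : ℤ := (j * a) / Q with hc
  set i : ℤ := (j * a) % Q with hi
  have hdiv : Q * c + i = j * a := Int.mul_ediv_add_emod (j * a) Q
  have hi0 : 0 ≤ i := Int.emod_nonneg _ hQ.ne'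
  have hiQ : i < Q := Int.emod_lt_of_pos _ hQ
  have hcj : |c| ≤ j := by
    rw [abs_le]
    constructor
    · refine Int.le_ediv_of_mul_le hQ ?_
      nlinarith [show -(Q : ℤ) ≤ a by omega]
    · refine Int.ediv_le_of_le_mul hQ ?_
      nlinarith [show a ≤ (Q : ℤ) by omega]
  have hcθ : |(c : ℝ) * θ| < δ := by
    rw [abs_mul]
    have h1 : |(c : ℝ)| ≤ j := by rw [← Int.cast_abs]; exact_mod_cast hcj
    have h2 : |(c : ℝ)| * |θ| ≤ j * |θ| := mul_le_mul_of_nonneg_right h1 (abs_nonneg _)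
    have h3 : (j : ℝ) * δ ≤ 3 := by linarith
    have h4 : (j : ℝ) * |θ| * δ < δ * δ := by nlinarith [abs_nonneg θ]
    exact h2.trans_lt (lt_of_mul_lt_mul_right h4 hδ.le)
  have heq : (i : ℝ) * α - (j * b - c * p) = j * δ - c * θ := by
    have : (Q : ℝ) * c + i = j * a := by exact_mod_cast hdiv
    rw [hδdef, hθ]
    linear_combination α * this
  refine ⟨i, j * b - c * p - ⌊t⌋, hi0, hiQ, ?_, ?_⟩
  · have := Int.self_sub_floor t
    push_cast
    have := abs_lt.1 hcθ
    linarith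
  · have := Int.self_sub_floor t
    push_cast
    have := abs_lt.1 hcθ
    linarith

/-- Existence of arbitrarily good main frames when the rotation number is Liouville. -/
lemma exists_mainFrame {T : ℤ → ℝ → ℝ} {α V : ℝ} (S : RotSystem T α V) (hL : Liouville α) :
    ∃ A : ℕ, ∀ (N : ℕ) (ε : ℝ), 0 < ε → ∃ (a b p : ℤ) (Q : ℕ), MainFrame α a b Q p ∧
      (∀ x, 1 ≤ (Q : ℝ) ^ A * disp T a b x) ∧ (∀ x, disp T a b x ≤ ε) ∧
      (Q : ℝ) ^ N * |(Q : ℝ) * α - p| < 1 := by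
  obtain ⟨a, b, B⟩ := exists_bestSeq S.irr
  obtain ⟨A, hA⟩ := B.exists_one_le_pow_mul_disp S
  refine ⟨A, fun N ε hε => ?_⟩
  obtain ⟨K, hK⟩ := B.exists_disp_le S hε
  obtain ⟨k, hk, hlt⟩ := B.exists_liouville hL (N + 6) K
  obtain ⟨p, hp⟩ : ∃ p : ℤ, |((a (k + 1)).natAbs : ℝ) * α - p| = a (k + 1) * α - b (k + 1) := by
    have h0 := (B.best (k + 1)).pos
    rcases le_total 0 (a (k + 1)) with h | h
    · refine ⟨b (k + 1), ?_⟩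
      rw [Nat.cast_natAbs, abs_of_nonneg h, abs_of_pos h0]
    · refine ⟨-b (k + 1), ?_⟩
      rw [Nat.cast_natAbs, abs_of_nonpos h, ← abs_of_pos h0, ← abs_neg]
      congr 1; push_cast; ring
  have hQ2 : 2 ≤ (a (k + 1)).natAbs := by
    have h1 := B.natAbs_lt k
    have h2 := B.natAbs_pos k
    omega
  set Q := (a (k + 1)).natAbs with hQ
  have hQ2' : (2 : ℝ) ≤ Q := by exact_mod_cast hQ2
  have h0 := (B.best (k + 1)).pos
  rw [← hp] at hlt h0
  have hδ := (B.best k).pos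
  have hsmall : 3 * |(Q : ℝ) * α - p| < (a k * α - b k) ^ 2 := by
    have h1 := B.one_le_mul k
    rw [← hQ] at h1
    have h2 : (2 * (Q : ℝ)) ^ 2 * (3 * |(Q : ℝ) * α - p|) < 1 := by
      refine lt_of_le_of_lt ?_ hlt
      have h3 : (16 : ℝ) ≤ Q ^ 4 := by
        calc (16 : ℝ) = 2 ^ 4 := by norm_num
          _ ≤ _ := by gcongr
      have h4 : (Q : ℝ) ^ 6 ≤ Q ^ (N + 6) := pow_le_pow_right₀ (by linarith) (by omega)
      have h5 : (2 * (Q : ℝ)) ^ 2 * 3 ≤ (Q : ℝ) ^ (N + 6) := by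
        refine le_trans ?_ h4
        nlinarith [sq_nonneg (Q : ℝ), mul_le_mul_of_nonneg_left h3 (sq_nonneg (Q : ℝ))]
      calc _ = (2 * (Q : ℝ)) ^ 2 * 3 * |(Q : ℝ) * α - p| := by ring
        _ ≤ _ := mul_le_mul_of_nonneg_right h5 (abs_nonneg _)
    have h6 : 1 ≤ (2 * (Q : ℝ)) ^ 2 * (a k * α - b k) ^ 2 := by
      rw [← mul_pow]; exact one_le_pow₀ h1
    exact lt_of_mul_lt_mul_left (h2.trans_le h6) (by positivity)
  refine ⟨a k, b k, p, Q, ⟨B.frame k, ?_, ?_⟩, hA k, hK k hk, ?_⟩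
  · rw [hp]; exact B.lt k
  · exact (B.frame k).cover_of_small (B.natAbs_lt k) hsmall
  · refine lt_of_le_of_lt ?_ hlt
    refine mul_le_mul_of_nonneg_right ?_ (abs_nonneg _)
    exact pow_le_pow_right₀ (by linarith) (by omega)

namespace MainFrame

variable {T : ℤ → ℝ → ℝ} {α V : ℝ} {a b : ℤ} {Q : ℕ} {p : ℤ}

/-- Every orbit of length `Q` visits every quadruple of consecutive fundamental intervals. -/
lemma exists_apply_mem (F : MainFrame α a b Q p) (S : RotSystem T α V) (x z : ℝ) :
    ∃ i k : ℤ, 0 ≤ i ∧ i < Q ∧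
      T i x - k ∈ Set.Icc z (z + disp T ((4 : ℕ) * a) ((4 : ℕ) * b) z) := by
  obtain ⟨H, hH, hHk, hHT⟩ := S.exists_semiconj
  obtain ⟨i, k, h0, hQ, h1, h2⟩ := F.cover (H z - H x)
  have hval : H (T i x - k) = H x + i * α - k := by
    have := hHk (T i x) (-k)
    push_cast at this
    rw [← sub_eq_add_neg] at this
    rw [this, hHT]; ring
  refine ⟨i, k, h0, hQ, ?_, ?_⟩
  · by_contra! hcon
    have := hH hcon.le
    rw [hval] at this; linarith
  · by_contra! hcon
    have h3 := hH hcon.le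
    have h4 : z + disp T ((4 : ℕ) * a) ((4 : ℕ) * b) z =
        T ((4 : ℕ) * a) z + ((-((4 : ℕ) * b) : ℤ) : ℝ) := by
      simp only [disp]; push_cast; ring
    rw [h4, hHk, hHT, hval] at h3
    push_cast at h3
    linarith

lemma exists_mem_apply_eq (F : MainFrame α a b Q p) (S : RotSystem T α V) (x z : ℝ) :
    ∃ (j : ℕ) (k : ℤ) (y : ℝ), j < Q ∧ T j y = x - k ∧
      y ∈ Set.Icc z (z + disp T ((4 : ℕ) * a) ((4 : ℕ) * b) z) := by
  obtain ⟨i, k, h0, hQ, h⟩ := F.exists_apply_mem S (T (-((Q : ℤ) - 1)) x) z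
  refine ⟨((Q : ℤ) - 1 - i).toNat, k, _, by omega, ?_, h⟩
  rw [S.sub_int, ← S.add, ← S.add]
  rw [show (((Q : ℤ) - 1 - i).toNat : ℤ) + i + -((Q : ℤ) - 1) = 0 by omega, S.zero]

/-- The Denjoy inequality. -/
lemma abs_log_deriv_le (F : MainFrame α a b Q p) (S : RotSystem T α V) (x : ℝ) :
    |Real.log (deriv (T a) x)| ≤ 10 * V := by
  obtain ⟨z, hz⟩ := exists_isMin_of_periodic (S.disp_smooth a b).continuous (S.disp_add_one a b)
  have hz1 := Frame.deriv_eq_one_of_isMin S hz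
  obtain ⟨i, k, h0, hQ, h⟩ := F.exists_apply_mem S x z
  have hm := S.disp_pos F.pos x
  have h1 := F.distortion S 1 (x := x) (y := T a x - b) (z := x)
    (by simp only [Nat.cast_one, one_mul, Set.mem_Icc]
        constructor <;> simp only [disp] at hm ⊢ <;> linarith)
    (by simp only [Nat.cast_one, one_mul]; exact F.left_mem S x) (n := i) (by omega)
  have h2 := F.distortion S 4 (x := z) (z := z) h
    ⟨le_rfl, by linarith [S.disp_mul_nonneg F.pos 4 z]⟩ (n := a) (by have := F.natAbs_le; omega)
  rw [hz1, Real.log_one, sub_zero, S.deriv_sub_int] at h2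
  rw [S.deriv_sub_int] at h1
  have h3 := S.log_deriv_add a i x
  rw [add_comm, S.log_deriv_add i a x] at h3
  have : Real.log (deriv (T a) x) = Real.log (deriv (T a) (T i x)) -
    (Real.log (deriv (T i) (T a x)) - Real.log (deriv (T i) x)) := by linarith
  rw [this]
  have h4 := abs_sub (Real.log (deriv (T a) (T i x)))
    (Real.log (deriv (T i) (T a x)) - Real.log (deriv (T i) x))
  push_cast at h1 h2
  linarith

lemma deriv_le (F : MainFrame α a b Q p) (S : RotSystem T α V) (x : ℝ) :
    deriv (T a) x ≤ Real.exp (10 * V) := by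
  rw [← Real.log_le_iff_le_exp (S.deriv_pos a x)]
  exact (abs_le.1 (F.abs_log_deriv_le S x)).2

lemma le_deriv (F : MainFrame α a b Q p) (S : RotSystem T α V) (x : ℝ) :
    (Real.exp (10 * V))⁻¹ ≤ deriv (T a) x := by
  rw [← Real.exp_neg, ← Real.le_log_iff_exp_le (S.deriv_pos a x)]
  exact (abs_le.1 (F.abs_log_deriv_le S x)).1

lemma one_le_exp (S : RotSystem T α V) : 1 ≤ Real.exp (10 * V) :=
  Real.one_le_exp (by linarith [S.one_le_V])

lemma abs_deriv_disp_le (F : MainFrame α a b Q p) (S : RotSystem T α V) (x : ℝ) :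
    |deriv (disp T a b) x| ≤ Real.exp (10 * V) := by
  rw [S.deriv_disp, abs_le]
  constructor <;> linarith [F.deriv_le S x, S.deriv_pos a x, one_le_exp S]

lemma abs_disp_sub_le (F : MainFrame α a b Q p) (S : RotSystem T α V) (x y : ℝ) :
    |disp T a b y - disp T a b x| ≤ Real.exp (10 * V) * |y - x| := by
  have := Convex.norm_image_sub_le_of_norm_deriv_le (f := disp T a b) (s := Set.univ) (x := x)
    (y := y) (C := Real.exp (10 * V)) (fun z _ => (S.disp_smooth a b).infty_differentiable z)
    (fun z _ => F.abs_deriv_disp_le S z) convex_univ trivial trivial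
  simpa using this

lemma disp_le_of_mem (F : MainFrame α a b Q p) (S : RotSystem T α V) {x y : ℝ}
    (hy : y ∈ Set.Icc x (x + disp T a b x)) :
    disp T a b y ≤ Real.exp (10 * V) * disp T a b x ∧
      disp T a b x ≤ Real.exp (10 * V) * disp T a b y := by
  obtain ⟨z, -, hz⟩ := exists_deriv_eq_slope_of_le (S.differentiable a) hy.1
  have h1 := mul_le_mul_of_nonneg_right (F.deriv_le S z) (sub_nonneg.2 hy.1)
  have h2 := mul_le_mul_of_nonneg_right (F.le_deriv S z) (sub_nonneg.2 hy.1)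
  have hE := one_le_exp S
  have hE0 := Real.exp_pos (10 * V)
  have hle := hy.2
  have heq : disp T a b y = (x + disp T a b x - y) + (T a y - T a x) := by simp only [disp]; ring
  rw [hz] at heq
  constructor
  · nlinarith [mul_nonneg (sub_nonneg.2 hE) (sub_nonneg.2 hle)]
  · have h3 : (y - x) ≤ Real.exp (10 * V) * (deriv (T a) z * (y - x)) := by
      rwa [inv_mul_le_iff₀ hE0] at h2
    rw [heq, mul_add]
    nlinarith [mul_nonneg (sub_nonneg.2 hE) (sub_nonneg.2 hle)]

lemma disp_le_of_mem_mul (F : MainFrame α a b Q p) (S : RotSystem T α V) {x y : ℝ} (L : ℕ)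
    (hy : y ∈ Set.Icc x (x + disp T (L * a) (L * b) x)) :
    disp T a b y ≤ Real.exp (10 * V) ^ L * disp T a b x ∧
      disp T a b x ≤ Real.exp (10 * V) ^ L * disp T a b y := by
  have hE := one_le_exp S
  induction L generalizing y with
  | zero =>
    simp only [Nat.cast_zero, zero_mul, S.disp_zero, add_zero, Set.mem_Icc] at hy
    obtain rfl : y = x := le_antisymm hy.2 hy.1
    simp
  | succ L ih =>
    rcases le_total y (x + disp T (L * a) (L * b) x) with h | h
    · obtain ⟨h1, h2⟩ := ih ⟨hy.1, h⟩
      have hx0 := S.disp_pos F.pos x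
      have hy0 := S.disp_pos F.pos y
      have hp : Real.exp (10 * V) ^ L ≤ Real.exp (10 * V) ^ (L + 1) :=
        pow_le_pow_right₀ hE (by omega)
      exact ⟨h1.trans (by gcongr), h2.trans (by gcongr)⟩
    · obtain ⟨h1, h2⟩ := ih (y := x + disp T (L * a) (L * b) x)
        ⟨by linarith [S.disp_mul_nonneg F.pos L x], le_rfl⟩
      have hy2 := hy.2
      rw [S.disp_succ_mul] at hy2
      obtain ⟨h3, h4⟩ := F.disp_le_of_mem S (y := y) ⟨h, by linarith⟩
      have hE0 := Real.exp_pos (10 * V)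
      constructor
      · refine h3.trans ?_
        rw [pow_succ', mul_assoc]; gcongr
      · refine h2.trans ?_
        rw [pow_succ, mul_assoc]; gcongr

end MainFrame

lemma exists_bound_of_periodic {f : ℝ → ℝ} (hf : Continuous f) (hp : ∀ x, f (x + 1) = f x) :
    ∃ K, 1 ≤ K ∧ ∀ x, |f x| ≤ K := by
  obtain ⟨z, hz⟩ := exists_isMax_of_periodic hf.abs (fun x => by rw [hp])
  exact ⟨max 1 |f z|, le_max_left _ _, fun x => (hz x).trans (le_max_right _ _)⟩

/-- The nonlinearity of `T n`: the derivative of the logarithm of its derivative. -/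
def nonlin (T : ℤ → ℝ → ℝ) (n : ℤ) (x : ℝ) : ℝ := deriv (fun y => Real.log (deriv (T n) y)) x

/-- The Schwarzian derivative of `T n`. -/
def schwarz (T : ℤ → ℝ → ℝ) (n : ℤ) (x : ℝ) : ℝ := deriv (nonlin T n) x - nonlin T n x ^ 2 / 2

namespace RotSystem

variable {T : ℤ → ℝ → ℝ} {α V : ℝ}

lemma deriv_smooth (S : RotSystem T α V) (n : ℤ) : ContDiff ℝ ∞ (deriv (T n)) := by
  simpa using (S.smooth n).infty_iteratedDeriv 1

lemma log_deriv_smooth (S : RotSystem T α V) (n : ℤ) :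
    ContDiff ℝ ∞ (fun y => Real.log (deriv (T n) y)) :=
  (S.deriv_smooth n).log fun x => (S.deriv_pos n x).ne'

lemma nonlin_smooth (S : RotSystem T α V) (n : ℤ) : ContDiff ℝ ∞ (nonlin T n) := by
  have h := (S.log_deriv_smooth n).infty_iteratedDeriv 1
  rwa [iteratedDeriv_one] at h

lemma deriv_add_one (S : RotSystem T α V) (n : ℤ) (x : ℝ) :
    deriv (T n) (x + 1) = deriv (T n) x := by
  have := S.deriv_sub_int n (x + 1) 1
  rw [← this]; simp

lemma nonlin_add_one (S : RotSystem T α V) (n : ℤ) (x : ℝ) :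
    nonlin T n (x + 1) = nonlin T n x := by
  unfold nonlin
  rw [← deriv_comp_add_const (f := fun y => Real.log (deriv (T n) y))]
  simp only [S.deriv_add_one]

lemma schwarz_smooth (S : RotSystem T α V) (n : ℤ) : ContDiff ℝ ∞ (schwarz T n) := by
  have h1 : ContDiff ℝ ∞ (deriv (nonlin T n)) := by
    simpa using (S.nonlin_smooth n).infty_iteratedDeriv 1
  exact h1.sub (((S.nonlin_smooth n).pow 2).div_const 2)

lemma schwarz_add_one (S : RotSystem T α V) (n : ℤ) (x : ℝ) :
    schwarz T n (x + 1) = schwarz T n x := by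
  unfold schwarz
  rw [← deriv_comp_add_const (f := nonlin T n)]
  simp only [S.nonlin_add_one]

lemma nonlin_sub_int (S : RotSystem T α V) (n : ℤ) (x : ℝ) (k : ℤ) :
    nonlin T n (x - k) = nonlin T n x := by
  have h := add_int_of_add_one (f := fun y => nonlin T n y + y)
    (fun y => by rw [S.nonlin_add_one]; ring) x (-k)
  push_cast at h
  rw [← sub_eq_add_neg] at h
  linarith

lemma hasDerivAt (S : RotSystem T α V) (n : ℤ) (x : ℝ) :
    HasDerivAt (T n) (deriv (T n) x) x := (S.differentiable n x).hasDerivAt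

lemma hasDerivAt_log (S : RotSystem T α V) (n : ℤ) (x : ℝ) :
    HasDerivAt (fun y => Real.log (deriv (T n) y)) (nonlin T n x) x :=
  ((S.log_deriv_smooth n).infty_differentiable x).hasDerivAt

lemma hasDerivAt_nonlin (S : RotSystem T α V) (n : ℤ) (x : ℝ) :
    HasDerivAt (nonlin T n) (deriv (nonlin T n) x) x :=
  ((S.nonlin_smooth n).infty_differentiable x).hasDerivAt

lemma hasDerivAt_deriv (S : RotSystem T α V) (n : ℤ) (x : ℝ) :
    HasDerivAt (deriv (T n)) (nonlin T n x * deriv (T n) x) x := by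
  have h1 := (((S.deriv_smooth n).infty_differentiable) x).hasDerivAt
  have h2 := (S.hasDerivAt_log n x).unique (h1.log (S.deriv_pos n x).ne')
  have h3 := (S.deriv_pos n x).ne'
  rw [h2, div_mul_cancel₀ _ h3]; exact h1

lemma nonlin_add (S : RotSystem T α V) (i j : ℤ) (x : ℝ) :
    nonlin T (i + j) x = nonlin T i (T j x) * deriv (T j) x + nonlin T j x := by
  have h1 : (fun y => Real.log (deriv (T (i + j)) y)) =
      fun y => Real.log (deriv (T i) (T j y)) + Real.log (deriv (T j) y) :=
    funext fun y => S.log_deriv_add i j y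
  have h2 := ((S.hasDerivAt_log i (T j x)).comp x (S.hasDerivAt j x)).add (S.hasDerivAt_log j x)
  rw [nonlin, h1]
  exact h2.deriv

lemma schwarz_add (S : RotSystem T α V) (i j : ℤ) (x : ℝ) :
    schwarz T (i + j) x = schwarz T i (T j x) * deriv (T j) x ^ 2 + schwarz T j x := by
  have h1 : nonlin T (i + j) =
      fun y => nonlin T i (T j y) * deriv (T j) y + nonlin T j y :=
    funext fun y => S.nonlin_add i j y
  have h2 := (((S.hasDerivAt_nonlin i (T j x)).comp x (S.hasDerivAt j x)).mul
    (S.hasDerivAt_deriv j x)).add (S.hasDerivAt_nonlin j x)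
  have h3 := h2.deriv
  rw [show nonlin T i ∘ T j * deriv (T j) + nonlin T j = nonlin T (i + j) from h1.symm] at h3
  simp only [schwarz]
  rw [h3, S.nonlin_add]
  simp only [Function.comp_apply]
  ring

lemma schwarz_natCast (S : RotSystem T α V) (n : ℕ) (x : ℝ) :
    schwarz T n x = ∑ i ∈ Finset.range n, schwarz T 1 (T i x) * deriv (T i) x ^ 2 := by
  induction n with
  | zero =>
    have h := S.schwarz_add 0 0 x
    rw [S.zero, S.deriv_zero, add_zero] at h
    simp only [Nat.cast_zero, Finset.range_zero, Finset.sum_empty]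
    linarith
  | succ n ih =>
    rw [Finset.sum_range_succ, ← ih, Nat.cast_succ, add_comm (n : ℤ) 1, S.schwarz_add]
    ring

end RotSystem

namespace Frame

variable {T : ℤ → ℝ → ℝ} {α V : ℝ} {a b : ℤ} {Q : ℕ}

lemma sum_deriv_sq_le (F : Frame α a b Q) (S : RotSystem T α V) {M : ℝ}
    (hM : ∀ x, disp T a b x ≤ M) {n : ℕ} (hn : n ≤ 2 * Q) (x : ℝ) :
    (∑ i ∈ Finset.range n, deriv (T i) x ^ 2) * disp T a b x ^ 2 ≤
      2 * Real.exp (2 * V) ^ 2 * M := by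
  have hsum := F.sum_disp_le_two S 0 hn x
  have hM0 : 0 ≤ M := (S.disp_pos F.pos x).le.trans (hM x)
  rw [Finset.sum_mul]
  calc _ ≤ ∑ i ∈ Finset.range n, Real.exp (2 * V) ^ 2 * M * disp T a b (T (0 + i) x) := by
        refine Finset.sum_le_sum fun i hi => ?_
        have hi' : (i : ℤ).natAbs ≤ 2 * Q := by have := Finset.mem_range.1 hi; omega
        have h1 := F.deriv_mul_disp_le S hi' (F.left_mem S x)
        have h2 := mul_nonneg (S.deriv_pos i x).le (S.disp_pos F.pos x).le
        have h3 := (S.disp_pos F.pos (T i x)).le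
        rw [zero_add, ← mul_pow]
        calc _ ≤ (Real.exp (2 * V) * disp T a b (T i x)) ^ 2 := pow_le_pow_left₀ h2 h1 2
          _ = Real.exp (2 * V) ^ 2 * (disp T a b (T i x) * disp T a b (T i x)) := by ring
          _ ≤ Real.exp (2 * V) ^ 2 * (M * disp T a b (T i x)) := by
            gcongr; exact hM _
          _ = _ := by ring
    _ = Real.exp (2 * V) ^ 2 * M * ∑ i ∈ Finset.range n, disp T a b (T (0 + i) x) := by
        rw [Finset.mul_sum]
    _ ≤ Real.exp (2 * V) ^ 2 * M * 2 := by gcongr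
    _ = _ := by ring

lemma abs_schwarz_le (F : Frame α a b Q) (S : RotSystem T α V) {M K : ℝ}
    (hM : ∀ x, disp T a b x ≤ M) (hK : ∀ x, |schwarz T 1 x| ≤ K) {n : ℕ} (hn : n ≤ 2 * Q) (x : ℝ) :
    |schwarz T n x| * disp T a b x ^ 2 ≤ K * (2 * Real.exp (2 * V) ^ 2 * M) := by
  have hK0 : 0 ≤ K := (abs_nonneg _).trans (hK 0)
  rw [S.schwarz_natCast]
  calc _ ≤ (K * ∑ i ∈ Finset.range n, deriv (T i) x ^ 2) * disp T a b x ^ 2 := by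
        refine mul_le_mul_of_nonneg_right ?_ (sq_nonneg _)
        rw [Finset.mul_sum]
        refine (Finset.abs_sum_le_sum_abs _ _).trans (Finset.sum_le_sum fun i _ => ?_)
        rw [abs_mul, abs_of_nonneg (sq_nonneg (deriv (T i) x))]
        exact mul_le_mul_of_nonneg_right (hK _) (sq_nonneg _)
    _ ≤ _ := by
        rw [mul_assoc]
        exact mul_le_mul_of_nonneg_left (F.sum_deriv_sq_le S hM hn x) hK0

lemma nonlin_sq_mul_le (F : Frame α a b Q) (S : RotSystem T α V) {M K μ : ℝ}
    (hM : ∀ x, disp T a b x ≤ M) (hK : ∀ x, |schwarz T 1 x| ≤ K) (hμ0 : 0 ≤ μ)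
    (hμ : ∀ x, μ ≤ disp T a b x) {n : ℕ} (hn : n ≤ 2 * Q) (x : ℝ) :
    nonlin T n x ^ 2 * μ ^ 2 ≤ 2 * (K * (2 * Real.exp (2 * V) ^ 2 * M)) := by
  obtain ⟨z, hz⟩ := exists_isMax_of_periodic ((S.nonlin_smooth n).pow 2).continuous
    (fun x => by rw [S.nonlin_add_one])
  have hd := ((S.hasDerivAt_nonlin n z).pow 2).deriv
  have h0 : deriv (fun y => nonlin T n y ^ 2) z = 0 :=
    IsLocalMax.deriv_eq_zero (Eventually.of_forall hz)
  have hS := F.abs_schwarz_le S hM hK hn z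
  have h1 : nonlin T n x ^ 2 * μ ^ 2 ≤ nonlin T n z ^ 2 * disp T a b z ^ 2 := by
    have := hμ z
    have := hz x
    gcongr
  refine h1.trans ?_
  rcases eq_or_ne (nonlin T n z) 0 with hw | hw
  · have := (mul_nonneg (abs_nonneg (schwarz T n z)) (sq_nonneg (disp T a b z))).trans hS
    rw [hw]; linarith
  · have h2 : deriv (nonlin T n) z = 0 := by
      have h3 : (2 : ℝ) * nonlin T n z * deriv (nonlin T n) z = 0 := by
        have h4 := h0
        rw [show (fun y => nonlin T n y ^ 2) = nonlin T n ^ 2 from rfl, hd] at h4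
        simpa using h4
      rcases mul_eq_zero.1 h3 with h | h
      · exact absurd h (by simpa using hw)
      · exact h
    have h3 : nonlin T n z ^ 2 = 2 * |schwarz T n z| := by
      rw [schwarz, h2, zero_sub, abs_neg, abs_of_nonneg (by positivity)]; ring
    rw [h3]; linarith

end Frame

lemma MainFrame.exists_nonlin_le {T : ℤ → ℝ → ℝ} {α V : ℝ} (S : RotSystem T α V) :
    ∃ C, 1 ≤ C ∧ ∀ (a b p : ℤ) (Q : ℕ) (M : ℝ), MainFrame α a b Q p → (∀ x, disp T a b x ≤ M) →
      ∀ n : ℕ, n ≤ Q → ∀ x, |nonlin T n x| * disp T a b x ≤ C * √M := by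
  obtain ⟨K, hK1, hK⟩ := exists_bound_of_periodic (S.schwarz_smooth 1).continuous
    (S.schwarz_add_one 1)
  set E := Real.exp (10 * V) with hE
  set e := Real.exp (2 * V) with he
  have hE1 : 1 ≤ E := one_le_exp S
  have he1 : 1 ≤ e := Real.one_le_exp (by linarith [S.one_le_V])
  have hs1 : 1 ≤ √(2 * (K * (2 * e ^ 2))) :=
    Real.one_le_sqrt.2 (by nlinarith [one_le_pow₀ he1 (n := 2)])
  refine ⟨e * (2 * (E ^ 4 * √(2 * (K * (2 * e ^ 2))))), ?_, fun a b p Q M F hM n hn x => ?_⟩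
  · have : 1 ≤ E ^ 4 * √(2 * (K * (2 * e ^ 2))) :=
      one_le_mul_of_one_le_of_one_le (one_le_pow₀ hE1) hs1
    nlinarith
  obtain ⟨z, hz⟩ := exists_isMin_of_periodic (S.disp_smooth a b).continuous (S.disp_add_one a b)
  have hz0 := S.disp_pos F.pos z
  obtain ⟨j, k, y, hj, hy, hmem⟩ := F.exists_mem_apply_eq S x z
  have hM0 : 0 ≤ M := hz0.le.trans (hM z)
  have hy0 := S.disp_pos F.pos y
  have near : ∀ i : ℕ, i ≤ 2 * Q →
      |nonlin T i y| * disp T a b y ≤ E ^ 4 * √(2 * (K * (2 * e ^ 2))) * √M := by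
    intro i hi
    have h1 := F.nonlin_sq_mul_le S hM hK hz0.le hz hi y
    have h2 : |nonlin T i y| * disp T a b z ≤ √(2 * (K * (2 * e ^ 2))) * √M := by
      rw [← Real.sqrt_mul (by positivity)]
      refine Real.le_sqrt_of_sq_le ?_
      rw [mul_pow, sq_abs]; linarith
    calc _ ≤ |nonlin T i y| * (E ^ 4 * disp T a b z) :=
          mul_le_mul_of_nonneg_left (F.disp_le_of_mem_mul S 4 hmem).1 (abs_nonneg _)
      _ = E ^ 4 * (|nonlin T i y| * disp T a b z) := by ring
      _ ≤ E ^ 4 * (√(2 * (K * (2 * e ^ 2))) * √M) := by gcongr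
      _ = _ := by ring
  have hadd := S.nonlin_add n j y
  rw [hy, S.nonlin_sub_int] at hadd
  have h1 : disp T a b x ≤ e * (deriv (T j) y * disp T a b y) := by
    have := F.disp_le_deriv_mul S (n := j) (by omega) (F.left_mem S y)
    rwa [hy, S.disp_sub_int] at this
  have h2 := near (n + j) (by omega)
  have h3 := near j (by omega)
  push_cast at h2
  have h4 : |nonlin T n x| * deriv (T j) y ≤ |nonlin T (n + j) y| + |nonlin T j y| := by
    rw [← abs_of_pos (S.deriv_pos j y), ← abs_mul,
      show nonlin T n x * deriv (T j) y = nonlin T (n + j) y - nonlin T j y by linarith]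
    exact abs_sub _ _
  calc _ ≤ |nonlin T n x| * (e * (deriv (T j) y * disp T a b y)) :=
        mul_le_mul_of_nonneg_left h1 (abs_nonneg _)
    _ = e * (|nonlin T n x| * deriv (T j) y * disp T a b y) := by ring
    _ ≤ e * ((|nonlin T (n + j) y| + |nonlin T j y|) * disp T a b y) := by gcongr
    _ ≤ e * (2 * (E ^ 4 * √(2 * (K * (2 * e ^ 2))) * √M)) := by
        refine mul_le_mul_of_nonneg_left ?_ (by positivity)
        rw [add_mul]; linarith
    _ = _ := by ring

lemma iteratedDeriv_periodic {f : ℝ → ℝ} (hp : ∀ x, f (x + 1) = f x) (n : ℕ) (x : ℝ) :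
    iteratedDeriv n f (x + 1) = iteratedDeriv n f x := by
  have h := congrFun (iteratedDeriv_comp_add_const n f 1) x
  rw [← h]
  simp only [hp]

lemma exists_bound_iteratedDeriv {f : ℝ → ℝ} (hf : ContDiff ℝ ∞ f) (hp : ∀ x, f (x + 1) = f x)
    (n : ℕ) : ∃ K, 1 ≤ K ∧ ∀ i ≤ n, ∀ x, |iteratedDeriv i f x| ≤ K := by
  induction n with
  | zero =>
    obtain ⟨K, h1, h⟩ := exists_bound_of_periodic hf.continuous hp
    exact ⟨K, h1, fun i hi x => by rw [Nat.le_zero.1 hi]; simpa using h x⟩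
  | succ n ih =>
    obtain ⟨K, h1, h⟩ := ih
    obtain ⟨K', h1', h'⟩ := exists_bound_of_periodic (hf.infty_iteratedDeriv (n + 1)).continuous
      (iteratedDeriv_periodic hp (n + 1))
    refine ⟨max K K', h1.trans (le_max_left _ _), fun i hi x => ?_⟩
    rcases Nat.le_add_one_iff.1 hi with hi | rfl
    · exact (h i hi x).trans (le_max_left _ _)
    · exact (h' x).trans (le_max_right _ _)

/-- Derivative bounds for a function from derivative bounds of its logarithmic derivative. -/
lemma exists_abs_iteratedDeriv_le_of_deriv_eq_mul (n : ℕ) {C : ℝ} (hC : 0 ≤ C) :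
    ∃ C', 1 ≤ C' ∧ ∀ (D w : ℝ → ℝ) (B x : ℝ), ContDiff ℝ ∞ D → ContDiff ℝ ∞ w → 0 < D x →
      (∀ y, deriv D y = w y * D y) → 0 ≤ B →
      (∀ i < n, |iteratedDeriv i w x| ≤ C * B * B ^ i) →
      ∀ i ≤ n, |iteratedDeriv i D x| ≤ C' * D x * B ^ i := by
  induction n with
  | zero =>
    refine ⟨1, le_rfl, fun D w B x _ _ h0 _ _ _ i hi => ?_⟩
    rw [Nat.le_zero.1 hi]
    simp [abs_of_pos h0]
  | succ n ih =>
    obtain ⟨C', h1, h⟩ := ih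
    refine ⟨C' + 2 ^ n * C * C', le_add_of_le_of_nonneg h1 (by positivity),
      fun D w B x hD hw h0 hd hB hb i hi => ?_⟩
    have ih' := h D w B x hD hw h0 hd hB fun i hi => hb i (by omega)
    rcases Nat.le_add_one_iff.1 hi with hi | rfl
    · refine (ih' i hi).trans ?_
      gcongr
      exact le_add_of_nonneg_right (by positivity)
    · rw [iteratedDeriv_succ', show deriv D = fun y => w y * D y from funext hd]
      refine (abs_iteratedDeriv_mul_le hw hD (fun i hi => hb i (by omega)) ih').trans ?_
      have : 0 ≤ C' * D x * B ^ (n + 1) := by positivity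
      calc _ = 2 ^ n * C * C' * D x * B ^ (n + 1) := by ring
        _ ≤ 2 ^ n * C * C' * D x * B ^ (n + 1) + C' * D x * B ^ (n + 1) :=
          le_add_of_nonneg_right this
        _ = _ := by ring

/-- Uniform bounds of order `k` for the nonlinearities of the first `Q` iterates. -/
def NonlinBound (T : ℤ → ℝ → ℝ) (α : ℝ) (k : ℕ) (C : ℝ) : Prop :=
  ∀ (a b p : ℤ) (Q : ℕ) (M : ℝ), MainFrame α a b Q p → (∀ x, disp T a b x ≤ M) → M ≤ 1 →
    ∀ n : ℕ, n ≤ Q → ∀ x, ∀ i ≤ k, |iteratedDeriv i (nonlin T n) x| ≤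
      C * (√M / disp T a b x) * (√M / disp T a b x) ^ i

section

variable {T : ℤ → ℝ → ℝ} {α V : ℝ}

lemma MainFrame.deriv_le_sqrt {a b p : ℤ} {Q : ℕ} {M : ℝ} (F : MainFrame α a b Q p)
    (S : RotSystem T α V) (hM : ∀ x, disp T a b x ≤ M) (hM1 : M ≤ 1) {n : ℕ} (hn : n ≤ 2 * Q)
    (x : ℝ) : deriv (T n) x ≤ Real.exp (2 * V) * (√M / disp T a b x) := by
  have h0 := S.disp_pos F.pos x
  have h1 := F.deriv_mul_disp_le S (n := n) (by omega) (F.left_mem S x)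
  rw [← mul_div_assoc, le_div_iff₀ h0]
  refine h1.trans ?_
  gcongr
  have hM0 : 0 ≤ M := h0.le.trans (hM x)
  refine (hM _).trans (Real.le_sqrt_of_sq_le ?_)
  nlinarith

lemma NonlinBound.exists_deriv_bound {k : ℕ} {C : ℝ} (hC : 0 ≤ C) (h : NonlinBound T α k C)
    (S : RotSystem T α V) :
    ∃ C', 1 ≤ C' ∧ ∀ (a b p : ℤ) (Q : ℕ) (M : ℝ), MainFrame α a b Q p →
      (∀ x, disp T a b x ≤ M) → M ≤ 1 → ∀ n : ℕ, n ≤ Q → ∀ x,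
      (∀ i ≤ k + 1, |iteratedDeriv i (deriv (T n)) x| ≤
        C' * deriv (T n) x * (√M / disp T a b x) ^ i) ∧
      (∀ i, 1 ≤ i → i ≤ k + 2 → |iteratedDeriv i (T n) x| ≤ (C' * (√M / disp T a b x)) ^ i) := by
  obtain ⟨C₁, hC₁, h₁⟩ := exists_abs_iteratedDeriv_le_of_deriv_eq_mul (k + 1) hC
  have he : 1 ≤ Real.exp (2 * V) := Real.one_le_exp (by linarith [S.one_le_V])
  refine ⟨C₁ * Real.exp (2 * V), one_le_mul_of_one_le_of_one_le hC₁ he,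
    fun a b p Q M F hM hM1 n hn x => ?_⟩
  have h0 := S.disp_pos F.pos x
  have hB : 0 ≤ √M / disp T a b x := by positivity
  have hD := h₁ (deriv (T n)) (nonlin T n) _ x (S.deriv_smooth n) (S.nonlin_smooth n)
    (S.deriv_pos n x) (fun y => (S.hasDerivAt_deriv n y).deriv) hB
    fun i hi => h a b p Q M F hM hM1 n hn x i (by omega)
  have hD0 := S.deriv_pos n x
  constructor
  · intro i hi
    refine (hD i hi).trans ?_
    gcongr
    nlinarith
  · intro i hi1 hi
    obtain ⟨j, rfl⟩ : ∃ j, i = j + 1 := ⟨i - 1, by omega⟩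
    rw [iteratedDeriv_succ']
    refine (hD j (by omega)).trans ?_
    calc _ ≤ C₁ * (Real.exp (2 * V) * (√M / disp T a b x)) * (√M / disp T a b x) ^ j := by
          gcongr; exact F.deriv_le_sqrt S hM hM1 (by omega) x
      _ = (C₁ * Real.exp (2 * V)) * (√M / disp T a b x) ^ (j + 1) := by ring
      _ ≤ (C₁ * Real.exp (2 * V)) ^ (j + 1) * (√M / disp T a b x) ^ (j + 1) := by
          gcongr
          exact le_self_pow₀ (one_le_mul_of_one_le_of_one_le hC₁ he) (by omega)
      _ = _ := by rw [← mul_pow]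

lemma RotSystem.deriv_nonlin_eq (S : RotSystem T α V) (n : ℕ) :
    deriv (nonlin T n) = fun x =>
      (∑ i ∈ Finset.range n, schwarz T 1 (T i x) * (deriv (T i) x * deriv (T i) x)) +
        nonlin T n x * nonlin T n x / 2 := by
  funext x
  have h := S.schwarz_natCast n x
  rw [schwarz] at h
  simp only [← sq]
  linarith

lemma NonlinBound.exists_succ {k : ℕ} {C : ℝ} (hC : 0 ≤ C) (h : NonlinBound T α k C)
    (S : RotSystem T α V) : ∃ C', 0 ≤ C' ∧ NonlinBound T α (k + 1) C' := by
  obtain ⟨C₁, hC₁, h₁⟩ := h.exists_deriv_bound hC S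
  obtain ⟨K, hK1, hK⟩ := exists_bound_iteratedDeriv (S.schwarz_smooth 1) (S.schwarz_add_one 1) k
  set C₂ : ℝ := 2 ^ k * (k.factorial * K * C₁ ^ k) * (2 ^ k * C₁ * C₁) with hC₂
  set e := Real.exp (2 * V) with he
  refine ⟨C + (C₂ * (2 * e ^ 2) + 2 ^ k * C * C), by positivity,
    fun a b p Q M F hM hM1 n hn x i hi => ?_⟩
  have h0 := S.disp_pos F.pos x
  have hM0 : 0 ≤ M := h0.le.trans (hM x)
  have hw := h a b p Q M F hM hM1 n hn x
  set B := √M / disp T a b x with hBdef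
  have hB : 0 ≤ B := by positivity
  rcases Nat.le_add_one_iff.1 hi with hi | rfl
  · refine (hw i hi).trans ?_
    gcongr
    exact le_add_of_nonneg_right (by positivity)
  have hterm : ∀ j ∈ Finset.range n, |iteratedDeriv k
      (fun y => schwarz T 1 (T j y) * (deriv (T j) y * deriv (T j) y)) x| ≤
      C₂ * B ^ k * deriv (T j) x ^ 2 := by
    intro j hj
    obtain ⟨hD, hT⟩ := h₁ a b p Q M F hM hM1 j (by have := Finset.mem_range.1 hj; omega) x
    rw [← hBdef] at hD hT
    have hu : ∀ i ≤ k, |iteratedDeriv i (fun y => schwarz T 1 (T j y)) x| ≤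
        (k.factorial * K * C₁ ^ k) * B ^ i := by
      intro i hi
      refine (abs_iteratedDeriv_comp_le (S.schwarz_smooth 1) (S.smooth j)
        (fun i' hi' => hK i' (by omega) _) (fun i' h1 h2 => hT i' h1 (by omega))).trans ?_
      rw [mul_pow, ← mul_assoc]
      gcongr
    have hv : ∀ i ≤ k, |iteratedDeriv i (fun y => deriv (T j) y * deriv (T j) y) x| ≤
        (2 ^ k * C₁ * C₁ * deriv (T j) x ^ 2) * B ^ i := by
      intro i hi
      refine (abs_iteratedDeriv_mul_le (S.deriv_smooth j) (S.deriv_smooth j)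
        (fun i' hi' => hD i' (by omega)) (fun i' hi' => hD i' (by omega))).trans ?_
      have hD0 := (S.deriv_pos j x).le
      calc _ = 2 ^ i * (C₁ * C₁ * deriv (T j) x ^ 2 * B ^ i) := by ring
        _ ≤ 2 ^ k * (C₁ * C₁ * deriv (T j) x ^ 2 * B ^ i) := by
          gcongr; norm_num
        _ = _ := by ring
    refine (abs_iteratedDeriv_mul_le ((S.schwarz_smooth 1).comp (S.smooth j))
      ((S.deriv_smooth j).mul (S.deriv_smooth j)) hu hv).trans (le_of_eq ?_)
    rw [hC₂]; ring
  have hsm : ∀ j ∈ Finset.range n, ContDiff ℝ ∞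
      (fun y => schwarz T 1 (T j y) * (deriv (T j) y * deriv (T j) y)) := fun j _ =>
    ((S.schwarz_smooth 1).comp (S.smooth j)).mul ((S.deriv_smooth j).mul (S.deriv_smooth j))
  have hww := abs_iteratedDeriv_mul_le (S.nonlin_smooth n) (S.nonlin_smooth n) hw hw
  rw [iteratedDeriv_succ', S.deriv_nonlin_eq, iteratedDeriv_fun_add
    ((ContDiff.sum hsm).infty_contDiffAt k x)
    ((((S.nonlin_smooth n).mul (S.nonlin_smooth n)).div_const 2).infty_contDiffAt k x),
    iteratedDeriv_fun_sum (fun j hj => (hsm j hj).infty_contDiffAt k x), iteratedDeriv_div_const]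
  have hsum : |∑ j ∈ Finset.range n, iteratedDeriv k
      (fun y => schwarz T 1 (T j y) * (deriv (T j) y * deriv (T j) y)) x| ≤
      C₂ * B ^ k * (2 * e ^ 2 * B ^ 2) := by
    refine (Finset.abs_sum_le_sum_abs _ _).trans ((Finset.sum_le_sum hterm).trans ?_)
    rw [← Finset.mul_sum]
    gcongr
    have h3 := F.sum_deriv_sq_le S hM (by omega : n ≤ 2 * Q) x
    rw [hBdef, div_pow, Real.sq_sqrt hM0, ← mul_div_assoc, le_div_iff₀ (by positivity)]
    exact h3
  have hhalf : |iteratedDeriv k (fun y => nonlin T n y * nonlin T n y) x / 2| ≤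
      2 ^ k * (C * B) * (C * B) * B ^ k := by
    rw [abs_div, abs_two]
    have := abs_nonneg (iteratedDeriv k (fun y => nonlin T n y * nonlin T n y) x)
    linarith
  refine (abs_add_le _ _).trans ((add_le_add hsum hhalf).trans ?_)
  have : 0 ≤ C * B * B ^ (k + 1) := by positivity
  calc _ = (C₂ * (2 * e ^ 2) + 2 ^ k * C * C) * B * B ^ (k + 1) := by ring
    _ ≤ (C₂ * (2 * e ^ 2) + 2 ^ k * C * C) * B * B ^ (k + 1) + C * B * B ^ (k + 1) :=
      le_add_of_nonneg_right this
    _ = _ := by ring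

lemma RotSystem.exists_nonlinBound (S : RotSystem T α V) (k : ℕ) :
    ∃ C, 0 ≤ C ∧ NonlinBound T α k C := by
  induction k with
  | zero =>
    obtain ⟨C, hC, h⟩ := MainFrame.exists_nonlin_le S
    refine ⟨C, by linarith, fun a b p Q M F hM _ n hn x i hi => ?_⟩
    rw [Nat.le_zero.1 hi, iteratedDeriv_zero, pow_zero, mul_one, ← mul_div_assoc,
      le_div_iff₀ (S.disp_pos F.pos x)]
    exact h a b p Q M F hM n hn x
  | succ k ih =>
    obtain ⟨C, hC, h⟩ := ih
    exact h.exists_succ hC S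

/-- The estimates of Yoccoz for the derivatives of the first `Q` iterates. -/
lemma RotSystem.exists_iterate_bound (S : RotSystem T α V) (k : ℕ) :
    ∃ C, 1 ≤ C ∧ ∀ (a b p : ℤ) (Q : ℕ) (M : ℝ), MainFrame α a b Q p →
      (∀ x, disp T a b x ≤ M) → M ≤ 1 → ∀ n : ℕ, n ≤ Q → ∀ x,
      ∀ i, 1 ≤ i → i ≤ k → |iteratedDeriv i (T n) x| ≤ (C * (√M / disp T a b x)) ^ i := by
  obtain ⟨C, hC, h⟩ := S.exists_nonlinBound k
  obtain ⟨C', hC', h'⟩ := h.exists_deriv_bound hC S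
  exact ⟨C', hC', fun a b p Q M F hM hM1 n hn x i h1 h2 =>
    (h' a b p Q M F hM hM1 n hn x).2 i h1 (by omega)⟩

end

/-- The point `x` moved by `L` fundamental intervals. -/
def adv (T : ℤ → ℝ → ℝ) (a b : ℤ) (L : ℕ) (x : ℝ) : ℝ := x + disp T (L * a) (L * b) x

section

variable {T : ℤ → ℝ → ℝ} {α V : ℝ} {a b p : ℤ} {Q : ℕ}

lemma adv_eq (L : ℕ) (x : ℝ) : adv T a b L x = T (L * a) x - ((L * b : ℤ) : ℝ) := by
  simp only [adv, disp]; ring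

namespace RotSystem

lemma adv_zero (S : RotSystem T α V) (x : ℝ) : adv T a b 0 x = x := by
  simp [adv, S.disp_zero]

lemma adv_succ (S : RotSystem T α V) (L : ℕ) (x : ℝ) :
    adv T a b (L + 1) x = adv T a b L x + disp T a b (adv T a b L x) := by
  simp only [adv]; rw [S.disp_succ_mul]; ring

lemma adv_add (S : RotSystem T α V) (K L : ℕ) (x : ℝ) :
    adv T a b (K + L) x = adv T a b K (adv T a b L x) := by
  simp only [adv_eq]
  rw [S.sub_int, ← S.add]
  push_cast
  rw [add_mul, add_mul]; ring

lemma adv_mono (S : RotSystem T α V) (h : 0 < a * α - b) (x : ℝ) :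
    StrictMono fun L => adv T a b L x :=
  strictMono_nat_of_lt_succ fun L => by
    rw [S.adv_succ]; linarith [S.disp_pos h (adv T a b L x)]

lemma adv_strictMono (S : RotSystem T α V) (L : ℕ) : StrictMono (adv T a b L) := fun x y h => by
  simp only [adv_eq]; linarith [S.strictMono (L * a) h]

lemma adv_le (S : RotSystem T α V) {M : ℝ} (hM : ∀ x, disp T a b x ≤ M) (L : ℕ) (x : ℝ) :
    adv T a b L x ≤ x + L * M := by
  induction L with
  | zero => simp [S.adv_zero]
  | succ L ih => rw [S.adv_succ]; push_cast; linarith [hM (adv T a b L x)]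

lemma abs_disp_sub_le (S : RotSystem T α V) (a b : ℤ) (x : ℝ) :
    |disp T a b x - (a * α - b)| ≤ 1 := by
  have h1 := S.le (i := a) (k := -b) (j := 0) (l := ⌈a * α - b⌉)
    (by push_cast; linarith [Int.le_ceil (a * α - b)]) x
  have h2 := S.le (i := 0) (k := ⌊a * α - b⌋) (j := a) (l := -b)
    (by push_cast; linarith [Int.floor_le (a * α - b)]) x
  rw [S.zero] at h1 h2
  push_cast at h1 h2
  simp only [disp]
  rw [abs_le]
  constructor <;> linarith [Int.ceil_lt_add_one (a * α - b), Int.lt_floor_add_one (a * α - b)]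

lemma mul_le_disp (S : RotSystem T α V) {c : ℝ} (h : ∀ x, c ≤ disp T a b x) (n : ℕ) (x : ℝ) :
    n * c ≤ disp T (n * a) (n * b) x := by
  induction n with
  | zero => simp [S.disp_zero]
  | succ n ih =>
    rw [S.disp_succ_mul]; push_cast
    linarith [h (x + disp T (n * a) (n * b) x)]

lemma disp_le_mul (S : RotSystem T α V) {c : ℝ} (h : ∀ x, disp T a b x ≤ c) (n : ℕ) (x : ℝ) :
    disp T (n * a) (n * b) x ≤ n * c := by
  induction n with
  | zero => simp [S.disp_zero]
  | succ n ih =>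
    rw [S.disp_succ_mul]; push_cast
    linarith [h (x + disp T (n * a) (n * b) x)]

lemma exists_disp_eq (S : RotSystem T α V) (a b : ℤ) : ∃ x, disp T a b x = a * α - b := by
  have hc := (S.disp_smooth a b).continuous
  have arch : ∀ t : ℝ, (∀ n : ℕ, n * t ≤ 1) → t ≤ 0 := by
    intro t ht
    by_contra! hcon
    obtain ⟨n, hn⟩ := exists_nat_gt (1 / t)
    rw [div_lt_iff₀ hcon] at hn
    linarith [ht n]
  obtain ⟨y, hy⟩ := exists_isMin_of_periodic hc (S.disp_add_one a b)
  obtain ⟨z, hz⟩ := exists_isMax_of_periodic hc (S.disp_add_one a b)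
  have h1 : disp T a b y - (a * α - b) ≤ 0 := arch _ fun n => by
    have h2 := S.mul_le_disp hy n y
    have h3 := (abs_le.1 (S.abs_disp_sub_le (n * a) (n * b) y)).2
    push_cast at h3
    linarith
  have h2 : (a * α - b) - disp T a b z ≤ 0 := arch _ fun n => by
    have h2 := S.disp_le_mul hz n y
    have h3 := (abs_le.1 (S.abs_disp_sub_le (n * a) (n * b) y)).1
    push_cast at h3
    linarith
  exact mem_range_of_exists_le_of_exists_ge hc ⟨y, by linarith⟩ ⟨z, by linarith⟩

end RotSystem

namespace MainFrame

lemma disp_ge_of_mem (F : MainFrame α a b Q p) (S : RotSystem T α V) {M z y : ℝ}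
    (hz : M ≤ Real.exp (10 * V) * disp T a b z) (L : ℕ) (hy : y ∈ Set.Icc z (adv T a b L z)) :
    M ≤ Real.exp (10 * V) ^ (L + 1) * disp T a b y := by
  refine hz.trans ?_
  rw [pow_succ', mul_assoc]
  exact mul_le_mul_of_nonneg_left (F.disp_le_of_mem_mul S L hy).2 (Real.exp_pos _).le

/-- The orbit of a point where the return of time `Q` is small visits every place. -/
lemma exists_small_return (F : MainFrame α a b Q p) (S : RotSystem T α V) {M R : ℝ}
    (hM : ∀ x, disp T a b x ≤ M) (hM1 : M ≤ 1) (hR : ∀ x, 1 ≤ R * disp T a b x) (z : ℝ) :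
    ∃ y ∈ Set.Icc z (adv T a b 4 z),
      |disp T Q p y| ≤ Real.exp (2 * V) * (R * |(Q : ℝ) * α - p|) := by
  obtain ⟨y, hy⟩ := S.exists_disp_eq Q p
  obtain ⟨i, k, hi0, hiQ, hmem⟩ := F.exists_apply_mem S y z
  obtain ⟨n, rfl⟩ : ∃ n : ℕ, i = n := ⟨i.toNat, by omega⟩
  refine ⟨_, hmem, ?_⟩
  rw [S.disp_sub_int, ← S.apply_add_disp_sub]
  have hD : ∀ x, |deriv (T n) x| ≤ Real.exp (2 * V) * R := by
    intro x
    have h0 := S.disp_pos F.pos x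
    rw [abs_of_pos (S.deriv_pos n x)]
    refine (F.deriv_le_sqrt S hM hM1 (by omega) x).trans ?_
    gcongr
    rw [div_le_iff₀ h0]
    have := hR x
    have : √M ≤ 1 := Real.sqrt_le_one.2 hM1
    linarith
  have := Convex.norm_image_sub_le_of_norm_deriv_le (f := T n) (s := Set.univ) (x := y)
    (y := y + disp T Q p y) (fun z _ => S.differentiable n z)
    (fun z _ => hD z) convex_univ trivial trivial
  simp only [Real.norm_eq_abs, add_sub_cancel_left] at this
  rw [hy, mul_assoc] at this
  rw [hy]
  simpa using this

lemma exists_return_le (S : RotSystem T α V) (s : ℕ) : ∃ C, 1 ≤ C ∧ ∀ (a b p : ℤ) (Q : ℕ)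
    (M R z : ℝ), MainFrame α a b Q p → (∀ x, disp T a b x ≤ M) → M ≤ 1 →
      (∀ x, 1 ≤ R * disp T a b x) → M ≤ Real.exp (10 * V) * disp T a b z →
      ∀ x ∈ Set.Icc z (adv T a b 8 z),
        |disp T Q p x| ≤ C * (R * |(Q : ℝ) * α - p| + M ^ (s + 1)) := by
  set n := 2 * (s + 1) with hn
  set L := 5 * 2 ^ n with hL
  set E := Real.exp (10 * V) with hE
  have hE1 : 1 ≤ E := one_le_exp S
  have hV := S.one_le_V
  obtain ⟨C₁, hC₁, h₁⟩ := S.exists_iterate_bound n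
  obtain ⟨C₂, hC₂, h₂⟩ := exists_abs_iteratedDeriv_le_of_nodes n (L * E ^ (L + 1)) (by positivity)
  set e := Real.exp (2 * V) with he
  have he1 : 1 ≤ e := Real.one_le_exp (by linarith)
  refine ⟨C₂ * (e + 2 * C₁ ^ n), ?_, fun a b p Q M R z F hM hM1 hR hz x hx => ?_⟩
  · have : (1 : ℝ) ≤ e + 2 * C₁ ^ n := le_add_of_le_of_nonneg he1 (by positivity)
    exact one_le_mul_of_one_le_of_one_le hC₂ this
  have hz0 := S.disp_pos F.pos z
  have hM0 : 0 < M := hz0.trans_le (hM z)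
  have hR0 : 0 ≤ R := by
    by_contra! hcon
    nlinarith [hR z]
  set g := M / E ^ (L + 1) with hg
  have hg0 : 0 < g := by positivity
  have hmem : ∀ y ∈ Set.Icc z (adv T a b L z), g ≤ disp T a b y := by
    intro y hy
    rw [hg, div_le_iff₀ (by positivity), mul_comm]
    exact F.disp_ge_of_mem S hz L hy
  have hmono := S.adv_mono F.pos z
  choose nd hnd hndv using fun j : ℕ => F.exists_small_return S hM hM1 hR (adv T a b (5 * j) z)
  have hnd1 : ∀ j, adv T a b (5 * j) z ≤ nd j := fun j => (hnd j).1
  have hnd2 : ∀ j, nd j ≤ adv T a b (5 * j + 4) z := fun j => by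
    rw [add_comm, S.adv_add]; exact (hnd j).2
  have hB : ∀ y ∈ Set.Icc z (adv T a b L z),
      |iteratedDeriv n (disp T Q p) y| ≤ 2 * (C₁ * (√M / g)) ^ n := by
    intro y hy
    have hgy := hmem y hy
    have hgM : g ≤ M := hgy.trans (hM y)
    have h3 : disp T Q p = fun y => (T Q y - p) - y := rfl
    have hid : ContDiff ℝ ∞ (fun y : ℝ => y) := contDiff_id
    rw [h3, iteratedDeriv_fun_sub (((S.smooth Q).sub contDiff_const).infty_contDiffAt n y)
      (hid.infty_contDiffAt n y)]
    have h4 : iteratedDeriv n (fun y => T Q y - p) y = iteratedDeriv n (T Q) y := by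
      rw [iteratedDeriv_fun_sub ((S.smooth Q).infty_contDiffAt n y)
        (contDiff_const (𝕜 := ℝ) (n := ∞) |>.infty_contDiffAt n y), iteratedDeriv_const,
        if_neg (by omega), sub_zero]
    rw [h4]
    have h5 := h₁ a b p Q M F hM hM1 Q le_rfl y n (by omega) le_rfl
    have h6 : (C₁ * (√M / disp T a b y)) ^ n ≤ (C₁ * (√M / g)) ^ n := by
      have := S.disp_pos F.pos y
      gcongr
    have h7 : (1 : ℝ) ≤ (C₁ * (√M / g)) ^ n := by
      refine one_le_pow₀ (one_le_mul_of_one_le_of_one_le hC₁ ?_)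
      rw [le_div_iff₀ hg0, one_mul]
      refine hgM.trans (Real.le_sqrt_of_sq_le ?_)
      nlinarith
    have h8 := abs_iteratedDeriv_id_le (n := n) (by omega) y
    have h9 := abs_sub (iteratedDeriv n (T Q) y) (iteratedDeriv n (fun y => y) y)
    linarith
  have key := h₂ (disp T Q p) g z (adv T a b L z) (e * (R * |(Q : ℝ) * α - p|))
    (2 * (C₁ * (√M / g)) ^ n) nd (S.disp_smooth Q p) hg0 ?_ (by positivity) (by positivity)
    ?_ ?_ (fun j _ => hndv j) hB 0 (by omega) x ?_
  · rw [iteratedDeriv_zero, pow_zero, mul_one] at key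
    refine key.trans ?_
    have h3 : 2 * (C₁ * (√M / g)) ^ n * g ^ n = 2 * C₁ ^ n * M ^ (s + 1) := by
      rw [mul_assoc, ← mul_pow, show C₁ * (√M / g) * g = C₁ * √M by field_simp, mul_pow, hn,
        pow_mul (√M), Real.sq_sqrt hM0.le]
      ring
    rw [h3, mul_assoc C₂]
    refine mul_le_mul_of_nonneg_left ?_ (zero_le_one.trans hC₂)
    have h4 : 0 ≤ R * |(Q : ℝ) * α - p| := by positivity
    have h5 : 0 ≤ M ^ (s + 1) := by positivity
    have h6 : 0 ≤ 2 * C₁ ^ n := by positivity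
    nlinarith [mul_nonneg h6 h4]
  · have h3 := S.adv_le hM L z
    have h4 : (L : ℝ) * E ^ (L + 1) * g = L * M := by rw [hg]; field_simp
    linarith
  · intro j hj
    refine ⟨?_, (hnd2 j).trans (hmono.monotone (by omega))⟩
    have := hmono.monotone (Nat.zero_le (5 * j))
    simp only [S.adv_zero] at this
    exact this.trans (hnd1 j)
  · intro j hj
    have h3 := hnd1 (j + 1)
    rw [mul_add, S.adv_succ] at h3
    have h4 := hmem (adv T a b (5 * j + 4) z) ⟨by
      have := hmono.monotone (Nat.zero_le (5 * j + 4))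
      simpa only [S.adv_zero] using this, hmono.monotone (by omega)⟩
    linarith [hnd2 j]
  · refine ⟨hx.1, hx.2.trans (hmono.monotone ?_)⟩
    have : 2 ^ 2 ≤ 2 ^ n := Nat.pow_le_pow_right two_pos (by omega)
    omega

end MainFrame

end

lemma deriv_smoothTransition_nonneg (x : ℝ) : 0 ≤ deriv Real.smoothTransition x :=
  Real.smoothTransition.monotone.deriv_nonneg

lemma deriv_expNegInvGlue_pos {x : ℝ} (hx : 0 < x) : 0 < deriv expNegInvGlue x := by
  have h : expNegInvGlue =ᶠ[𝓝 x] fun y => Real.exp (-y⁻¹) := by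
    filter_upwards [lt_mem_nhds hx] with y hy
    simp [expNegInvGlue, not_le.2 hy]
  have h1 : HasDerivAt (fun y : ℝ => Real.exp (-y⁻¹)) _ x := (hasDerivAt_inv hx.ne').neg.exp
  rw [h.deriv_eq, h1.deriv]
  have := Real.exp_pos (-x⁻¹)
  simp only [neg_neg]
  positivity

lemma deriv_smoothTransition_pos {x : ℝ} (hx : x ∈ Set.Ioo (0 : ℝ) 1) :
    0 < deriv Real.smoothTransition x := by
  have hd : Differentiable ℝ expNegInvGlue :=
    (expNegInvGlue.contDiff (n := 1)).differentiable one_ne_zero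
  have h1 := (hd x).hasDerivAt
  have h2 := (hd (1 - x)).hasDerivAt.comp_const_sub 1 x
  have h3 := h1.div (h1.add h2) (Real.smoothTransition.pos_denom x).ne'
  have h4 : deriv Real.smoothTransition x = _ := h3.deriv
  rw [h4]
  have a1 := deriv_expNegInvGlue_pos hx.1
  have a2 : 0 ≤ deriv expNegInvGlue (1 - x) := expNegInvGlue.monotone.deriv_nonneg
  have a3 := expNegInvGlue.pos_of_pos (sub_pos.2 hx.2)
  have a4 := expNegInvGlue.nonneg x
  refine div_pos ?_ (pow_pos (Real.smoothTransition.pos_denom x) 2)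
  simp only [Pi.add_apply]
  nlinarith [mul_pos a1 a3, mul_nonneg a4 a2]

lemma iteratedDeriv_smoothTransition_eq_zero {i : ℕ} (hi : 1 ≤ i) {x : ℝ}
    (hx : x ∉ Set.Icc (0 : ℝ) 1) : iteratedDeriv i Real.smoothTransition x = 0 := by
  rw [Set.mem_Icc, not_and_or, not_le, not_le] at hx
  have : ∃ c : ℝ, Real.smoothTransition =ᶠ[𝓝 x] fun _ => c := by
    rcases hx with hx | hx
    · exact ⟨0, by filter_upwards [gt_mem_nhds hx] with y hy using
        Real.smoothTransition.zero_of_nonpos (le_of_lt hy)⟩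
    · exact ⟨1, by filter_upwards [lt_mem_nhds hx] with y hy using
        Real.smoothTransition.one_of_one_le (le_of_lt hy)⟩
  obtain ⟨c, hc⟩ := this
  rw [(hc.iteratedDeriv i).eq_of_nhds, iteratedDeriv_const, if_neg (by omega)]

lemma exists_bound_smoothTransition (n : ℕ) :
    ∃ C, 1 ≤ C ∧ ∀ i, 1 ≤ i → i ≤ n → ∀ x, |iteratedDeriv i Real.smoothTransition x| ≤ C := by
  have h1 : ∀ i, ∃ C, ∀ x ∈ Set.Icc (0 : ℝ) 1, ‖iteratedDeriv i Real.smoothTransition x‖ ≤ C :=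
    fun i => isCompact_Icc.exists_bound_of_continuousOn
      ((Real.smoothTransition.contDiff (n := ⊤)).continuous_iteratedDeriv i
        (by exact_mod_cast le_top)).continuousOn
  choose C hC using h1
  refine ⟨1 + ∑ i ∈ Finset.range (n + 1), |C i|, ?_, fun i hi hin x => ?_⟩
  · exact le_add_of_nonneg_right (Finset.sum_nonneg fun _ _ => abs_nonneg _)
  · by_cases hx : x ∈ Set.Icc (0 : ℝ) 1
    · have h2 := Finset.single_le_sum (f := fun i => |C i|) (fun _ _ => abs_nonneg _)
        (Finset.mem_range.2 (Nat.lt_succ_of_le hin))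
      have h3 := hC i x hx
      rw [Real.norm_eq_abs] at h3
      linarith [le_abs_self (C i)]
    · rw [iteratedDeriv_smoothTransition_eq_zero hi hx, abs_zero]
      exact add_nonneg zero_le_one (Finset.sum_nonneg fun _ _ => abs_nonneg _)

/-- A smooth staircase: it climbs by one over each interval `[x₀ + n, x₀ + n + ℓ]` and is constant
in between. -/
def staircase (x₀ l x : ℝ) : ℝ := ⌊x - x₀⌋ + Real.smoothTransition (Int.fract (x - x₀) / l)

namespace staircase

variable {x₀ l : ℝ}

lemma add_one (x : ℝ) : staircase x₀ l (x + 1) = staircase x₀ l x + 1 := by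
  have : x + 1 - x₀ = x - x₀ + 1 := by ring
  simp only [staircase]
  rw [this, Int.floor_add_one, Int.fract_add_one]
  push_cast
  ring

lemma eventuallyEq (hl : 0 < l) (hl1 : l < 1) (x : ℝ) : staircase x₀ l =ᶠ[𝓝 x]
    fun y => (⌊x - x₀⌋ : ℝ) + Real.smoothTransition ((y - (x₀ + ⌊x - x₀⌋)) / l) := by
  set n := ⌊x - x₀⌋ with hn
  have h1 := Int.floor_le (x - x₀)
  have h2 := Int.lt_floor_add_one (x - x₀)
  rw [← hn] at h1 h2
  filter_upwards [Ioo_mem_nhds (show x₀ + n - 1 + l < x by linarith)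
    (show x < x₀ + n + 1 by linarith)] with y hy
  rcases lt_or_ge y (x₀ + n) with h | h
  · have : ⌊y - x₀⌋ = n - 1 := by
      rw [Int.floor_eq_iff]; push_cast; constructor <;> linarith [hy.1]
    simp only [staircase, Int.fract, this]
    rw [Real.smoothTransition.one_of_one_le, Real.smoothTransition.zero_of_nonpos]
    · push_cast; ring
    · exact div_nonpos_of_nonpos_of_nonneg (by linarith) hl.le
    · rw [le_div_iff₀ hl]; push_cast; linarith [hy.1]
  · have : ⌊y - x₀⌋ = n := by
      rw [Int.floor_eq_iff]; constructor <;> linarith [hy.2]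
    simp only [staircase, Int.fract, this]
    rw [sub_sub]

lemma contDiff (hl : 0 < l) (hl1 : l < 1) : ContDiff ℝ ∞ (staircase x₀ l) := by
  rw [contDiff_iff_contDiffAt]
  intro x
  refine ContDiffAt.congr_of_eventuallyEq ?_ (eventuallyEq hl hl1 x)
  have := Real.smoothTransition.contDiff (n := ⊤)
  exact (contDiff_const.add (this.comp
    ((contDiff_id.sub contDiff_const).div_const l))).contDiffAt

lemma iteratedDeriv_eq (hl : 0 < l) (hl1 : l < 1) {i : ℕ} (hi : 1 ≤ i) (x : ℝ) :
    iteratedDeriv i (staircase x₀ l) x * l ^ i =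
      iteratedDeriv i Real.smoothTransition ((x - (x₀ + ⌊x - x₀⌋)) / l) := by
  rw [((eventuallyEq hl hl1 x).iteratedDeriv i).eq_of_nhds]
  set n := ⌊x - x₀⌋
  have hs : ContDiff ℝ ∞ Real.smoothTransition := Real.smoothTransition.contDiff (n := ⊤)
  have h0 : ContDiff ℝ ∞ (fun y : ℝ => Real.smoothTransition (l⁻¹ * y)) :=
    hs.comp (contDiff_const.mul contDiff_id)
  have h1 : (fun y : ℝ => (n : ℝ) + Real.smoothTransition ((y - (x₀ + n)) / l)) =
      fun y => (n : ℝ) + (fun t => Real.smoothTransition (l⁻¹ * t)) (y - (x₀ + n)) := by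
    funext y; simp only; rw [div_eq_inv_mul]
  have hc : ContDiff ℝ ∞ (fun _ : ℝ => (n : ℝ)) := contDiff_const
  have h2 : ContDiff ℝ ∞ (fun y => (fun t => Real.smoothTransition (l⁻¹ * t)) (y - (x₀ + n))) :=
    h0.comp (contDiff_id.sub contDiff_const)
  rw [h1, iteratedDeriv_fun_add (hc.infty_contDiffAt i x) (h2.infty_contDiffAt i x),
    iteratedDeriv_const, if_neg (by omega), zero_add,
    iteratedDeriv_comp_sub_const i (fun t => Real.smoothTransition (l⁻¹ * t)) (x₀ + n)]
  simp only
  rw [iteratedDeriv_comp_const_mul (hs.of_le (by exact_mod_cast le_top)), div_eq_inv_mul]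
  simp only
  rw [mul_right_comm, ← mul_pow, inv_mul_cancel₀ hl.ne', one_pow, one_mul]

lemma deriv_nonneg (hl : 0 < l) (hl1 : l < 1) (x : ℝ) : 0 ≤ deriv (staircase x₀ l) x := by
  have h := iteratedDeriv_eq (x₀ := x₀) hl hl1 le_rfl x
  rw [iteratedDeriv_one, iteratedDeriv_one, pow_one] at h
  have := deriv_smoothTransition_nonneg ((x - (x₀ + ⌊x - x₀⌋)) / l)
  rw [← h] at this
  exact nonneg_of_mul_nonneg_left this hl

lemma exists_mem_of_ne_zero (hl : 0 < l) (hl1 : l < 1) {i : ℕ} (hi : 1 ≤ i) {x : ℝ}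
    (h : iteratedDeriv i (staircase x₀ l) x ≠ 0) : ∃ k : ℤ, x - k ∈ Set.Icc x₀ (x₀ + l) := by
  refine ⟨⌊x - x₀⌋, ?_⟩
  by_contra hcon
  have h1 := iteratedDeriv_eq (x₀ := x₀) hl hl1 hi x
  rw [iteratedDeriv_smoothTransition_eq_zero hi] at h1
  · exact h ((mul_eq_zero.1 h1).resolve_right (pow_pos hl i).ne')
  · intro h2
    apply hcon
    rw [Set.mem_Icc, div_le_one hl, le_div_iff₀ hl] at h2
    constructor <;> linarith [h2.1, h2.2]

end staircase

lemma exists_staircase_deriv_ge {τ : ℝ} (hτ : 0 < τ) : ∃ c > 0, ∀ (x₀ l x : ℝ) (k : ℤ), 0 < l →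
    l < 1 → x - k ∈ Set.Icc (x₀ + τ * l) (x₀ + l - τ * l) → c ≤ deriv (staircase x₀ l) x * l := by
  have hc : ContinuousOn (deriv Real.smoothTransition) (Set.Icc τ (1 - τ)) :=
    ((Real.smoothTransition.contDiff (n := 1)).continuous_deriv le_rfl).continuousOn
  obtain ⟨c, hc0, hcl⟩ : ∃ c > 0, ∀ t ∈ Set.Icc τ (1 - τ), c ≤ deriv Real.smoothTransition t := by
    rcases (Set.Icc τ (1 - τ)).eq_empty_or_nonempty with h | h
    · exact ⟨1, one_pos, by simp [h]⟩
    · obtain ⟨t, ht, hmin⟩ := isCompact_Icc.exists_isMinOn h hc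
      exact ⟨_, deriv_smoothTransition_pos ⟨hτ.trans_le ht.1, by linarith [ht.2]⟩,
        fun s hs => hmin hs⟩
  refine ⟨c, hc0, fun x₀ l x k hl hl1 hx => ?_⟩
  have hτl : 0 < τ * l := by positivity
  have hk : ⌊x - x₀⌋ = k := by
    rw [Int.floor_eq_iff]; constructor <;> linarith [hx.1, hx.2]
  have h := staircase.iteratedDeriv_eq (x₀ := x₀) hl hl1 le_rfl x
  rw [iteratedDeriv_one, iteratedDeriv_one, pow_one, hk] at h
  rw [h]
  apply hcl
  rw [Set.mem_Icc, le_div_iff₀ hl, div_le_iff₀ hl]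
  constructor <;> linarith [hx.1, hx.2]

/-- The displacement of the frame has maximal value `M`, attained at `z`. -/
structure Peak (T : ℤ → ℝ → ℝ) (α V : ℝ) (a b p : ℤ) (Q : ℕ) (M z : ℝ) : Prop where
  sys : RotSystem T α V
  frame : MainFrame α a b Q p
  le : ∀ x, disp T a b x ≤ M
  peak : M ≤ disp T a b z
  small : 6 * M < 1

/-- The length of six fundamental intervals near `z`. -/
def peakLength (T : ℤ → ℝ → ℝ) (a b : ℤ) (z : ℝ) : ℝ := adv T a b 7 z - adv T a b 1 z

/-- The staircase climbing over six fundamental intervals near `z`. -/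
def peakStair (T : ℤ → ℝ → ℝ) (a b : ℤ) (z : ℝ) : ℝ → ℝ :=
  staircase (adv T a b 1 z) (peakLength T a b z)

lemma RotSystem.adv_sub_int {T : ℤ → ℝ → ℝ} {α V : ℝ} {a b : ℤ} (S : RotSystem T α V) (L : ℕ)
    (x : ℝ) (k : ℤ) : adv T a b L (x - k) = adv T a b L x - k := by
  rw [adv_eq, adv_eq, S.sub_int]; ring

lemma adv_one {T : ℤ → ℝ → ℝ} {a b : ℤ} (x : ℝ) : adv T a b 1 x = T a x - b := by
  rw [adv_eq]; simp

namespace Peak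

variable {T : ℤ → ℝ → ℝ} {α V : ℝ} {a b p : ℤ} {Q : ℕ} {M z : ℝ}

lemma pos (h : Peak T α V a b p Q M z) : 0 < M :=
  (h.sys.disp_pos h.frame.pos z).trans_le (h.le z)

lemma adv_mono (h : Peak T α V a b p Q M z) : StrictMono fun L => adv T a b L z :=
  h.sys.adv_mono h.frame.pos z

lemma le_disp (h : Peak T α V a b p Q M z) {y : ℝ} {k : ℤ}
    (hy : y - k ∈ Set.Icc z (adv T a b 8 z)) : M ≤ Real.exp (10 * V) ^ 8 * disp T a b y := by
  rw [← h.sys.disp_sub_int a b y k]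
  exact h.peak.trans (h.frame.disp_le_of_mem_mul h.sys 8 hy).2

lemma le_adv (h : Peak T α V a b p Q M z) (L : ℕ) : z ≤ adv T a b L z := by
  have := h.adv_mono.monotone (Nat.zero_le L)
  simpa only [h.sys.adv_zero] using this

lemma le_adv_sub (h : Peak T α V a b p Q M z) {L : ℕ} (hL : L ≤ 8) :
    M ≤ Real.exp (10 * V) ^ 8 * (adv T a b (L + 1) z - adv T a b L z) := by
  rw [h.sys.adv_succ, add_sub_cancel_left]
  exact h.le_disp (k := 0) (by
    simpa using ⟨h.le_adv L, h.adv_mono.monotone hL⟩)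

lemma le_length (h : Peak T α V a b p Q M z) :
    M ≤ Real.exp (10 * V) ^ 8 * peakLength T a b z := by
  refine (h.le_adv_sub (L := 1) (by norm_num)).trans ?_
  have := h.adv_mono.monotone (show 1 + 1 ≤ 7 by norm_num)
  exact mul_le_mul_of_nonneg_left (sub_le_sub_right this _) (by positivity)

lemma length_pos (h : Peak T α V a b p Q M z) : 0 < peakLength T a b z :=
  sub_pos.2 (h.adv_mono (by norm_num))

lemma length_le (h : Peak T α V a b p Q M z) : peakLength T a b z ≤ 6 * M := by
  have h1 := h.sys.adv_le h.le 6 (adv T a b 1 z)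
  rw [← h.sys.adv_add] at h1
  simp only [peakLength]
  push_cast at h1
  linarith

lemma length_lt_one (h : Peak T α V a b p Q M z) : peakLength T a b z < 1 :=
  h.length_le.trans_lt h.small

lemma stair_smooth (h : Peak T α V a b p Q M z) : ContDiff ℝ ∞ (peakStair T a b z) :=
  staircase.contDiff h.length_pos h.length_lt_one

lemma stair_differentiable (h : Peak T α V a b p Q M z) :
    Differentiable ℝ (peakStair T a b z) := h.stair_smooth.infty_differentiable

lemma stair_deriv_nonneg (h : Peak T α V a b p Q M z) (x : ℝ) :
    0 ≤ deriv (peakStair T a b z) x :=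
  staircase.deriv_nonneg h.length_pos h.length_lt_one x

lemma exists_le_deriv_stair (V : ℝ) : ∃ c > 0, ∀ (T : ℤ → ℝ → ℝ) (α : ℝ) (a b p : ℤ) (Q : ℕ)
    (M z x : ℝ) (k : ℤ), Peak T α V a b p Q M z →
    x - k ∈ Set.Icc (adv T a b 2 z) (adv T a b 6 z) → c ≤ deriv (peakStair T a b z) x * M := by
  set E := Real.exp (10 * V) with hE
  obtain ⟨c, hc, H⟩ := exists_staircase_deriv_ge (τ := 1 / (6 * E ^ 8)) (by positivity)
  refine ⟨c / 6, by positivity, fun T α a b p Q M z x k h hx => ?_⟩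
  have hl := h.length_le
  have hτ : 1 / (6 * E ^ 8) * peakLength T a b z ≤ M / E ^ 8 := by
    rw [div_mul_eq_mul_div, one_mul, div_le_div_iff₀ (by positivity) (by positivity)]
    nlinarith [pow_pos (Real.exp_pos (10 * V)) 8]
  have h1 := h.le_adv_sub (L := 1) (by norm_num)
  have h2 := h.le_adv_sub (L := 6) (by norm_num)
  rw [← div_le_iff₀' (by positivity)] at h1 h2
  have h3 := H (adv T a b 1 z) (peakLength T a b z) x k h.length_pos h.length_lt_one (by
    norm_num at h1 h2
    refine ⟨?_, ?_⟩
    · linarith [hx.1]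
    · have : adv T a b 1 z + peakLength T a b z = adv T a b 7 z := by simp [peakLength]
      rw [this]
      linarith [hx.2])
  have h4 := h.stair_deriv_nonneg x
  have h5 : deriv (peakStair T a b z) x * peakLength T a b z ≤
    deriv (peakStair T a b z) x * (6 * M) := mul_le_mul_of_nonneg_left hl h4
  have h6 : c ≤ deriv (peakStair T a b z) x * peakLength T a b z := h3
  linarith

lemma exists_mem_of_stair_ne_zero (h : Peak T α V a b p Q M z) {i : ℕ} (hi : 1 ≤ i) {x : ℝ}
    (hx : iteratedDeriv i (peakStair T a b z) x ≠ 0) :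
    ∃ k : ℤ, x - k ∈ Set.Icc (adv T a b 1 z) (adv T a b 7 z) := by
  have := staircase.exists_mem_of_ne_zero h.length_pos h.length_lt_one hi hx
  simpa only [peakLength, add_sub_cancel] using this

lemma exists_stair_bound (V : ℝ) (n : ℕ) : ∃ C, 1 ≤ C ∧ ∀ (T : ℤ → ℝ → ℝ) (α : ℝ) (a b p : ℤ)
    (Q : ℕ) (M z : ℝ), Peak T α V a b p Q M z → ∀ i, 1 ≤ i → i ≤ n → ∀ x,
    |iteratedDeriv i (peakStair T a b z) x| * M ^ i ≤ C := by
  obtain ⟨C, hC, H⟩ := exists_bound_smoothTransition n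
  refine ⟨C * max 1 (Real.exp (10 * V) ^ 8) ^ n, ?_, fun T α a b p Q M z h i hi hin x => ?_⟩
  · exact one_le_mul_of_one_le_of_one_le hC (one_le_pow₀ (le_max_left _ _))
  · set l := peakLength T a b z
    have hl := h.length_pos
    have h1 := staircase.iteratedDeriv_eq (x₀ := adv T a b 1 z) hl h.length_lt_one hi x
    have h2 := H i hi hin ((x - (adv T a b 1 z + ⌊x - adv T a b 1 z⌋)) / l)
    rw [← h1, abs_mul, abs_of_pos (pow_pos hl i)] at h2
    change |iteratedDeriv i (peakStair T a b z) x| * l ^ i ≤ C at h2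
    set E := max 1 (Real.exp (10 * V) ^ 8)
    have hE : 1 ≤ E := le_max_left _ _
    have h3 : M ≤ E * l := h.le_length.trans
      (mul_le_mul_of_nonneg_right (le_max_right _ _) hl.le)
    have hM := h.pos
    calc |iteratedDeriv i (peakStair T a b z) x| * M ^ i
        ≤ |iteratedDeriv i (peakStair T a b z) x| * (E * l) ^ i := by gcongr
      _ = |iteratedDeriv i (peakStair T a b z) x| * l ^ i * E ^ i := by rw [mul_pow]; ring
      _ ≤ C * E ^ n := by gcongr

lemma exists_stair_bound_disp (V : ℝ) (n : ℕ) : ∃ C, 1 ≤ C ∧ ∀ (T : ℤ → ℝ → ℝ) (α : ℝ)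
    (a b p : ℤ) (Q : ℕ) (M z : ℝ), Peak T α V a b p Q M z → ∀ i, 1 ≤ i → i ≤ n → ∀ x,
    |iteratedDeriv i (peakStair T a b z) x| * M ^ (n + 1) ≤ C * disp T a b x := by
  obtain ⟨C, hC, H⟩ := exists_stair_bound V n
  refine ⟨C * max 1 (Real.exp (10 * V) ^ 8), ?_, fun T α a b p Q M z h i hi hin x => ?_⟩
  · exact one_le_mul_of_one_le_of_one_le hC (le_max_left _ _)
  have hd := h.sys.disp_pos h.frame.pos x
  have hM := h.pos
  have hM1 : M ≤ 1 := by linarith [h.small]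
  by_cases h0 : iteratedDeriv i (peakStair T a b z) x = 0
  · rw [h0, abs_zero, zero_mul]; positivity
  · obtain ⟨k, hk⟩ := h.exists_mem_of_stair_ne_zero hi h0
    have h1 := h.le_disp (k := k) ⟨(h.le_adv 1).trans hk.1,
      hk.2.trans (h.adv_mono.monotone (by norm_num))⟩
    have h2 : |iteratedDeriv i (peakStair T a b z) x| * M ^ n ≤ C :=
      (mul_le_mul_of_nonneg_left (pow_le_pow_of_le_one hM.le hM1 hin) (abs_nonneg _)).trans
        (H T α a b p Q M z h i hi hin x)
    rw [pow_succ, ← mul_assoc, mul_assoc C]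
    refine mul_le_mul h2 (h1.trans ?_) hM.le (by linarith)
    exact mul_le_mul_of_nonneg_right (le_max_right _ _) hd.le

end Peak

/-- The Birkhoff sum of the staircase over `Q` consecutive iterates, the first of which is `s`. -/
def stairSum (T : ℤ → ℝ → ℝ) (a b : ℤ) (Q : ℕ) (z : ℝ) (s : ℕ) (x : ℝ) : ℝ :=
  ∑ i ∈ Finset.range Q, peakStair T a b z (T ((s + i : ℕ) : ℤ) x)

/-- The defect of `peakStair` under the return of time `Q`. -/
def stairDefect (T : ℤ → ℝ → ℝ) (a b p : ℤ) (Q : ℕ) (z x : ℝ) : ℝ :=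
  peakStair T a b z (x + disp T Q p x) - peakStair T a b z x

lemma peakStair_add_one {T : ℤ → ℝ → ℝ} {a b : ℤ} {z : ℝ} (x : ℝ) :
    peakStair T a b z (x + 1) = peakStair T a b z x + 1 := staircase.add_one x

lemma RotSystem.stairSum_add_one {T : ℤ → ℝ → ℝ} {α V : ℝ} (S : RotSystem T α V) (a b : ℤ)
    (Q : ℕ) (z : ℝ) (s : ℕ) (x : ℝ) :
    stairSum T a b Q z s (x + 1) = stairSum T a b Q z s x + Q := by
  simp only [stairSum, S.add_one, peakStair_add_one, Finset.sum_add_distrib]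
  simp

lemma RotSystem.stairSum_one {T : ℤ → ℝ → ℝ} {α V : ℝ} (S : RotSystem T α V) (a b : ℤ)
    (Q : ℕ) (z : ℝ) (x : ℝ) :
    stairSum T a b Q z 1 x = stairSum T a b Q z 0 (T 1 x) := by
  simp only [stairSum, ← S.add]
  refine Finset.sum_congr rfl fun i _ => ?_
  push_cast
  rw [zero_add, add_comm]

lemma RotSystem.stairSum_one_eq {T : ℤ → ℝ → ℝ} {α V : ℝ} (S : RotSystem T α V) (a b p : ℤ)
    (Q : ℕ) (z : ℝ) (x : ℝ) :
    stairSum T a b Q z 1 x = stairSum T a b Q z 0 x + p + stairDefect T a b p Q z x := by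
  have h1 : x + disp T Q p x + p = T Q x := by simp only [disp]; ring
  have h2 := add_int_of_add_one (peakStair_add_one (T := T) (a := a) (b := b) (z := z))
    (x + disp T Q p x) p
  rw [h1] at h2
  have h3 := Finset.sum_range_succ (fun i : ℕ => peakStair T a b z (T (i : ℤ) x)) Q
  have h4 := Finset.sum_range_succ' (fun i : ℕ => peakStair T a b z (T (i : ℤ) x)) Q
  simp only [Nat.cast_zero, S.zero] at h4
  simp only [stairSum, stairDefect, zero_add, add_comm 1]
  linarith

namespace Peak

variable {T : ℤ → ℝ → ℝ} {α V : ℝ} {a b p : ℤ} {Q : ℕ} {M z : ℝ}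

lemma stair_comp_smooth (h : Peak T α V a b p Q M z) (n : ℤ) :
    ContDiff ℝ ∞ fun x => peakStair T a b z (T n x) := h.stair_smooth.comp (h.sys.smooth n)

lemma stairSum_smooth (h : Peak T α V a b p Q M z) (s : ℕ) :
    ContDiff ℝ ∞ (stairSum T a b Q z s) :=
  ContDiff.sum fun _ _ => h.stair_comp_smooth _

lemma exists_stairSum_bound (S : RotSystem T α V) (n : ℕ) {K : ℝ} (hK : 1 ≤ K) : ∃ C, 2 ≤ C ∧
    ∀ (a b p : ℤ) (Q : ℕ) (M z X : ℝ) (s : ℕ), Peak T α V a b p Q M z → s ≤ 1 → 0 < X → X ≤ M →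
      ∀ x, X ≤ K * disp T a b x → ∀ i, 1 ≤ i → i ≤ n →
      |iteratedDeriv i (stairSum T a b Q z s) x| * X ^ (2 * n + 1) ≤ C := by
  obtain ⟨C₁, hC₁, H₁⟩ := exists_stair_bound_disp V n
  obtain ⟨C₂, hC₂, H₂⟩ := S.exists_iterate_bound n
  refine ⟨2 * (n.factorial * C₁ * (C₂ * K) ^ n), ?_,
    fun a b p Q M z X s h hs hX hXM x hx i hi hin => ?_⟩
  · have h1 : (1 : ℝ) ≤ n.factorial := by exact_mod_cast Nat.factorial_pos n
    have h2 : 1 ≤ (C₂ * K) ^ n := one_le_pow₀ (one_le_mul_of_one_le_of_one_le hC₂ hK)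
    have h3 := one_le_mul_of_one_le_of_one_le (one_le_mul_of_one_le_of_one_le h1 hC₁) h2
    linarith
  have hM := h.pos
  have hM1 : M ≤ 1 := by linarith [h.small]
  have hd := h.sys.disp_pos h.frame.pos
  set D := C₂ * K / X with hD
  have hD1 : 1 ≤ D := by
    rw [hD, le_div_iff₀ hX]
    linarith [one_le_mul_of_one_le_of_one_le hC₂ hK]
  have hterm : ∀ j ∈ Finset.range Q,
      |iteratedDeriv i (fun x => peakStair T a b z (T ((s + j : ℕ) : ℤ) x)) x| ≤
        n.factorial * (C₁ / M ^ (n + 1)) * D ^ n * disp T a b (T (s + j) x) := by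
    intro j hj
    have hsj : s + j ≤ Q := by have := Finset.mem_range.1 hj; omega
    set m : ℤ := ((s + j : ℕ) : ℤ) with hm
    set w := T m x with hw
    set P := peakStair T a b z with hP
    have hc : ContDiff ℝ ∞ (fun _ : ℝ => P w) := contDiff_const
    have h1 : ContDiff ℝ ∞ (fun y => P y - P w) := h.stair_smooth.sub hc
    have h2 : iteratedDeriv i (fun x => P (T m x)) x =
        iteratedDeriv i ((fun y => P y - P w) ∘ T m) x := by
      have : ((fun y => P y - P w) ∘ T m) = fun x => P (T m x) - P w := rfl
      rw [this, iteratedDeriv_fun_sub ((h.stair_comp_smooth m).infty_contDiffAt i x)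
        (hc.infty_contDiffAt i x), iteratedDeriv_const, if_neg (by omega), sub_zero]
    have h3 := abs_iteratedDeriv_comp_le (n := i) (x := x) (D := D)
      (C := C₁ / M ^ (n + 1) * disp T a b w) h1 (h.sys.smooth m) (fun l hl => by
        rcases Nat.eq_zero_or_pos l with rfl | hl0
        · have := hd w
          simp only [iteratedDeriv_zero]
          rw [← hw, sub_self, abs_zero]
          positivity
        · have h4 : iteratedDeriv l (fun y => P y - P w) w = iteratedDeriv l P w := by
            rw [iteratedDeriv_fun_sub (h.stair_smooth.infty_contDiffAt l w)
              (hc.infty_contDiffAt l w), iteratedDeriv_const, if_neg (by omega), sub_zero]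
          rw [← hw, h4, div_mul_eq_mul_div, le_div_iff₀ (by positivity)]
          exact H₁ T α a b p Q M z h l hl0 (hl.trans hin) w)
      (fun l hl hli => by
        refine (H₂ a b p Q M h.frame h.le hM1 (s + j) hsj x l hl (hli.trans hin)).trans ?_
        have h5 : C₂ * (√M / disp T a b x) ≤ D := by
          rw [hD, mul_div_assoc]
          refine mul_le_mul_of_nonneg_left ?_ (by linarith)
          rw [div_le_div_iff₀ (hd x) hX]
          have : √M ≤ 1 := Real.sqrt_le_one.2 hM1
          nlinarith [Real.sqrt_nonneg M]
        have := hd x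
        exact pow_le_pow_left₀ (by positivity) h5 l)
    rw [h2]
    refine h3.trans ?_
    have h6 : (i.factorial : ℝ) ≤ n.factorial := by exact_mod_cast Nat.factorial_le hin
    have h7 : D ^ i ≤ D ^ n := pow_le_pow_right₀ hD1 hin
    have h8 := hd w
    have h9 : T ((s : ℤ) + (j : ℤ)) x = w := by rw [hw, hm]; push_cast; rfl
    rw [h9]
    calc (i.factorial : ℝ) * (C₁ / M ^ (n + 1) * disp T a b w) * D ^ i
        ≤ n.factorial * (C₁ / M ^ (n + 1) * disp T a b w) * D ^ n := by gcongr
      _ = _ := by ring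
  have hsum : |iteratedDeriv i (stairSum T a b Q z s) x| ≤
      n.factorial * (C₁ / M ^ (n + 1)) * D ^ n := by
    have h1 : stairSum T a b Q z s = fun x => ∑ j ∈ Finset.range Q,
      peakStair T a b z (T ((s + j : ℕ) : ℤ) x) := rfl
    rw [h1, iteratedDeriv_fun_sum (fun j _ => (h.stair_comp_smooth _).infty_contDiffAt i x)]
    refine (Finset.abs_sum_le_sum_abs _ _).trans ((Finset.sum_le_sum hterm).trans ?_)
    rw [← Finset.mul_sum]
    exact mul_le_of_le_one_right (by positivity) (h.frame.sum_disp_le_one h.sys s x)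
  calc |iteratedDeriv i (stairSum T a b Q z s) x| * X ^ (2 * n + 1)
      ≤ n.factorial * (C₁ / X ^ (n + 1)) * D ^ n * X ^ (2 * n + 1) := by
        refine mul_le_mul_of_nonneg_right (hsum.trans ?_) (by positivity)
        gcongr
    _ = n.factorial * C₁ * (C₂ * K) ^ n := by
        rw [hD, div_pow]
        field_simp
        ring
    _ ≤ _ := by
        have : 0 ≤ n.factorial * C₁ * (C₂ * K) ^ n := by positivity
        linarith

lemma hasDerivAt_stairSum (h : Peak T α V a b p Q M z) (s : ℕ) (x : ℝ) :
    HasDerivAt (stairSum T a b Q z s) (∑ i ∈ Finset.range Q,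
      deriv (peakStair T a b z) (T ((s + i : ℕ) : ℤ) x) * deriv (T ((s + i : ℕ) : ℤ)) x) x := by
  have := HasDerivAt.fun_sum (u := Finset.range Q)
    (A := fun (i : ℕ) x => peakStair T a b z (T ((s + i : ℕ) : ℤ) x)) (x := x)
    fun i _ => (h.stair_differentiable (T ((s + i : ℕ) : ℤ) x)).hasDerivAt.comp x
      (h.sys.hasDerivAt ((s + i : ℕ) : ℤ) x)
  exact this

lemma exists_le_deriv_stairSum (V : ℝ) : ∃ c > 0, ∀ (T : ℤ → ℝ → ℝ) (α : ℝ) (a b p : ℤ) (Q : ℕ)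
    (M z x : ℝ) (s : ℕ), Peak T α V a b p Q M z → s ≤ 1 → c ≤ deriv (stairSum T a b Q z s) x := by
  obtain ⟨c, hc, H⟩ := exists_le_deriv_stair V
  refine ⟨c / (Real.exp (2 * V) * Real.exp (10 * V) ^ 8), by positivity,
    fun T α a b p Q M z x s h hs => ?_⟩
  have hM := h.pos
  have hM1 : M ≤ 1 := by linarith [h.small]
  obtain ⟨i, k, hi0, hiQ, hmem⟩ := h.frame.exists_apply_mem h.sys (T s x) (adv T a b 2 z)
  obtain ⟨j, rfl⟩ : ∃ j : ℕ, i = j := ⟨i.toNat, by omega⟩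
  have hj : j < Q := by exact_mod_cast hiQ
  set n : ℤ := ((s + j : ℕ) : ℤ) with hn
  have h0 : T j (T s x) = T n x := by
    rw [← h.sys.add, hn]; push_cast; rw [add_comm]
  rw [h0] at hmem
  have hmem' : T n x - k ∈ Set.Icc (adv T a b 2 z) (adv T a b 6 z) := by
    have h1 : adv T a b 6 z = adv T a b 4 (adv T a b 2 z) := h.sys.adv_add 4 2 z
    rw [h1]; exact hmem
  have h1 := H T α a b p Q M z (T n x) k h hmem'
  have h2 := h.le_disp (k := k) ⟨(h.le_adv 2).trans hmem'.1,
    hmem'.2.trans (h.adv_mono.monotone (by norm_num))⟩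
  have h3 := h.frame.disp_le_deriv_mul h.sys (n := n) (by omega)
    (h.frame.toFrame.left_mem h.sys x)
  rw [(h.hasDerivAt_stairSum s x).deriv]
  have h4 : deriv (peakStair T a b z) (T n x) * deriv (T n) x ≤ ∑ i ∈ Finset.range Q,
      deriv (peakStair T a b z) (T ((s + i : ℕ) : ℤ) x) * deriv (T ((s + i : ℕ) : ℤ)) x :=
    Finset.single_le_sum (f := fun i : ℕ => deriv (peakStair T a b z) (T ((s + i : ℕ) : ℤ) x) *
      deriv (T ((s + i : ℕ) : ℤ)) x)
      (fun i _ => mul_nonneg (h.stair_deriv_nonneg _) (h.sys.deriv_pos _ _).le)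
      (Finset.mem_range.2 hj)
  refine le_trans ?_ h4
  rw [div_le_iff₀ (by positivity)]
  set P' := deriv (peakStair T a b z) (T n x)
  set D := deriv (T n) x
  have hP : 0 ≤ P' := h.stair_deriv_nonneg _
  have hD : 0 < D := h.sys.deriv_pos _ _
  have h5 : M ≤ Real.exp (10 * V) ^ 8 * (Real.exp (2 * V) * D) := by
    refine h2.trans (mul_le_mul_of_nonneg_left (h3.trans ?_) (by positivity))
    refine mul_le_mul_of_nonneg_left ?_ (by positivity)
    exact mul_le_of_le_one_right hD.le ((h.le x).trans hM1)
  calc c ≤ P' * M := h1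
    _ ≤ P' * (Real.exp (10 * V) ^ 8 * (Real.exp (2 * V) * D)) := by gcongr
    _ = _ := by ring

lemma abs_return_le (h : Peak T α V a b p Q M z) (x : ℝ) :
    x + disp T Q p x ≤ adv T a b 1 x ∧ x ≤ adv T a b 1 (x + disp T Q p x) := by
  have h1 := h.frame.theta_lt
  rw [abs_lt] at h1
  constructor
  · have h2 := h.sys.le (i := Q) (k := -p) (j := a) (l := -b) (by push_cast; linarith) x
    rw [adv_one]
    simp only [disp]
    push_cast at h2
    linarith
  · have h2 := h.sys.le (i := 0) (k := 0) (j := a + Q) (l := -p - b) (by push_cast; linarith) x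
    have h3 : x + disp T Q p x = T Q x - p := by simp only [disp]; ring
    rw [adv_one, h3, h.sys.sub_int, ← h.sys.add]
    rw [h.sys.zero] at h2
    push_cast at h2
    linarith

lemma exists_stairDefect_bound (V : ℝ) : ∃ C, 1 ≤ C ∧ ∀ (T : ℤ → ℝ → ℝ) (α : ℝ) (a b p : ℤ)
    (Q : ℕ) (M z x : ℝ), Peak T α V a b p Q M z → stairDefect T a b p Q z x ≠ 0 →
    |stairDefect T a b p Q z x| * M ≤ C * |disp T Q p x| ∧
      ∃ k : ℤ, x - k ∈ Set.Icc z (adv T a b 8 z) := by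
  obtain ⟨C, hC, H⟩ := exists_stair_bound V 1
  refine ⟨C, hC, fun T α a b p Q M z x h hx => ?_⟩
  set d := disp T Q p x with hd
  obtain ⟨ξ, hξ, heq⟩ : ∃ ξ, (ξ ∈ Set.Icc x (x + d) ∨ ξ ∈ Set.Icc (x + d) x) ∧
      stairDefect T a b p Q z x = deriv (peakStair T a b z) ξ * d := by
    rcases le_total 0 d with hd0 | hd0
    · obtain ⟨ξ, hξ, he⟩ := exists_deriv_eq_slope_of_le h.stair_differentiable
        (show x ≤ x + d by linarith)
      exact ⟨ξ, Or.inl hξ, by rw [stairDefect, he]; ring⟩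
    · obtain ⟨ξ, hξ, he⟩ := exists_deriv_eq_slope_of_le h.stair_differentiable
        (show x + d ≤ x by linarith)
      refine ⟨ξ, Or.inr hξ, ?_⟩
      rw [stairDefect, ← hd]
      linarith
  have hne : deriv (peakStair T a b z) ξ ≠ 0 := by
    intro h0
    rw [heq, h0, zero_mul] at hx
    exact hx rfl
  constructor
  · have h1 := H T α a b p Q M z h 1 le_rfl le_rfl ξ
    rw [iteratedDeriv_one, pow_one] at h1
    rw [heq, abs_mul, mul_right_comm]
    exact mul_le_mul_of_nonneg_right h1 (abs_nonneg _)
  · rw [← iteratedDeriv_one] at hne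
    obtain ⟨k, hk⟩ := h.exists_mem_of_stair_ne_zero le_rfl hne
    refine ⟨k, ?_⟩
    have hr := h.abs_return_le x
    rw [← hd] at hr
    have h7 := h.adv_mono.monotone (show 7 ≤ 8 by norm_num)
    have h1 := h.le_adv 1
    rcases hξ with hξ | hξ
    · refine ⟨?_, by linarith [hξ.1, hk.2]⟩
      have h2 : adv T a b 1 z ≤ adv T a b 1 (x - k) := by
        rw [h.sys.adv_sub_int]; linarith [hξ.2, hk.1, hr.1]
      exact (h.sys.adv_strictMono 1).le_iff_le.1 h2
    · refine ⟨by linarith [hξ.2, hk.1], ?_⟩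
      have h2 : adv T a b 1 (ξ - k) ≤ adv T a b 8 z := by
        rw [show (8 : ℕ) = 1 + 7 from rfl, h.sys.adv_add]
        exact (h.sys.adv_strictMono 1).monotone hk.2
      have h3 : adv T a b 1 (x + d - k) ≤ adv T a b 1 (ξ - k) :=
        (h.sys.adv_strictMono 1).monotone (by linarith [hξ.1])
      rw [h.sys.adv_sub_int] at h3
      linarith [hr.2]

end Peak

lemma exists_smooth_inverse {u : ℝ → ℝ} (hu : ContDiff ℝ ∞ u) (hd : ∀ x, 0 < deriv u x) {q : ℝ}
    (hq : 0 < q) (hp : ∀ x, u (x + 1) = u x + q) :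
    ∃ w : ℝ → ℝ, ContDiff ℝ ∞ w ∧ (∀ y, u (w y) = y) ∧ ∀ x, w (u x) = x := by
  have hmono := strictMono_of_deriv_pos hd
  have hint : ∀ n : ℕ, u n = u 0 + n * q ∧ u (-n) = u 0 - n * q := by
    intro n
    induction n with
    | zero => simp
    | succ n ih =>
      have h1 := hp (-(n + 1 : ℕ))
      rw [show (-((n + 1 : ℕ) : ℝ) + 1) = -n by push_cast; ring] at h1
      push_cast at h1 ⊢
      rw [hp]
      constructor <;> linarith [ih.1, ih.2]
  have hsurj : Function.Surjective u := by
    intro y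
    obtain ⟨n, hn⟩ := exists_nat_ge (|y - u 0| / q)
    rw [div_le_iff₀ hq, abs_le] at hn
    exact mem_range_of_exists_le_of_exists_ge hu.continuous
      ⟨-n, by rw [(hint n).2]; linarith⟩ ⟨n, by rw [(hint n).1]; linarith⟩
  let e := (hmono.orderIsoOfSurjective u hsurj).toHomeomorph
  refine ⟨e.symm, ?_, fun y => e.apply_symm_apply y, fun x => e.symm_apply_apply x⟩
  exact e.contDiff_symm_deriv (f' := deriv u) (fun x => (hd x).ne')
    (fun x => (hu.infty_differentiable x).hasDerivAt) hu

lemma le_abs_sub_of_deriv_ge {u : ℝ → ℝ} (hu : ContDiff ℝ ∞ u) {c : ℝ} (hd : ∀ x, c ≤ deriv u x)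
    (x y : ℝ) : c * |y - x| ≤ |u y - u x| := by
  wlog hxy : x ≤ y generalizing x y
  · rw [abs_sub_comm y, abs_sub_comm (u y)]
    exact this y x (by linarith)
  obtain ⟨z, -, hz⟩ := exists_deriv_eq_slope_of_le hu.infty_differentiable hxy
  rw [abs_of_nonneg (sub_nonneg.2 hxy)]
  refine le_trans ?_ (le_abs_self _)
  rw [hz]
  exact mul_le_mul_of_nonneg_right (hd z) (by linarith)

lemma iteratedDeriv_add_const {u : ℝ → ℝ} {i : ℕ} (hi : 1 ≤ i) (t x : ℝ) :
    iteratedDeriv i (fun y => u y + t) x = iteratedDeriv i u x := by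
  obtain ⟨j, rfl⟩ : ∃ j, i = j + 1 := ⟨i - 1, by omega⟩
  rw [iteratedDeriv_succ', iteratedDeriv_succ']
  congr 1
  funext y
  exact deriv_add_const t

lemma Peak.exists_transition_bound {T : ℤ → ℝ → ℝ} {α V : ℝ} (S : RotSystem T α V) (n : ℕ) {K₀ : ℝ}
    (hK₀ : 1 ≤ K₀) : ∃ (s : ℕ) (C δ : ℝ), 1 ≤ C ∧ 0 < δ ∧ ∀ (a b p : ℤ) (Q : ℕ)
      (M z X x t : ℝ) (κ : ℝ → ℝ) (s₀ s₁ : ℕ), Peak T α V a b p Q M z → s₀ ≤ 1 → s₁ ≤ 1 →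
      ContDiff ℝ ∞ κ → (∀ y, stairSum T a b Q z s₁ (κ y) = stairSum T a b Q z s₀ y + t) →
      0 < X → X ≤ M → M ≤ δ → X ≤ K₀ * disp T a b x → (∀ y, |y - x| ≤ X ^ 2 → |κ y - y| ≤ X ^ s) →
      ∀ j ≤ n, |iteratedDeriv j (fun y => κ y - y) x| ≤ C * X := by
  obtain ⟨C₁, hC₁, H₁⟩ := Peak.exists_stairSum_bound S (n + 1) (K := 2 * K₀) (by linarith)
  obtain ⟨c, hc, H₂⟩ := Peak.exists_le_deriv_stairSum V
  obtain ⟨s, C, hC, H₃⟩ := exists_abs_iteratedDeriv_sub_id_le n (2 * (n + 1) + 1) (max C₁ c⁻¹)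
    (hC₁.trans (le_max_left _ _))
  set E := Real.exp (10 * V) with hE
  have hE0 : 0 < E := Real.exp_pos _
  refine ⟨s + 2, C, 1 / (4 * E * K₀), hC, by positivity, ?_⟩
  intro a b p Q M z X x t κ s₀ s₁ h hs₀ hs₁ hκ hconj hX hXM hM hx hclose
  have hM1 : M ≤ 1 := by linarith [h.small, h.pos]
  have hX1 : X ≤ 1 := hXM.trans hM1
  have hpos : ∀ s ≤ 1, ∀ y, 0 < deriv (stairSum T a b Q z s) y := fun s hs y =>
    hc.trans_le (H₂ T α a b p Q M z y s h hs)
  have hdisp : ∀ w, |w - x| ≤ 2 * X ^ 2 → X ≤ 2 * K₀ * disp T a b w := by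
    intro w hw
    have h1 := (abs_le.1 (h.frame.abs_disp_sub_le S x w)).1
    have h2 : X * (4 * E * K₀) ≤ 1 := by
      have := hXM.trans hM
      rwa [le_div_iff₀ (by positivity)] at this
    have h3 : E * |w - x| ≤ E * (2 * X ^ 2) := mul_le_mul_of_nonneg_left hw hE0.le
    have h4 : disp T a b x - E * (2 * X ^ 2) ≤ disp T a b w := by linarith
    have h5 : K₀ * (disp T a b x - E * (2 * X ^ 2)) ≤ K₀ * disp T a b w :=
      mul_le_mul_of_nonneg_left h4 (by linarith)
    have h6 : X * (X * (4 * E * K₀)) ≤ X * 1 := mul_le_mul_of_nonneg_left h2 hX.le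
    nlinarith
  have hsq : ∀ y, |y - x| ≤ X ^ 2 → |κ y - y| ≤ X ^ 2 ∧ |κ y - y| ≤ X ^ s := fun y hy =>
    ⟨(hclose y hy).trans (pow_le_pow_of_le_one hX.le hX1 (by omega)),
      (hclose y hy).trans (pow_le_pow_of_le_one hX.le hX1 (by omega))⟩
  refine H₃ (fun y => stairSum T a b Q z s₀ y + t) (stairSum T a b Q z s₁) κ X x
    ((h.stairSum_smooth s₀).add contDiff_const) (h.stairSum_smooth s₁) hκ (hpos s₁ hs₁) hconj
    hX hX1 fun y hy => ⟨fun i hi hin => ⟨?_, ?_⟩, ?_, (hsq y hy).2⟩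
  · rw [iteratedDeriv_add_const hi]
    exact (H₁ a b p Q M z X s₀ h hs₀ hX hXM y (hdisp y (by nlinarith)) i hi hin).trans
      (le_max_left _ _)
  · refine (H₁ a b p Q M z X s₁ h hs₁ hX hXM (κ y) (hdisp (κ y) ?_) i hi hin).trans
      (le_max_left _ _)
    have := abs_sub_le (κ y) y x
    linarith [(hsq y hy).1]
  · have h1 := H₂ T α a b p Q M z (κ y) s₁ h hs₁
    calc 1 = c⁻¹ * c := (inv_mul_cancel₀ hc.ne').symm
      _ ≤ max C₁ c⁻¹ * deriv (stairSum T a b Q z s₁) (κ y) := by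
        gcongr
        exact le_max_right _ _

lemma Peak.exists_defect_bound {T : ℤ → ℝ → ℝ} {α V : ℝ} (S : RotSystem T α V) (s : ℕ) :
    ∃ C, 1 ≤ C ∧ ∀ (a b p : ℤ) (Q : ℕ) (M R z : ℝ), Peak T α V a b p Q M z →
      (∀ x, 1 ≤ R * disp T a b x) → R ^ (s + 2) * |(Q : ℝ) * α - p| ≤ 1 →
      ∀ x, stairDefect T a b p Q z x ≠ 0 → |stairDefect T a b p Q z x| ≤ C * M ^ s ∧
        M ≤ Real.exp (10 * V) ^ 8 * disp T a b x := by
  obtain ⟨C₁, hC₁, H₁⟩ := Peak.exists_stairDefect_bound V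
  obtain ⟨C₂, hC₂, H₂⟩ := MainFrame.exists_return_le S s
  have hCC := one_le_mul_of_one_le_of_one_le hC₁ hC₂
  refine ⟨C₁ * C₂ * 2, by linarith, fun a b p Q M R z h hR hθ x hx => ?_⟩
  obtain ⟨h1, k, hk⟩ := H₁ T α a b p Q M z x h hx
  refine ⟨?_, h.le_disp hk⟩
  have hM := h.pos
  have hR0 : 0 < R := by
    by_contra! hcon
    nlinarith [hR z, h.sys.disp_pos h.frame.pos z]
  have h2 := H₂ a b p Q M R z h.frame h.le (by linarith [h.small]) hR
    (h.peak.trans (le_mul_of_one_le_left (hM.le.trans h.peak) (MainFrame.one_le_exp S))) _ hk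
  rw [S.disp_sub_int] at h2
  have hRM : 1 ≤ R * M := (hR z).trans (mul_le_mul_of_nonneg_left (h.le z) hR0.le)
  have h3 : R * |(Q : ℝ) * α - p| ≤ M ^ (s + 1) := by
    have h4 : 1 ≤ (R * M) ^ (s + 1) := one_le_pow₀ hRM
    have h5 : R ^ (s + 1) * (R * |(Q : ℝ) * α - p|) ≤ R ^ (s + 1) * M ^ (s + 1) := by
      rw [← mul_pow, ← mul_assoc, ← pow_succ]
      exact hθ.trans h4
    exact le_of_mul_le_mul_left h5 (by positivity)
  have h6 : |stairDefect T a b p Q z x| * M ≤ C₁ * C₂ * 2 * M ^ s * M := by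
    refine h1.trans ?_
    calc C₁ * |disp T Q p x| ≤ C₁ * (C₂ * (M ^ (s + 1) + M ^ (s + 1))) := by
          gcongr
          refine h2.trans ?_
          gcongr
      _ = _ := by ring
  exact le_of_mul_le_mul_right h6 hM

lemma exists_conjugacy {T : ℤ → ℝ → ℝ} {α V : ℝ} (S : RotSystem T α V) (hL : Liouville α) (n : ℕ)
    {ε : ℝ} (hε : 0 < ε) : ∃ (Q : ℕ) (h k k' : ℝ → ℝ), 1 ≤ Q ∧ ContDiff ℝ ∞ h ∧
      (∀ x, 0 < deriv h x) ∧ (∀ x, h (x + 1) = h x + Q) ∧ ContDiff ℝ ∞ k ∧ ContDiff ℝ ∞ k' ∧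
      (∀ x, k (k' x) = x) ∧ (∀ x, k' (k x) = x) ∧ (∀ x, h (T 1 (k x)) = h x + Q * α) ∧
      ∀ j ≤ n, ∀ x, |iteratedDeriv j (fun y => k y - y) x| ≤ ε ∧
        |iteratedDeriv j (fun y => k' y - y) x| ≤ ε := by
  set E := Real.exp (10 * V) with hE
  have hE1 : 1 ≤ E := MainFrame.one_le_exp S
  have hE0 : 0 < E := Real.exp_pos _
  obtain ⟨s, C, δ, hC, hδ, H₁⟩ := Peak.exists_transition_bound S n (K₀ := 2 * E ^ 8)
    (by linarith [one_le_pow₀ (n := 8) hE1])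
  obtain ⟨C₁, hC₁, H₂⟩ := Peak.exists_defect_bound S (s + 1)
  obtain ⟨c, hc, H₃⟩ := Peak.exists_le_deriv_stairSum V
  obtain ⟨A, HA⟩ := exists_mainFrame S hL
  set ε₁ := min (min (1 / 7) δ) (min (min (c / (1 + C₁)) (ε / C)) (1 / (4 * E ^ 9))) with hε₁
  have hε₁0 : 0 < ε₁ := by positivity
  obtain ⟨a, b, p, Q, F, hR, hM, hθ⟩ := HA (A * (s + 3)) ε₁ hε₁0
  set R : ℝ := (Q : ℝ) ^ A with hRdef
  obtain ⟨z, hz⟩ := exists_isMax_of_periodic (S.disp_smooth a b).continuous (S.disp_add_one a b)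
  set M := disp T a b z with hMdef
  have hMε : M ≤ ε₁ := hM z
  have hM7 : M ≤ 1 / 7 := hMε.trans ((min_le_left _ _).trans (min_le_left _ _))
  have hMδ : M ≤ δ := hMε.trans ((min_le_left _ _).trans (min_le_right _ _))
  have hMr : M ≤ min (min (c / (1 + C₁)) (ε / C)) (1 / (4 * E ^ 9)) :=
    hMε.trans (min_le_right _ _)
  have hMc : M ≤ c / (1 + C₁) := hMr.trans ((min_le_left _ _).trans (min_le_left _ _))
  have hMC : M ≤ ε / C := hMr.trans ((min_le_left _ _).trans (min_le_right _ _))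
  have hME : M ≤ 1 / (4 * E ^ 9) := hMr.trans (min_le_right _ _)
  rw [le_div_iff₀ (by positivity)] at hMc hMC hME
  have h : Peak T α V a b p Q M z := ⟨S, F, hz, le_rfl, by linarith⟩
  have hM0 := h.pos
  have hQ0 : 0 < Q := F.one_le
  have hR0 : 0 < R := by positivity
  set θ := |(Q : ℝ) * α - p| with hθdef
  have hθ' : R ^ (s + 3) * θ ≤ 1 := by rw [hRdef, ← pow_mul]; exact hθ.le
  have hRM : 1 ≤ R * M := (hR z).trans (mul_le_mul_of_nonneg_left (h.le z) hR0.le)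
  have hXM : R⁻¹ ≤ M := by rw [inv_le_iff_one_le_mul₀ hR0]; linarith
  have hR1 : 1 ≤ R := one_le_pow₀ (by exact_mod_cast hQ0)
  have hθX : θ ≤ R⁻¹ ^ (s + 1) := by
    have h1 : R ^ (s + 1) * θ ≤ R ^ (s + 3) * θ := mul_le_mul_of_nonneg_right
      (pow_le_pow_right₀ hR1 (by omega)) (abs_nonneg _)
    rw [inv_pow, ← one_div, le_div_iff₀' (by positivity)]
    exact h1.trans hθ'
  set u := stairSum T a b Q z 0 with hu
  set v := stairSum T a b Q z 1 with hv
  have hus : ContDiff ℝ ∞ u := h.stairSum_smooth 0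
  have hvs : ContDiff ℝ ∞ v := h.stairSum_smooth 1
  have hud : ∀ x, c ≤ deriv u x := fun x => H₃ T α a b p Q M z x 0 h (by norm_num)
  have hvd : ∀ x, c ≤ deriv v x := fun x => H₃ T α a b p Q M z x 1 h le_rfl
  obtain ⟨u', hu's, huu', hu'u⟩ := exists_smooth_inverse hus (fun x => hc.trans_le (hud x))
    (q := Q) (by positivity) (S.stairSum_add_one a b Q z 0)
  obtain ⟨v', hv's, hvv', hv'v⟩ := exists_smooth_inverse hvs (fun x => hc.trans_le (hvd x))
    (q := Q) (by positivity) (S.stairSum_add_one a b Q z 1)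
  have hvu : ∀ x, v x = u x + p + stairDefect T a b p Q z x := S.stairSum_one_eq a b p Q z
  set k : ℝ → ℝ := fun x => v' (u x + Q * α) with hk
  set k' : ℝ → ℝ := fun x => u' (v x + -(Q * α)) with hk'
  have hks : ContDiff ℝ ∞ k := hv's.comp (hus.add contDiff_const)
  have hk's : ContDiff ℝ ∞ k' := hu's.comp (hvs.add contDiff_const)
  have hvk : ∀ x, v (k x) = u x + Q * α := fun x => hvv' _
  have huk' : ∀ x, u (k' x) = v x + -(Q * α) := fun x => huu' _
  have hkc : ∀ y, c * |k y - y| ≤ θ + |stairDefect T a b p Q z y| := by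
    intro y
    refine (le_abs_sub_of_deriv_ge hvs hvd y (k y)).trans ?_
    rw [hvk, hvu]
    refine le_trans (le_of_eq ?_) (abs_sub (Q * α - p) (stairDefect T a b p Q z y))
    congr 1
    ring
  have hk'c : ∀ y, c * |k' y - y| ≤ θ + |stairDefect T a b p Q z y| := by
    intro y
    refine (le_abs_sub_of_deriv_ge hus hud y (k' y)).trans ?_
    rw [huk', hvu, ← abs_sub_comm]
    refine le_trans (le_of_eq ?_) (abs_sub (Q * α - p) (stairDefect T a b p Q z y))
    congr 1
    ring
  have main : ∀ x (κ : ℝ → ℝ) (t : ℝ) (s₀ s₁ : ℕ), s₀ ≤ 1 → s₁ ≤ 1 → ContDiff ℝ ∞ κ →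
      (∀ y, stairSum T a b Q z s₁ (κ y) = stairSum T a b Q z s₀ y + t) →
      (∀ y, c * |κ y - y| ≤ θ + |stairDefect T a b p Q z y|) →
      ∀ j ≤ n, |iteratedDeriv j (fun y => κ y - y) x| ≤ ε := by
    intro x κ t s₀ s₁ hs₀ hs₁ hκ hconj hκc j hj
    have hdef := H₂ a b p Q M R z h hR hθ'
    rcases le_or_gt M (2 * E ^ 8 * disp T a b x) with hnear | hfar
    · have h1 := H₁ a b p Q M z M x t κ s₀ s₁ h hs₀ hs₁ hκ hconj hM0 le_rfl hMδ hnear (by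
        intro y _
        have h2 : |stairDefect T a b p Q z y| ≤ C₁ * M ^ (s + 1) := by
          by_cases h0 : stairDefect T a b p Q z y = 0
          · rw [h0, abs_zero]; positivity
          · exact (hdef y h0).1
        have h3 : θ ≤ M ^ (s + 1) := hθX.trans (pow_le_pow_left₀ (by positivity) hXM _)
        have h4 := hκc y
        have h5 : M ^ s * (M * (1 + C₁)) ≤ M ^ s * c :=
          mul_le_mul_of_nonneg_left hMc (by positivity)
        refine le_of_mul_le_mul_left (a := c) ?_ hc
        rw [pow_succ] at h2 h3
        nlinarith) j hj
      linarith
    · have hX0 : 0 < R⁻¹ := by positivity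
      have hX1 : R⁻¹ ≤ disp T a b x := by
        rw [inv_le_iff_one_le_mul₀ hR0]; linarith [hR x]
      have h1 := H₁ a b p Q M z R⁻¹ x t κ s₀ s₁ h hs₀ hs₁ hκ hconj hX0 hXM hMδ
        (hX1.trans (le_mul_of_one_le_left (hX0.le.trans hX1)
          (by linarith [one_le_pow₀ (n := 8) hE1]))) (by
        intro y hy
        have h0 : stairDefect T a b p Q z y = 0 := by
          by_contra h0
          have h2 := (hdef y h0).2
          have h3 := (abs_le.1 (F.abs_disp_sub_le S x y)).2
          have h4 : E * |y - x| ≤ E * M ^ 2 := mul_le_mul_of_nonneg_left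
            (hy.trans (pow_le_pow_left₀ hX0.le hXM 2)) hE0.le
          have h5 : E ^ 8 * disp T a b y ≤ E ^ 8 * (disp T a b x + E * M ^ 2) :=
            mul_le_mul_of_nonneg_left (by linarith) (by positivity)
          have h6 : M * (M * (4 * E ^ 9)) ≤ M * 1 := mul_le_mul_of_nonneg_left hME hM0.le
          have h7 : E ^ 8 * (E * M ^ 2) = M * (M * (4 * E ^ 9)) / 4 := by ring
          linarith
        have h4 := hκc y
        rw [h0, abs_zero, add_zero] at h4
        have h5 : R⁻¹ ≤ c := by nlinarith
        refine le_of_mul_le_mul_left (a := c) (h4.trans (hθX.trans ?_)) hc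
        rw [pow_succ, mul_comm]
        exact mul_le_mul_of_nonneg_right h5 (by positivity)) j hj
      nlinarith
  refine ⟨Q, u, k, k', hQ0, hus, fun x => hc.trans_le (hud x), S.stairSum_add_one a b Q z 0, hks,
    hk's, fun x => ?_, fun x => ?_, fun x => ?_, fun j hj x => ⟨?_, ?_⟩⟩
  · simp only [hk]; rw [huk', neg_add_cancel_right, hv'v]
  · simp only [hk']; rw [hvk, add_neg_cancel_right, hu'u]
  · rw [hu, ← S.stairSum_one, ← hv, hvk]
  · exact main x k (Q * α) 0 1 (by norm_num) le_rfl hks hvk hkc j hj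
  · exact main x k' (-(Q * α)) 1 0 le_rfl (by norm_num) hk's huk' hk'c j hj

/-! ### Approximation by smooth conjugates of the rotation -/

lemma volume_preimage_coe_eq_zero_iff {N : Set UnitAddCircle} (hN : MeasurableSet N) :
    volume ((fun x : ℝ => (x : UnitAddCircle)) ⁻¹' N) = 0 ↔ volume N = 0 := by
  have key (t : ℝ) : volume ((fun x : ℝ => (x : UnitAddCircle)) ⁻¹' N ∩ Set.Ioc t (t + 1)) =
      volume N := by
    have h := (UnitAddCircle.measurePreserving_mk t).measure_preimage hN.nullMeasurableSet
    rwa [Measure.restrict_apply (hN.preimage AddCircle.measurable_mk')] at h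
  refine ⟨fun h => ?_, fun h => ?_⟩
  · rw [← key 0]
    exact measure_mono_null Set.inter_subset_left h
  · have h1 : (fun x : ℝ => (x : UnitAddCircle)) ⁻¹' N ⊆
        ⋃ n : ℤ, (fun x : ℝ => (x : UnitAddCircle)) ⁻¹' N ∩ Set.Ioc (n : ℝ) (n + 1) := by
      rw [← Set.inter_iUnion, iUnion_Ioc_intCast, Set.inter_univ]
    exact measure_mono_null h1 (measure_iUnion_null fun n => (key n).trans h)

lemma exists_circleMap {u : ℝ → ℝ} (hu : Continuous u) (hp : ∀ x, u (x + 1) = u x + 1) :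
    ∃ F : UnitAddCircle → UnitAddCircle, Measurable F ∧ ∀ x : ℝ, F x = u x := by
  have hper : Function.Periodic (fun x : ℝ => (u x : UnitAddCircle)) 1 := fun x => by
    simp only [hp]
    exact AddCircle.coe_add_period 1 (u x)
  refine ⟨hper.lift, Continuous.measurable ?_, fun x => hper.lift_coe x⟩
  exact continuous_coinduced_dom.2 ((AddCircle.continuous_mk' 1).comp hu)

/-- A circle map smoothly conjugate to a rotation has an invariant measure equivalent to the
Lebesgue measure. -/
lemma exists_invariant_measure_of_conj {f w v : ℝ → ℝ} {a : ℝ} (hf : Continuous f)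
    (hfp : ∀ x, f (x + 1) = f x + 1) (hw : Differentiable ℝ w) (hwp : ∀ x, w (x + 1) = w x + 1)
    (hv : Differentiable ℝ v) (hwv : ∀ x, w (v x) = x) (hvw : ∀ x, v (w x) = x)
    (hfw : ∀ x, f (w x) = w (x + a)) :
    ∃ F : UnitAddCircle → UnitAddCircle, Measurable F ∧ (∀ x : ℝ, F x = f x) ∧
      ∃ μ : Measure UnitAddCircle, IsProbabilityMeasure μ ∧
        Measure.map F μ = μ ∧ μ ≪ volume ∧ volume ≪ μ := by
  obtain ⟨F, hFm, hF⟩ := exists_circleMap hf hfp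
  obtain ⟨W, hWm, hW⟩ := exists_circleMap hw.continuous hwp
  have hpre (N : Set UnitAddCircle) : (fun x : ℝ => (x : UnitAddCircle)) ⁻¹' (W ⁻¹' N) =
      w ⁻¹' ((fun x : ℝ => (x : UnitAddCircle)) ⁻¹' N) := by
    ext x; simp [hW]
  have hFW : F ∘ W = W ∘ fun x => x + (a : UnitAddCircle) := by
    funext x
    obtain ⟨x, rfl⟩ := QuotientAddGroup.mk_surjective x
    change F (W (x : ℝ)) = W ((x : UnitAddCircle) + (a : UnitAddCircle))
    rw [hW, hF, hfw, ← AddCircle.coe_add, hW]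
  have : IsProbabilityMeasure (volume : Measure UnitAddCircle) := ⟨UnitAddCircle.measure_univ⟩
  refine ⟨F, hFm, hF, Measure.map W volume, Measure.isProbabilityMeasure_map hWm.aemeasurable,
    ?_, ?_, ?_⟩
  · rw [Measure.map_map hFm hWm, hFW, ← Measure.map_map hWm (measurable_add_const _),
      map_add_right_eq_self]
  · refine Measure.AbsolutelyContinuous.mk fun N hN h0 => ?_
    rw [Measure.map_apply hWm hN, ← volume_preimage_coe_eq_zero_iff (hWm hN), hpre,
      ← Set.image_eq_preimage_of_inverse hwv hvw]
    exact addHaar_image_eq_zero_of_differentiableOn_of_addHaar_eq_zero _ hv.differentiableOn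
      ((volume_preimage_coe_eq_zero_iff hN).2 h0)
  · refine Measure.AbsolutelyContinuous.mk fun N hN h0 => ?_
    rw [Measure.map_apply hWm hN, ← volume_preimage_coe_eq_zero_iff (hWm hN), hpre] at h0
    rw [← volume_preimage_coe_eq_zero_iff hN,
      ← Set.image_preimage_eq ((fun x : ℝ => (x : UnitAddCircle)) ⁻¹' N)
        (fun x => ⟨v x, hwv x⟩ : Function.Surjective w)]
    exact addHaar_image_eq_zero_of_differentiableOn_of_addHaar_eq_zero _ hw.differentiableOn h0

lemma Liouville.add_int {α : ℝ} (h : Liouville α) (k : ℤ) : Liouville (α + k) := by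
  intro n
  obtain ⟨p, q, hq, hne, hlt⟩ := h n
  have hq0 : (q : ℝ) ≠ 0 := by
    have : q ≠ 0 := by lia
    exact_mod_cast this
  have e : ((p + k * q : ℤ) : ℝ) / q = p / q + k := by
    push_cast; field_simp
  refine ⟨p + k * q, q, hq, ?_, ?_⟩
  · rw [e]; exact fun h => hne (by linarith)
  · rwa [e, add_sub_add_right_eq_sub]

/-- The integer iterates of a lift with irrational translation number form a `RotSystem`. -/
lemma exists_rotSystem {g g' : ℝ → ℝ} {a : ℝ} (hg : ContDiff ℝ ∞ g)
    (hgp : ∀ x, g (x + 1) = g x + 1) (hgd : ∀ x, 0 < deriv g x) (hg' : ContDiff ℝ ∞ g')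
    (hgg' : ∀ x, g (g' x) = x) (hg'g : ∀ x, g' (g x) = x) (ha : Irrational a)
    (hlim : Tendsto (fun n : ℕ => g^[n] 0 / (n : ℝ)) atTop (𝓝 a)) :
    ∃ (T : ℤ → ℝ → ℝ) (V : ℝ), RotSystem T a V ∧ (∀ x, T 1 x = g x) := by
  have hgm : StrictMono g := strictMono_of_deriv_pos hgd
  let e : Equiv.Perm ℝ := ⟨g, g', hg'g, hgg'⟩
  have h0 : ∀ x, (e ^ (0 : ℤ)) x = x := fun x => by simp
  have hS : ∀ (i : ℤ) x, (e ^ (i + 1)) x = g ((e ^ i) x) := fun i x => by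
    rw [add_comm, zpow_add, zpow_one]; rfl
  have hP : ∀ (i : ℤ) x, (e ^ (i - 1)) x = g' ((e ^ i) x) := fun i x => by
    rw [sub_eq_neg_add, zpow_add, zpow_neg_one]; rfl
  have h1 : ∀ x, (e ^ (1 : ℤ)) x = g x := fun x => by rw [zpow_one]; rfl
  have hg'p : ∀ x, g' (x + 1) = g' x + 1 := fun x =>
    hgm.injective (by rw [hgg', hgp, hgg'])
  have hg'd : ∀ x, 0 < deriv g' x := fun x => by
    have h2 : HasDerivAt (fun y => g (g' y)) (deriv g (g' x) * deriv g' x) x :=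
      (hg.infty_differentiable _).hasDerivAt.comp x (hg'.infty_differentiable _).hasDerivAt
    have h3 : deriv g (g' x) * deriv g' x = 1 := by
      rw [← h2.deriv]; simp [hgg']
    exact pos_of_mul_pos_right (by rw [h3]; exact one_pos) (hgd _).le
  have hcomp {u v : ℝ → ℝ} (hu : ContDiff ℝ ∞ u) (hv : ContDiff ℝ ∞ v)
      (hud : ∀ x, 0 < deriv u x) (hvd : ∀ x, 0 < deriv v x) (x : ℝ) :
      0 < deriv (fun y => u (v y)) x := by
    have h2 : HasDerivAt (fun y => u (v y)) (deriv u (v x) * deriv v x) x :=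
      (hu.infty_differentiable _).hasDerivAt.comp x (hv.infty_differentiable _).hasDerivAt
    rw [h2.deriv]; exact mul_pos (hud _) (hvd _)
  have hind : ∀ i : ℤ, ContDiff ℝ ∞ (e ^ i : Equiv.Perm ℝ) ∧
      (∀ x, 0 < deriv (e ^ i : Equiv.Perm ℝ) x) ∧ ∀ x, (e ^ i) (x + 1) = (e ^ i) x + 1 := by
    intro i
    induction i using Int.induction_on with
    | zero =>
      have h : ⇑(e ^ (0 : ℤ)) = fun x => x := funext h0
      rw [h]
      exact ⟨contDiff_id, fun x => by simp, fun x => rfl⟩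
    | succ i ih =>
      have h : ⇑(e ^ ((i : ℤ) + 1)) = fun x => g ((e ^ (i : ℤ)) x) := funext (hS i)
      rw [h]
      exact ⟨hg.comp ih.1, hcomp hg ih.1 hgd ih.2.1, fun x => by simp only [ih.2.2, hgp]⟩
    | pred i ih =>
      have h : ⇑(e ^ (-(i : ℤ) - 1)) = fun x => g' ((e ^ (-(i : ℤ))) x) := funext (hP (-i))
      rw [h]
      exact ⟨hg'.comp ih.1, hcomp hg' ih.1 hg'd ih.2.1, fun x => by simp only [ih.2.2, hg'p]⟩
  have hsemi : ∃ H : ℝ → ℝ, Monotone H ∧ (∀ x, H (x + 1) = H x + 1) ∧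
      ∀ x, H (g x) = H x + a := by
    let G : CircleDeg1Lift := ⟨⟨g, hgm.monotone⟩, hgp⟩
    let R : CircleDeg1Lift := CircleDeg1Lift.translate (Multiplicative.ofAdd a)
    have hG : G.translationNumber = a := by
      refine CircleDeg1Lift.translationNumber_eq_of_tendsto₀ G hlim
    have hR : R.translationNumber = a := CircleDeg1Lift.translationNumber_translate a
    have hGb : Function.Bijective G := e.bijective
    have hRb : Function.Bijective R := CircleDeg1Lift.isUnit_iff_bijective.1 (Units.isUnit _)
    obtain ⟨H, hH⟩ := CircleDeg1Lift.semiconj_of_bijective_of_translationNumber_eq hGb hRb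
      (hG.trans hR.symm)
    exact ⟨H, H.monotone, H.map_add_one, fun x => (hH x).trans (add_comm _ _)⟩
  obtain ⟨H, hHm, hHp, hHg⟩ := hsemi
  have hHT : ∀ (i : ℤ) x, H ((e ^ i) x) = H x + i * a := by
    intro i x
    induction i using Int.induction_on with
    | zero => simp
    | succ i ih => rw [hS, hHg, ih]; push_cast; ring
    | pred i ih =>
      have h := hHg (g' ((e ^ (-(i : ℤ))) x))
      rw [hgg', ih] at h
      rw [hP]; push_cast at h ⊢; linarith
  have hlog : ContDiff ℝ ∞ (fun x => Real.log (deriv g x)) :=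
    hg.infty_of_deriv.log fun x => (hgd x).ne'
  have hdp : ∀ x, deriv g (x + 1) = deriv g x := fun x => by
    rw [← deriv_comp_add_const, show (fun y => g (y + 1)) = fun y => g y + 1 from funext hgp,
      deriv_add_const]
  have hlp : ∀ x, Real.log (deriv g (x + 1)) = Real.log (deriv g x) := fun x => by rw [hdp]
  obtain ⟨K, hK1, hK⟩ := exists_bound_iteratedDeriv hlog hlp 1
  refine ⟨fun i => ⇑(e ^ i), K, ⟨h0, fun i j x => by rw [zpow_add]; rfl, fun i => (hind i).2.2,
    fun i => (hind i).1, fun i => (hind i).2.1, ⟨H, hHm, hHp, hHT⟩, ha, hK1, ?_⟩, h1⟩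
  intro x y
  rw [show ⇑(e ^ (1 : ℤ)) = g from funext h1]
  refine Convex.norm_image_sub_le_of_norm_deriv_le (𝕜 := ℝ) (s := Set.univ)
    (f := fun x => Real.log (deriv g x)) (fun z _ => hlog.infty_differentiable z)
    (fun z _ => ?_) convex_univ (Set.mem_univ y) (Set.mem_univ x)
  simpa using hK 1 le_rfl z

lemma exists_bound_iteratedDeriv_of_add_one {g : ℝ → ℝ} (hg : ContDiff ℝ ∞ g)
    (hgp : ∀ x, g (x + 1) = g x + 1) (i : ℕ) (hi : 1 ≤ i) :
    ∃ C, ∀ x, |iteratedDeriv i g x| ≤ C := by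
  obtain ⟨K, -, hK⟩ := exists_bound_iteratedDeriv (f := fun y => g y - y) (hg.sub contDiff_id)
    (fun x => by rw [hgp]; ring) i
  refine ⟨K + 1, fun x => ?_⟩
  have h1 := hK i le_rfl x
  rw [iteratedDeriv_sub_id hg] at h1
  have h2 := abs_iteratedDeriv_id_le hi x
  rw [abs_le] at *
  constructor <;> linarith

lemma tendsto_iterate_div_of_conj {f h : ℝ → ℝ} {a q : ℝ} (hh : Continuous h) (hq : 0 < q)
    (hp : ∀ x, h (x + 1) = h x + q) (hf : ∀ x, h (f x) = h x + q * a) :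
    Tendsto (fun n : ℕ => f^[n] 0 / (n : ℝ)) atTop (𝓝 a) := by
  obtain ⟨K, -, hK⟩ := exists_bound_of_periodic (f := fun x => h x - q * x)
    (hh.sub (continuous_const.mul continuous_id)) (fun x => by rw [hp]; ring)
  have hn : ∀ n : ℕ, h (f^[n] 0) = h 0 + n * (q * a) := fun n => by
    induction n with
    | zero => simp
    | succ n ih => rw [Function.iterate_succ_apply', hf, ih]; push_cast; ring
  rw [tendsto_iff_norm_sub_tendsto_zero]
  refine squeeze_zero' (Eventually.of_forall fun _ => norm_nonneg _)
    ((eventually_gt_atTop 0).mono fun n h0 => ?_)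
    (tendsto_const_div_atTop_nhds_zero_nat ((K + |h 0|) / q))
  have h0' : (0 : ℝ) < n := by exact_mod_cast h0
  have e : f^[n] 0 / (n : ℝ) - a = (f^[n] 0 - n * a) / n := by field_simp
  rw [e, Real.norm_eq_abs, abs_div, abs_of_pos h0']
  refine div_le_div_of_nonneg_right ?_ h0'.le
  rw [le_div_iff₀ hq]
  have h1 := hK (f^[n] 0)
  simp only [hn] at h1
  nth_rewrite 1 [← abs_of_pos hq]
  rw [← abs_mul]
  have h2 := le_abs_self (h 0)
  have h3 := neg_abs_le (h 0)
  rw [abs_le] at h1 ⊢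
  constructor <;> linarith

lemma CrNorm_le {r : ℕ} {φ : ℝ → ℝ} {c : ℝ} (h : ∀ j ≤ r, ∀ x, |iteratedDeriv j φ x| ≤ c) :
    CrNorm r φ ≤ c :=
  Finset.sup'_le _ _ fun j hj => ciSup_le fun x =>
    h j (Nat.lt_succ_iff.1 (Finset.mem_range.1 hj)) x

lemma invFun_eq_of_inverse {u v : ℝ → ℝ} (huv : ∀ x, u (v x) = x) (hvu : ∀ x, v (u x) = x) :
    Function.invFun u = v :=
  Function.LeftInverse.eq_rightInverse
    (Function.leftInverse_invFun (Function.LeftInverse.injective hvu)) huv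

/-- For a Liouville number `α ∈ (0,1)`, type `II₁` diffeomorphisms are `C^∞`-dense in
the set of smooth circle diffeomorphisms with rotation number `α`. -/
theorem stmt_0 (α : ℝ) (hα0 : 0 < α) (hα1 : α < 1) (hL : Liouville α)
    (g : ℝ → ℝ) (hg : IsCircleDiffeoLift g) (hρg : HasRotationNumber g α)
    (r : ℕ) (ε : ℝ) (hε : 0 < ε) :
    ∃ f : ℝ → ℝ, IsCircleDiffeoLift f ∧ HasRotationNumber f α ∧
      liftDist r f g < ε ∧
      ∃ F : UnitAddCircle → UnitAddCircle, Measurable F ∧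
        (∀ x : ℝ, F ↑x = ↑(f x)) ∧
        ∃ μ : Measure UnitAddCircle, IsProbabilityMeasure μ ∧
          Measure.map F μ = μ ∧ μ ≪ volume ∧ volume ≪ μ := by
  obtain ⟨hgs, hgp, hgd⟩ := hg
  obtain ⟨m, hm⟩ := hρg
  obtain ⟨g', hg's, hgg', hg'g⟩ := exists_smooth_inverse hgs hgd one_pos hgp
  have hLm := hL.add_int m
  obtain ⟨T, V, S, hT⟩ := exists_rotSystem hgs hgp hgd hg's hgg' hg'g hLm.irrational hm
  have hg'p : ∀ x, g' (x + 1) = g' x + 1 := fun x => by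
    rw [← hg'g (g' x + 1), hgp, hgg']
  have hε2 : 0 < ε / 2 := half_pos hε
  obtain ⟨δ₁, hδ₁, H₁⟩ := exists_abs_iteratedDeriv_comp_sub_le hgs
    (exists_bound_iteratedDeriv_of_add_one hgs hgp) r hε2
  obtain ⟨δ₂, hδ₂, H₂⟩ := exists_abs_iteratedDeriv_comp_le hg's
    (exists_bound_iteratedDeriv_of_add_one hg's hg'p) r hε2
  obtain ⟨Q, h, k, k', hQ, hhs, hhd, hhp, hks, hk's, hkk', hk'k, hconj, hb⟩ :=
    exists_conjugacy S hLm (r + 1) (lt_min hδ₁ hδ₂)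
  simp only [hT] at hconj
  have hQ0 : (0 : ℝ) < Q := by exact_mod_cast hQ
  have hhi : Function.Injective h := (strictMono_of_deriv_pos hhd).injective
  have hfs : ContDiff ℝ ∞ (fun x => g (k x)) := hgs.comp hks
  have hfp : ∀ x, g (k (x + 1)) = g (k x) + 1 := fun x => hhi <| by
    rw [hconj, hhp, hhp, hconj]; ring
  have hfd : ∀ x, 0 < deriv (fun x => g (k x)) x := fun x => by
    have h1 : HasDerivAt (fun y => h (g (k y)))
        (deriv h (g (k x)) * deriv (fun y => g (k y)) x) x :=
      (hhs.infty_differentiable _).hasDerivAt.comp x (hfs.infty_differentiable _).hasDerivAt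
    have h2 : deriv (fun y => h (g (k y))) x = deriv h x := by
      simp only [hconj, deriv_add_const]
    rw [h1.deriv] at h2
    exact pos_of_mul_pos_right (h2 ▸ hhd x) (hhd _).le
  obtain ⟨w, hws, hhw, hwh⟩ := exists_smooth_inverse hhs hhd hQ0 hhp
  refine ⟨fun x => g (k x), ⟨hfs, hfp, hfd⟩,
    ⟨m, tendsto_iterate_div_of_conj hhs.continuous hQ0 hhp hconj⟩, ?_, ?_⟩
  · have e1 : Function.invFun (fun x => g (k x)) = fun x => k' (g' x) :=
      invFun_eq_of_inverse (fun x => by simp only [hkk', hgg'])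
        (fun x => by simp only [hg'g, hk'k])
    have e2 : Function.invFun g = g' := invFun_eq_of_inverse hgg' hg'g
    refine lt_of_le_of_lt (max_le (CrNorm_le fun j hj x => ?_) (CrNorm_le fun j hj x => ?_))
      (half_lt_self hε)
    · exact H₁ k hks (fun y i hi => (hb i hi y).1.trans (min_le_left _ _)) x j hj
    · rw [e1, e2]
      exact H₂ (fun y => k' y - y) (hk's.sub contDiff_id)
        (fun y i hi => (hb i (hi.trans r.le_succ) y).2.trans (min_le_right _ _)) x j hj
  · refine exists_invariant_measure_of_conj (w := fun x => w (Q * x)) (v := fun x => h x / Q)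
      (a := α + m) hfs.continuous hfp
      (hws.infty_differentiable.comp (differentiable_id.const_mul _)) (fun x => hhi ?_)
      (hhs.infty_differentiable.div_const _) (fun x => ?_) (fun x => ?_) (fun x => hhi ?_)
    · rw [hhp, hhw, hhw]; ring
    · simp only [mul_div_cancel₀ _ hQ0.ne', hwh]
    · simp only [hhw, mul_div_cancel_left₀ _ hQ0.ne']
    · rw [hconj, hhw, hhw]; ring
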